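/- arXiv:2410.01049 — 3 statements merged into one kernel-verified Lean document; each statement's English description precedes it below -/
import Mathlib

section
/- Every cubic graph has list normal chromatic index at most 10: for any list assignment giving each edge at least 10 colors, a normal edge-coloring can be chosen from the lists. -/
open SimpleGraph

/-- Two edges (as elements of `Sym2 V`) are adjacent: distinct and sharing an endvertex. -/
def EdgeAdj {V : Type*} (e f : Sym2 V) : Prop := e ≠ f ∧ ∃ v, v ∈ e ∧ v ∈ f

/-- Two edges are at distance at most 2 in `G`: adjacent, or both adjacent to a common edge. -/
def DistLE2 {V : Type*} (G : SimpleGraph V) (e f : Sym2 V) : Prop :=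
  EdgeAdj e f ∨ ∃ g ∈ G.edgeSet, EdgeAdj e g ∧ EdgeAdj g f

/-- A strong edge-coloring: any two distinct edges at distance at most 2 get distinct colors. -/
def IsStrongEdgeColoring {V : Type*} (G : SimpleGraph V) {C : Type*} (φ : Sym2 V → C) : Prop :=
  ∀ e ∈ G.edgeSet, ∀ f ∈ G.edgeSet, DistLE2 G e f → φ e ≠ φ f

/-- A proper edge-coloring: adjacent edges get distinct colors. -/
def IsProperEdgeColoring {V : Type*} (G : SimpleGraph V) {C : Type*} (φ : Sym2 V → C) : Prop :=
  ∀ e ∈ G.edgeSet, ∀ f ∈ G.edgeSet, EdgeAdj e f → φ e ≠ φ f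

/-- An edge is rich: its adjacent edges carry 4 distinct colors. -/
def IsRich {V : Type*} (G : SimpleGraph V) {C : Type*} (φ : Sym2 V → C) (e : Sym2 V) : Prop :=
  (φ '' {f | f ∈ G.edgeSet ∧ EdgeAdj e f}).ncard = 4

/-- An edge is poor: its adjacent edges carry exactly 2 distinct colors. -/
def IsPoor {V : Type*} (G : SimpleGraph V) {C : Type*} (φ : Sym2 V → C) (e : Sym2 V) : Prop :=
  (φ '' {f | f ∈ G.edgeSet ∧ EdgeAdj e f}).ncard = 2

/-- A normal edge-coloring: proper, and every edge is rich or poor. -/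
def IsNormalEdgeColoring {V : Type*} (G : SimpleGraph V) {C : Type*} (φ : Sym2 V → C) : Prop :=
  IsProperEdgeColoring G φ ∧ ∀ e ∈ G.edgeSet, IsRich G φ e ∨ IsPoor G φ e


namespace AT

/-- Evaluate `x` to a literal before passing it on. -/
def force {α : Type} (x : ℕ) (f : ℕ → α) : α :=
  Nat.rec (motive := fun _ => α) (f 0) (fun n _ => f (n + 1)) x

theorem force_eq {α : Type} (x : ℕ) (f : ℕ → α) : force x f = f x := by
  cases x <;> rfl

abbrev St := List (ℕ × ℕ)

def rapp (A acc : St) : St :=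
  List.rec (motive := fun _ => St → St) (fun acc => acc) (fun x _ ih acc => ih (x :: acc)) A acc

def mrg (n : ℕ) : St → St → St → St :=
  Nat.rec (motive := fun _ => St → St → St → St) (fun A B acc => A ++ (B ++ acc))
    (fun _ ih A B acc =>
      List.rec (motive := fun _ => St) (rapp B acc)
        (fun x A' _ => List.rec (motive := fun _ => St) (rapp A acc)
          (fun y B' _ =>
            bif Nat.beq x.1 y.1 then
              force ((x.2 + y.2) % 1009) fun s =>
                bif Nat.beq s 0 then ih A' B' acc else ih A' B' ((x.1, s) :: acc)
            else bif Nat.ble x.1 y.1 then ih A B' (y :: acc) else ih A' B (x :: acc)) B) A) n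

def psh (c : Bool) (m v : ℕ) (acc : St) (f : St → St) : St :=
  bif c then force m fun m' => force v fun v' => f ((m', v') :: acc) else f acc

def stp (pa ra pb rb : ℕ) (D : St) : St → St → St :=
  List.rec (motive := fun _ => St → St → St) (fun A B => mrg 1000000 A B [])
    (fun x _ ih A B =>
      force (x.1 / pa % 16) fun da => force (x.1 / pb % 16) fun db =>
        psh (Nat.ble 1 da && Nat.ble da (ra + 1) && Nat.ble db rb) (x.1 - pa) x.2 A fun A' =>
        psh (Nat.ble 1 db && Nat.ble db (rb + 1) && Nat.ble da ra) (x.1 - pb) (x.2 * 1008 % 1009) B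
          fun B' => ih A' B') D

def cnt (a : ℕ) (es : List (ℕ × ℕ)) : ℕ :=
  List.rec (motive := fun _ => ℕ) 0
    (fun x _ ih => ih + ((bif Nat.beq x.1 a then 1 else 0) + (bif Nat.beq x.2 a then 1 else 0))) es

def dp (tl : ℕ → ℕ) (es : List (ℕ × ℕ)) : St → St :=
  List.rec (motive := fun _ => St → St) (fun D => D)
    (fun x rest ih D =>
      force (16 ^ x.1) fun pa => force (16 ^ x.2) fun pb =>
      force (cnt x.1 rest + tl x.1) fun ra => force (cnt x.2 rest + tl x.2) fun rb =>
      ih (stp pa ra pb rb D [] [])) es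

/-- final check: the state is `[(0,c)]`, `c ≠ 0`. -/
def fin (D : St) : Bool :=
  List.rec (motive := fun _ => Bool) false
    (fun x D' _ => List.rec (motive := fun _ => Bool) (Nat.beq x.1 0 && Nat.blt 0 x.2 && Nat.blt x.2 1009)
      (fun _ _ _ => false) D') D

end AT

namespace AT
open Classical in
noncomputable def coefR : List (ℕ × ℕ) → (ℕ → ℕ) → ℤ
  | [], t => if t = 0 then 1 else 0
  | (a, b) :: es, t =>
    (if t a = 0 then 0 else coefR es (Function.update t a (t a - 1))) -
    (if t b = 0 then 0 else coefR es (Function.update t b (t b - 1)))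

theorem cnt_cons (a : ℕ) (x : ℕ × ℕ) (es) : cnt a (x :: es) =
    cnt a es + ((if x.1 = a then 1 else 0) + (if x.2 = a then 1 else 0)) := by
  show cnt a es + ((bif Nat.beq x.1 a then 1 else 0) + (bif Nat.beq x.2 a then 1 else 0)) = _
  have h : ∀ u v : ℕ, (bif Nat.beq u v then 1 else 0) = (if u = v then 1 else 0 : ℕ) := by
    intro u v
    by_cases h : u = v
    · simp [h]
    · have : Nat.beq u v = false := by
        cases hb : Nat.beq u v
        · rfl
        · exact absurd (Nat.eq_of_beq_eq_true hb) h
      simp [h, this]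
  rw [h, h]

theorem cnt_append (a : ℕ) (es fs) : cnt a (es ++ fs) = cnt a es + cnt a fs := by
  induction es with
  | nil => simp [cnt]
  | cons x es ih => rw [List.cons_append, cnt_cons, cnt_cons, ih]; ring

theorem coefR_zero (es : List (ℕ × ℕ)) : ∀ (t : ℕ → ℕ) (v : ℕ), cnt v es < t v → coefR es t = 0 := by
  induction es with
  | nil =>
    intro t v h
    have : t ≠ 0 := by rintro rfl; simp at h
    simp [coefR, this]
  | cons x es ih =>
    intro t v h
    obtain ⟨a, b⟩ := x
    rw [cnt_cons] at h
    have key : ∀ c, (c = a ∨ c = b) → (if t c = 0 then 0 else coefR es (Function.update t c (t c - 1))) = 0 := by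
      intro c hc
      split_ifs with h0
      · rfl
      · apply ih _ v
        by_cases hv : v = c
        · subst hv
          simp only [Function.update_self]
          rcases hc with rfl | rfl <;> simp at h <;> omega
        · rw [Function.update_of_ne hv]; omega
    simp only [coefR]
    rw [key a (Or.inl rfl), key b (Or.inr rfl)]; simp

theorem digit_sub (m a b : ℕ) (h : 1 ≤ m / 16 ^ a % 16) :
    (m - 16 ^ a) / 16 ^ b % 16 = if b = a then m / 16 ^ a % 16 - 1 else m / 16 ^ b % 16 := by
  have hq : (m - 16 ^ a) / 16 ^ a = m / 16 ^ a - 1 := by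
    have := Nat.sub_mul_div_of_le (x := m) (n := 16^a) (p := 1) (by
      by_contra hlt; rw [Nat.div_eq_of_lt (by omega)] at h; simp at h)
    simpa using this
  split_ifs with hb
  · subst hb; rw [hq]; clear hq; generalize m / 16 ^ b = q at *; omega
  · rcases lt_or_gt_of_ne hb with hb | hb
    · obtain ⟨c, rfl⟩ : ∃ c, a = b + 1 + c := ⟨a - b - 1, by omega⟩
      have hle : 16 ^ b * (16 * 16 ^ c) ≤ m := by
        by_contra hlt
        rw [Nat.div_eq_of_lt (by rw [show 16 ^ (b+1+c) = 16 ^ b * (16 * 16 ^ c) by ring]; omega)] at h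
        simp at h
      have := Nat.sub_mul_div_of_le (x := m) (n := 16^b) (p := 16 * 16 ^ c) hle
      rw [show 16 ^ (b+1+c) = 16 ^ b * (16 * 16 ^ c) by ring, this]
      have : 16 * 16 ^ c ≤ m / 16 ^ b := by
        rw [Nat.le_div_iff_mul_le (by positivity)]; linarith
      omega
    · obtain ⟨c, rfl⟩ : ∃ c, b = a + 1 + c := ⟨b - a - 1, by omega⟩
      rw [show 16 ^ (a+1+c) = 16 ^ a * 16 * 16 ^ c by ring, ← Nat.div_div_eq_div_mul,
        ← Nat.div_div_eq_div_mul, ← Nat.div_div_eq_div_mul, ← Nat.div_div_eq_div_mul, hq]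
      congr 2; clear hq hb; generalize m / 16 ^ a = q at *; omega

structure Dec (N : ℕ) (ρ : ℕ → ℕ) (dec : ℕ → ℕ → ℕ) : Prop where
  inj : ∀ a < N, ∀ b < N, ρ a = ρ b → a = b
  dig : ∀ a < N, ∀ m, dec m (ρ a) = m / 16 ^ a % 16
  sub : ∀ a < N, ∀ m, 1 ≤ m / 16 ^ a % 16 →
    dec (m - 16 ^ a) = Function.update (dec m) (ρ a) (dec m (ρ a) - 1)

noncomputable def Val (dec : ℕ → ℕ → ℕ) (es : List (ℕ × ℕ)) (D : St) : ZMod 1009 :=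
  (D.map fun x => (x.2 : ZMod 1009) * (coefR es (dec x.1) : ZMod 1009)).sum

section
variable {dec : ℕ → ℕ → ℕ} {es : List (ℕ × ℕ)}

@[simp] theorem Val_nil : Val dec es [] = 0 := rfl
@[simp] theorem Val_cons (x D) : Val dec es (x :: D) =
    (x.2 : ZMod 1009) * (coefR es (dec x.1) : ZMod 1009) + Val dec es D := by simp [Val]
@[simp] theorem Val_append (A B) : Val dec es (A ++ B) = Val dec es A + Val dec es B := by simp [Val]

theorem Val_rapp (A) : ∀ acc, Val dec es (rapp A acc) = Val dec es A + Val dec es acc := by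
  induction A with
  | nil => intro acc; simp [rapp]
  | cons x A ih =>
    intro acc
    show Val dec es (rapp A (x :: acc)) = _
    rw [ih]; simp; ring

theorem cast_mod (n : ℕ) : ((n % 1009 : ℕ) : ZMod 1009) = n := by
  simp

theorem Val_mrg (n : ℕ) : ∀ A B acc, Val dec es (mrg n A B acc) =
    Val dec es A + Val dec es B + Val dec es acc := by
  induction n with
  | zero => intro A B acc; show Val dec es (A ++ (B ++ acc)) = _; simp; ring
  | succ n ih =>
    intro A B acc
    rcases A with _ | ⟨x, A⟩
    · show Val dec es (rapp B acc) = _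
      rw [Val_rapp]; simp
    rcases B with _ | ⟨y, B⟩
    · show Val dec es (rapp (x :: A) acc) = _
      rw [Val_rapp]; simp
    show Val dec es (bif Nat.beq x.1 y.1 then
              force ((x.2 + y.2) % 1009) fun s =>
                bif Nat.beq s 0 then mrg n A B acc else mrg n A B ((x.1, s) :: acc)
            else bif Nat.ble x.1 y.1 then mrg n (x :: A) B (y :: acc) else mrg n A (y :: B) (x :: acc)) = _
    rw [force_eq]
    cases h : Nat.beq x.1 y.1
    · cases h2 : Nat.ble x.1 y.1
      · simp only [cond_false, ih, Val_cons]; ring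
      · simp only [cond_true, cond_false, ih, Val_cons]; ring
    · have he := Nat.eq_of_beq_eq_true h
      have hs : (((x.2 + y.2) % 1009 : ℕ) : ZMod 1009) = x.2 + y.2 := by rw [cast_mod]; push_cast; rfl
      cases h2 : Nat.beq ((x.2 + y.2) % 1009) 0
      · simp only [cond_true, cond_false, ih, Val_cons, hs, he]; ring
      · have h3 := Nat.eq_of_beq_eq_true h2
        rw [h3] at hs
        simp only [cond_true, ih, Val_cons, he]
        have : (x.2 : ZMod 1009) = - y.2 := by
          rw [eq_neg_iff_add_eq_zero, ← hs]; simp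
        rw [this]; ring

theorem Val_psh (c m v acc f) : Val dec es (psh c m v acc f) =
    Val dec es (f (bif c then (m, v) :: acc else acc)) := by
  cases c <;> simp [psh, force_eq]

theorem Val_stp {N : ℕ} {ρ : ℕ → ℕ} (hd : Dec N ρ dec) (a b ra rb : ℕ) (hne : a ≠ b) (ha : a < N) (hb : b < N)
    (hra : cnt (ρ a) es ≤ ra) (hrb : cnt (ρ b) es ≤ rb) (D : St) : ∀ A B,
    Val dec es (stp (16 ^ a) ra (16 ^ b) rb D A B) =
      Val dec ((ρ a, ρ b) :: es) D + Val dec es A + Val dec es B := by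
  induction D with
  | nil => intro A B; show Val dec es (mrg 1000000 A B []) = _; rw [Val_mrg]; simp
  | cons x D ih =>
    intro A B
    show Val dec es (force (x.1 / 16 ^ a % 16) fun da => force (x.1 / 16 ^ b % 16) fun db =>
        psh (Nat.ble 1 da && Nat.ble da (ra + 1) && Nat.ble db rb) (x.1 - 16 ^ a) x.2 A fun A' =>
        psh (Nat.ble 1 db && Nat.ble db (rb + 1) && Nat.ble da ra) (x.1 - 16 ^ b) (x.2 * 1008 % 1009) B
          fun B' => stp (16 ^ a) ra (16 ^ b) rb D A' B') = _
    rw [force_eq, force_eq, Val_psh, Val_psh, ih, Val_cons]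
    obtain ⟨m, v⟩ := x
    simp only [coefR]
    have hneg : (((v * 1008 % 1009 : ℕ)) : ZMod 1009) = - v := by
      rw [cast_mod]; push_cast
      have : (1008 : ZMod 1009) = -1 := by decide +kernel
      rw [this]; ring
    -- generic contribution
    have key : ∀ (a b ra rb : ℕ), a ≠ b → a < N → b < N → cnt (ρ a) es ≤ ra → cnt (ρ b) es ≤ rb →
        ∀ (w : ℕ) (A : St),
        Val dec es (bif (Nat.ble 1 (m / 16 ^ a % 16) && Nat.ble (m / 16 ^ a % 16) (ra + 1) &&
          Nat.ble (m / 16 ^ b % 16) rb) then (m - 16 ^ a, w) :: A else A) =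
        (w : ZMod 1009) * (((if dec m (ρ a) = 0 then 0 else
          coefR es (Function.update (dec m) (ρ a) (dec m (ρ a) - 1)) : ℤ)) : ZMod 1009) + Val dec es A := by
      intro a b ra rb hne ha hb hra hrb w A
      by_cases h1 : 1 ≤ m / 16 ^ a % 16
      · have h0 : dec m (ρ a) ≠ 0 := by rw [hd.dig a ha]; omega
        rw [if_neg h0]
        by_cases h2 : m / 16 ^ a % 16 ≤ ra + 1 ∧ m / 16 ^ b % 16 ≤ rb
        · have e1 := Nat.ble_eq_true_of_le h1
          have e2 := Nat.ble_eq_true_of_le h2.1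
          have e3 := Nat.ble_eq_true_of_le h2.2
          rw [e1, e2, e3]
          simp only [Bool.and_true, cond_true, Val_cons, hd.sub a ha m h1]
        · have hz : coefR es (Function.update (dec m) (ρ a) (dec m (ρ a) - 1)) = 0 := by
            by_cases h3 : m / 16 ^ a % 16 ≤ ra + 1
            · have h4 : ¬ m / 16 ^ b % 16 ≤ rb := fun h => h2 ⟨h3, h⟩
              by_cases hab : ρ b = ρ a
              · have := hd.inj b hb a ha hab
                exact absurd this.symm hne
              · apply coefR_zero es _ (ρ b)
                rw [Function.update_of_ne hab, hd.dig b hb]; omega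
            · apply coefR_zero es _ (ρ a)
              simp only [Function.update_self]
              rw [hd.dig a ha]; omega
          rw [hz]
          have : (Nat.ble 1 (m / 16 ^ a % 16) && Nat.ble (m / 16 ^ a % 16) (ra + 1) &&
            Nat.ble (m / 16 ^ b % 16) rb) = false := by
            rw [Bool.eq_false_iff]; intro hc
            simp only [Bool.and_eq_true] at hc
            exact h2 ⟨Nat.le_of_ble_eq_true hc.1.2, Nat.le_of_ble_eq_true hc.2⟩
          rw [this]; simp
      · have h0 : dec m (ρ a) = 0 := by rw [hd.dig a ha]; omega
        rw [if_pos h0]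
        have : (Nat.ble 1 (m / 16 ^ a % 16)) = false := by
          rw [Bool.eq_false_iff]; intro hc; exact h1 (Nat.le_of_ble_eq_true hc)
        rw [this]; simp
    rw [key a b ra rb hne ha hb hra hrb v A, key b a rb ra hne.symm hb ha hrb hra _ B, hneg]
    push_cast
    ring

theorem Val_dp {N : ℕ} {ρ : ℕ → ℕ} (hd : Dec N ρ dec) (tl : ℕ → ℕ)
    (htl : ∀ a < N, cnt (ρ a) es ≤ tl a) (fs : List (ℕ × ℕ)) :
    (∀ x ∈ fs, x.1 ≠ x.2 ∧ x.1 < N ∧ x.2 < N) → ∀ D, Val dec es (dp tl fs D) =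
      Val dec (fs.map (Prod.map ρ ρ) ++ es) D := by
  have hcnt : ∀ (gs : List (ℕ × ℕ)), (∀ x ∈ gs, x.1 ≠ x.2 ∧ x.1 < N ∧ x.2 < N) → ∀ a < N,
      cnt (ρ a) (gs.map (Prod.map ρ ρ)) = cnt a gs := by
    intro gs
    induction gs with
    | nil => intros; rfl
    | cons x gs ih =>
      intro h a ha
      rw [List.map_cons, cnt_cons, cnt_cons, ih (fun y hy => h y (List.mem_cons_of_mem _ hy)) a ha]
      obtain ⟨_, h1, h2⟩ := h x List.mem_cons_self
      have e1 : ρ x.1 = ρ a ↔ x.1 = a := ⟨hd.inj _ h1 _ ha, fun h => by rw [h]⟩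
      have e2 : ρ x.2 = ρ a ↔ x.2 = a := ⟨hd.inj _ h2 _ ha, fun h => by rw [h]⟩
      simp [e1, e2]
  induction fs with
  | nil => intro _ D; rfl
  | cons x gs ih =>
    intro h D
    have hg : ∀ x ∈ gs, x.1 ≠ x.2 ∧ x.1 < N ∧ x.2 < N := fun y hy => h y (List.mem_cons_of_mem _ hy)
    show Val dec es (force (16 ^ x.1) fun pa => force (16 ^ x.2) fun pb =>
      force (cnt x.1 gs + tl x.1) fun ra => force (cnt x.2 gs + tl x.2) fun rb =>
      dp tl gs (stp pa ra pb rb D [] [])) = _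
    simp only [force_eq]
    obtain ⟨h0, h1, h2⟩ := h x List.mem_cons_self
    rw [ih hg, Val_stp hd _ _ _ _ h0 h1 h2]
    · simp [Prod.map]
    · rw [cnt_append, hcnt gs hg _ h1]; have := htl _ h1; omega
    · rw [cnt_append, hcnt gs hg _ h2]; have := htl _ h2; omega

end

theorem Val_fin (dec : ℕ → ℕ → ℕ) (h0 : dec 0 = 0) (D : St) (h : fin D = true) : Val dec [] D ≠ 0 := by
  rcases D with _ | ⟨x, _ | ⟨y, D⟩⟩
  · exact absurd h (by simp [fin])
  · have h' : (Nat.beq x.1 0 && Nat.blt 0 x.2 && Nat.blt x.2 1009) = true := h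
    simp only [Bool.and_eq_true] at h'
    have e := Nat.eq_of_beq_eq_true h'.1.1
    have e1 : 0 < x.2 := Nat.le_of_ble_eq_true h'.1.2
    have e2 : x.2 < 1009 := Nat.le_of_ble_eq_true h'.2
    simp only [Val_cons, Val_nil, e, h0, coefR]
    simp only [if_true, Int.cast_one, mul_one, add_zero]
    intro hc
    rw [ZMod.natCast_eq_zero_iff] at hc
    exact absurd (Nat.le_of_dvd e1 hc) (by omega)
  · exact absurd h (by simp [fin])

/-- decoding of `n`-digit numbers -/
def dcd (n m v : ℕ) : ℕ := if v < n then m / 16 ^ v % 16 else 0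

theorem dec_dcd (n : ℕ) : Dec n id (dcd n) where
  inj := fun a _ b _ h => h
  dig := fun a ha m => by simp [dcd, ha]
  sub := fun a ha m h => by
    funext v
    by_cases hv : v = a
    · subst hv; simp [dcd, ha, digit_sub _ _ _ h]
    · rw [id, Function.update_of_ne hv]
      simp [dcd, digit_sub _ _ _ h, hv]

theorem dcd_zero (n : ℕ) : dcd n 0 = 0 := by funext v; simp [dcd]

theorem coefR_ne_zero (n : ℕ) (es : List (ℕ × ℕ)) (T : ℕ)
    (hes : ∀ x ∈ es, x.1 ≠ x.2 ∧ x.1 < n ∧ x.2 < n)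
    (h : fin (dp (fun _ => 0) es [(T, 1)]) = true) : coefR es (dcd n T) ≠ 0 := by
  have h1 := Val_fin (dcd n) (dcd_zero n) _ h
  rw [Val_dp (dec_dcd n) _ (by intro a _; exact le_refl 0) es hes] at h1
  intro hc
  apply h1
  simp only [Val_cons, Val_nil]
  have : es.map (Prod.map id id) ++ [] = es := by simp
  rw [this, hc]; simp

section CN
open MvPolynomial

noncomputable def lx (n : ℕ) (a : ℕ) : MvPolynomial (Fin n) ℤ := if h : a < n then X ⟨a, h⟩ else 0

noncomputable def pol (n : ℕ) (es : List (ℕ × ℕ)) : MvPolynomial (Fin n) ℤ :=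
  (es.map fun x => lx n x.1 - lx n x.2).prod

theorem coeff_lx (n a : ℕ) (ha : a < n) (p : MvPolynomial (Fin n) ℤ) (t : Fin n →₀ ℕ) :
    coeff t (lx n a * p) = if t ⟨a, ha⟩ = 0 then 0 else coeff (t - Finsupp.single ⟨a, ha⟩ 1) p := by
  rw [lx, dif_pos ha, coeff_X_mul']
  by_cases h : t ⟨a, ha⟩ = 0 <;> simp [h]

theorem coefR_eq (n : ℕ) (es : List (ℕ × ℕ)) (hes : ∀ x ∈ es, x.1 < n ∧ x.2 < n) :
    ∀ (t : ℕ → ℕ), (∀ v, n ≤ v → t v = 0) →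
    coefR es t = coeff (Finsupp.equivFunOnFinite.symm fun i : Fin n => t i) (pol n es) := by
  induction es with
  | nil =>
    intro t ht
    simp only [coefR, pol, List.map_nil, List.prod_nil, coeff_one]
    congr 1
    simp only [eq_iff_iff]
    constructor
    · rintro rfl; ext; simp
    · intro h
      funext v
      by_cases hv : v < n
      · have := DFunLike.congr_fun h ⟨v, hv⟩
        simpa using this.symm
      · exact ht v (by omega)
  | cons x es ih =>
    intro t ht
    obtain ⟨a, b⟩ := x
    obtain ⟨ha, hb⟩ := hes _ List.mem_cons_self
    have hes' : ∀ x ∈ es, x.1 < n ∧ x.2 < n := fun y hy => hes y (List.mem_cons_of_mem _ hy)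
    have key : ∀ c (hc : c < n), coefR es (Function.update t c (t c - 1)) =
        coeff ((Finsupp.equivFunOnFinite.symm fun i : Fin n => t i) - Finsupp.single ⟨c, hc⟩ 1) (pol n es) := by
      intro c hc
      rw [ih hes']
      · congr 1
        ext i
        by_cases hi : i = ⟨c, hc⟩
        · subst hi; simp
        · have : (i : ℕ) ≠ c := fun h => hi (Fin.ext h)
          simp [Function.update_of_ne this, Finsupp.single_apply, Ne.symm hi]
      · intro v hv
        rw [Function.update_of_ne (by omega)]; exact ht v hv
    have : pol n ((a, b) :: es) = lx n a * pol n es - lx n b * pol n es := by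
      simp [pol, sub_mul]
    rw [this, coeff_sub, coeff_lx n a ha, coeff_lx n b hb, ← key, ← key]
    simp [coefR]

theorem alonTarsi (n : ℕ) (es : List (ℕ × ℕ)) (hes : ∀ x ∈ es, x.1 < n ∧ x.2 < n)
    (t : ℕ → ℕ) (ht : ∀ v, n ≤ v → t v = 0) (hc : coefR es t ≠ 0)
    (S : ℕ → Finset ℕ) (hS : ∀ i < n, t i < (S i).card) :
    ∃ s : ℕ → ℕ, (∀ i < n, s i ∈ S i) ∧ ∀ x ∈ es, s x.1 ≠ s x.2 := by
  rw [coefR_eq n es hes t ht] at hc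
  have hdeg : (pol n es).IsHomogeneous es.length := by
    clear hc
    induction es with
    | nil => simpa [pol] using isHomogeneous_one (Fin n) ℤ
    | cons x es ih =>
      obtain ⟨ha, hb⟩ := hes _ List.mem_cons_self
      have h1 := ih (fun y hy => hes y (List.mem_cons_of_mem _ hy))
      have h2 : (lx n x.1 - lx n x.2).IsHomogeneous 1 := by
        rw [lx, lx, dif_pos ha, dif_pos hb]
        exact (isHomogeneous_X _ _).sub (isHomogeneous_X _ _)
      have := h2.mul h1
      rw [add_comm] at this
      simpa [pol] using this
  have hne : pol n es ≠ 0 := by intro h; rw [h] at hc; simp at hc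
  have htd := hdeg.totalDegree hne
  have htd2 := hdeg hc
  obtain ⟨s, hs1, hs2⟩ := combinatorial_nullstellensatz_exists_eval_nonzero (pol n es) _ hc
    (by rw [htd, ← htd2, Finsupp.degree_eq_weight_one]; rfl)
    (fun i : Fin n => (S i).map Nat.castEmbedding) (by intro i; simpa using hS i i.2)
  have hs3 : ∀ i : Fin n, ∃ k ∈ S i, (k : ℤ) = s i := by
    intro i
    simpa using hs1 i
  choose k hk1 hk2 using hs3
  refine ⟨fun i => if h : i < n then k ⟨i, h⟩ else 0, ?_, ?_⟩
  · intro i hi; simpa [hi] using hk1 ⟨i, hi⟩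
  · intro x hx heq
    obtain ⟨ha, hb⟩ := hes x hx
    simp only [ha, hb, dif_pos] at heq
    apply hs2
    rw [pol, map_list_prod]
    apply List.prod_eq_zero
    rw [List.map_map, List.mem_map]
    refine ⟨x, hx, ?_⟩
    simp only [Function.comp, lx, dif_pos ha, dif_pos hb, map_sub, eval_X]
    rw [← hk2, ← hk2, heq]; simp
end CN
end AT


section graphpart
open SimpleGraph AT
variable {V : Type*} (G : SimpleGraph V)

def Conf (e f : Sym2 V) : Prop := e ≠ f ∧ ∃ a ∈ e, ∃ b ∈ f, a = b ∨ G.Adj a b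

theorem Conf.symm {G : SimpleGraph V} {e f : Sym2 V} (h : Conf G e f) : Conf G f e := by
  obtain ⟨h1, a, ha, b, hb, h⟩ := h
  exact ⟨h1.symm, b, hb, a, ha, h.imp Eq.symm (fun h => h.symm)⟩

def Good (L : Sym2 V → Finset ℕ) (F : Finset (Sym2 V)) : Prop :=
  ∃ φ : Sym2 V → ℕ, (∀ e ∈ F, φ e ∈ L e) ∧ ∀ e ∈ F, ∀ f ∈ F, Conf G e f → φ e ≠ φ f

/-- minimal counterexample -/
structure Cex (L : Sym2 V → Finset ℕ) (F : Finset (Sym2 V)) : Prop where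
  cubic : ∀ v, ∃ x y z, x ≠ y ∧ x ≠ z ∧ y ≠ z ∧ ∀ w, G.Adj v w ↔ (w = x ∨ w = y ∨ w = z)
  edge : ∀ e ∈ F, e ∈ G.edgeSet
  list : ∀ e ∈ G.edgeSet, 10 ≤ (L e).card
  bad : ¬ Good G L F
  min : ∀ F' ⊂ F, Good G L F'

theorem cnt_le (n : ℕ) (es : List (ℕ × ℕ)) (hes : ∀ x ∈ es, x.1 < x.2 ∧ x.2 < n)
    (hnd : es.Nodup) (C : ℕ → ℕ → Prop) [∀ i j, Decidable (C i j)] (hsym : ∀ i j, C i j → C j i)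
    (hC : ∀ x ∈ es, C x.1 x.2) (i : ℕ) : cnt i es ≤ ((Finset.range n).filter (C i)).card := by
  have h1 : cnt i es = (es.toFinset.filter fun x => x.1 = i ∨ x.2 = i).card := by
    clear hC
    induction es with
    | nil => rfl
    | cons x es ih =>
      rw [List.nodup_cons] at hnd
      rw [cnt_cons, ih (fun y hy => hes y (List.mem_cons_of_mem _ hy)) hnd.2, List.toFinset_cons,
        Finset.filter_insert]
      have := (hes x List.mem_cons_self).1
      split_ifs with h3 h4 h5 <;> try omega
      · rw [Finset.card_insert_of_notMem (by simp [hnd.1])]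
      · rw [Finset.card_insert_of_notMem (by simp [hnd.1])]
  rw [h1]
  apply Finset.card_le_card_of_injOn (fun x => if x.1 = i then x.2 else x.1)
  · intro x hx
    simp only [Finset.coe_filter, List.mem_toFinset, Set.mem_ofPred_eq] at hx
    have h2 := hes x hx.1
    have h3 := hC x hx.1
    simp only [Finset.coe_filter, Finset.mem_range, Set.mem_ofPred_eq]
    split_ifs with h
    · subst h; exact ⟨h2.2, h3⟩
    · have h4 : x.2 = i := hx.2.resolve_left h
      subst h4; exact ⟨by omega, hsym _ _ h3⟩
  · intro x hx y hy hxy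
    simp only [Finset.coe_filter, List.mem_toFinset, Set.mem_ofPred_eq] at hx hy
    have h2 := hes x hx.1
    have h3 := hes y hy.1
    obtain ⟨x1, x2⟩ := x
    obtain ⟨y1, y2⟩ := y
    simp only at *
    simp only [Prod.mk.injEq]
    split_ifs at hxy <;> omega

variable {G}

open Classical in
theorem Cex.red {L : Sym2 V → Finset ℕ} {F : Finset (Sym2 V)} (H : Cex G L F)
    (n : ℕ) (q : ℕ → Sym2 V) (hq : ∀ i < n, q i ∈ G.edgeSet)
    (hinj : ∀ i < n, ∀ j < n, q i = q j → i = j) (hex : ∃ i < n, q i ∈ F)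
    (es : List (ℕ × ℕ)) (hes : ∀ x ∈ es, x.1 < x.2 ∧ x.2 < n) (hnd : es.Nodup)
    (hC : ∀ x ∈ es, Conf G (q x.1) (q x.2))
    (hall : ∀ i j, i < j → j < n → Conf G (q i) (q j) → (i, j) ∈ es)
    (T : ℕ → ℕ) (hT : ∀ i < n, ∃ Z : Finset (Sym2 V), Z.card ≤ T i ∧ ∀ f ∈ G.edgeSet,
      Conf G (q i) f → (f ∈ F ∨ ∃ j < n, f = q j) → f ∈ Z)
    (t : ℕ → ℕ) (ht : ∀ v, n ≤ v → t v = 0) (hlt : ∀ i < n, t i + T i < 10 + cnt i es)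
    (hc : coefR es t ≠ 0) : False := by
  set Q : Finset (Sym2 V) := (Finset.range n).image q with hQ
  have hmQ : ∀ e, e ∈ Q ↔ ∃ i < n, q i = e := by intro e; simp [hQ]
  obtain ⟨i0, hi0, hi0F⟩ := hex
  obtain ⟨φ, hφ1, hφ2⟩ := H.min (F \ Q) (by
    refine Finset.ssubset_iff_subset_ne.2 ⟨Finset.sdiff_subset, fun h => ?_⟩
    rw [← h] at hi0F
    exact (Finset.mem_sdiff.1 hi0F).2 ((hmQ _).2 ⟨i0, hi0, rfl⟩))
  set O : ℕ → Finset (Sym2 V) := fun i => (F \ Q).filter (fun f => Conf G (q i) f) with hO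
  obtain ⟨s, hs1, hs2⟩ := alonTarsi n es (fun x hx => ⟨by have := hes x hx; omega, (hes x hx).2⟩)
    t ht hc (fun i => L (q i) \ (O i).image φ) (by
      intro i hi
      obtain ⟨Z, hZ1, hZ2⟩ := hT i hi
      have h1 := Finset.le_card_sdiff ((O i).image φ) (L (q i))
      have h2 := H.list _ (hq i hi)
      have h3 : ((O i).image φ).card ≤ (O i).card := Finset.card_image_le
      have h4 := cnt_le n es hes hnd (fun i j => Conf G (q i) (q j)) (fun _ _ h => h.symm) hC i
      set P := ((Finset.range n).filter fun j => Conf G (q i) (q j)) with hP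
      have h5 : (P.image q).card = P.card := by
        apply Finset.card_image_of_injOn
        intro a ha b hb hab
        simp only [hP, Finset.coe_filter, Finset.mem_range, Set.mem_ofPred_eq] at ha hb
        exact hinj a ha.1 b hb.1 hab
      have h6 : Disjoint (O i) (P.image q) := by
        rw [Finset.disjoint_left]
        intro e he hp
        simp only [hO, Finset.mem_filter, Finset.mem_sdiff] at he
        apply he.1.2
        simp only [Finset.mem_image, hP, Finset.mem_filter, Finset.mem_range] at hp
        obtain ⟨j, hj, rfl⟩ := hp
        exact (hmQ _).2 ⟨j, hj.1, rfl⟩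
      have h7 : (O i) ∪ (P.image q) ⊆ Z := by
        intro e he
        rw [Finset.mem_union] at he
        rcases he with he | hp
        · simp only [hO, Finset.mem_filter, Finset.mem_sdiff] at he
          exact hZ2 e (H.edge e he.1.1) he.2 (Or.inl he.1.1)
        · simp only [Finset.mem_image, hP, Finset.mem_filter, Finset.mem_range] at hp
          obtain ⟨j, hj, rfl⟩ := hp
          exact hZ2 _ (hq j hj.1) hj.2 (Or.inr ⟨j, hj.1, rfl⟩)
      have h8 := Finset.card_le_card h7
      rw [Finset.card_union_of_disjoint h6, h5] at h8
      have h9 := hlt i hi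
      omega)
  apply H.bad
  have hsq : ∀ i < n, ∀ j < n, Conf G (q i) (q j) → s i ≠ s j := by
    intro i hi j hj hcf
    rcases lt_trichotomy i j with h | h | h
    · exact hs2 _ (hall i j h hj hcf)
    · subst h; exact absurd rfl hcf.1
    · exact (hs2 _ (hall j i h hi hcf.symm)).symm
  have hx : ∀ i < n, ∀ f ∈ F, f ∉ Q → Conf G (q i) f → s i ≠ φ f := by
    intro i hi f hf hfQ hcf heq
    have := hs1 i hi
    rw [Finset.mem_sdiff] at this
    apply this.2
    rw [heq]
    exact Finset.mem_image_of_mem _ (by simp [hO, hf, hfQ, hcf])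
  refine ⟨fun e => if h : ∃ i < n, q i = e then s h.choose else φ e, ?_, ?_⟩
  · intro e he
    by_cases h : ∃ i < n, q i = e
    · simp only [h, dif_pos]
      have h1 := h.choose_spec
      have h2 := hs1 _ h1.1
      rw [Finset.mem_sdiff] at h2
      have h3 := h2.1
      rw [h1.2] at h3
      exact h3
    · simp only [h, dif_neg, not_false_eq_true]
      exact hφ1 e (by rw [Finset.mem_sdiff]; exact ⟨he, fun hh => h ((hmQ e).1 hh)⟩)
  · intro e he f hf hcf
    by_cases h : ∃ i < n, q i = e <;> by_cases h' : ∃ i < n, q i = f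
    · simp only [h, h', dif_pos]
      have h1 := h.choose_spec
      have h2 := h'.choose_spec
      exact hsq _ h1.1 _ h2.1 (by rw [h1.2, h2.2]; exact hcf)
    · simp only [h, h', dif_pos, dif_neg, not_false_eq_true]
      have h1 := h.choose_spec
      exact hx _ h1.1 f hf (fun hh => h' ((hmQ f).1 hh)) (by rw [h1.2]; exact hcf)
    · simp only [h, h', dif_pos, dif_neg, not_false_eq_true]
      have h1 := h'.choose_spec
      exact (hx _ h1.1 e he (fun hh => h ((hmQ e).1 hh)) (by rw [h1.2]; exact hcf.symm)).symm
    · simp only [h, h', dif_neg, not_false_eq_true]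
      exact hφ2 e (by rw [Finset.mem_sdiff]; exact ⟨he, fun hh => h ((hmQ e).1 hh)⟩)
        f (by rw [Finset.mem_sdiff]; exact ⟨hf, fun hh => h' ((hmQ f).1 hh)⟩) hcf

/-- `v` has exactly the neighbours `x y z`. -/
def Nb (G : SimpleGraph V) (v x y z : V) : Prop :=
  x ≠ y ∧ x ≠ z ∧ y ≠ z ∧ ∀ w, G.Adj v w ↔ (w = x ∨ w = y ∨ w = z)

theorem Nb.rot {v x y z : V} (h : Nb G v x y z) : Nb G v y z x :=
  ⟨h.2.2.1, h.1.symm, h.2.1.symm, fun w => by rw [h.2.2.2]; tauto⟩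
theorem Nb.swap {v x y z : V} (h : Nb G v x y z) : Nb G v x z y :=
  ⟨h.2.1, h.1, h.2.2.1.symm, fun w => by rw [h.2.2.2]; tauto⟩
theorem Nb.a1 {v x y z : V} (h : Nb G v x y z) : G.Adj v x := (h.2.2.2 x).2 (by simp)
theorem Nb.a2 {v x y z : V} (h : Nb G v x y z) : G.Adj v y := (h.2.2.2 y).2 (by simp)
theorem Nb.a3 {v x y z : V} (h : Nb G v x y z) : G.Adj v z := (h.2.2.2 z).2 (by simp)

section cubic
variable {L : Sym2 V → Finset ℕ} {F : Finset (Sym2 V)} 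

theorem Cex.nb1 (H : Cex G L F) (v : V) : ∃ x y z, Nb G v x y z := H.cubic v

theorem Cex.nb2 (H : Cex G L F) {v x : V} (hx : G.Adj v x) : ∃ y z, Nb G v x y z := by
  obtain ⟨a, b, c, h⟩ := H.nb1 v
  rcases (h.2.2.2 x).1 hx with rfl | rfl | rfl
  · exact ⟨_, _, h⟩
  · exact ⟨_, _, h.rot⟩
  · exact ⟨_, _, h.rot.rot⟩

theorem Cex.nb3 (H : Cex G L F) {v x y : V} (hx : G.Adj v x) (hy : G.Adj v y) (hxy : x ≠ y) :
    ∃ z, Nb G v x y z := by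
  obtain ⟨b, c, h⟩ := H.nb2 hx
  rcases (h.2.2.2 y).1 hy with rfl | rfl | rfl
  · exact absurd rfl hxy
  · exact ⟨_, h⟩
  · exact ⟨_, h.swap⟩

/-- edges at a vertex -/
def IncIn (G : SimpleGraph V) (v : V) (I : Finset (Sym2 V)) : Prop :=
  I.card ≤ 3 ∧ ∀ w, G.Adj v w → s(v, w) ∈ I

theorem Cex.inc (H : Cex G L F) (v : V) : ∃ I, IncIn G v I := by
  classical
  obtain ⟨x, y, z, h⟩ := H.nb1 v
  refine ⟨{s(v, x), s(v, y), s(v, z)}, Finset.card_le_three, ?_⟩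
  intro w hw
  rcases (h.2.2.2 w).1 hw with rfl | rfl | rfl <;> simp

/-- all conflicts of an edge are incident with one of the vertices of `zs`. -/
theorem conf_cover {u v a b c d : V} (hu : Nb G u v a b) (hv : Nb G v u c d) (f : Sym2 V)
    (hf : f ∈ G.edgeSet) (hc : Conf G s(u, v) f) : ∃ x w, G.Adj x w ∧ f = s(x, w) ∧ 
      (x = a ∨ x = c ∨ x = b ∨ x = d) := by
  induction f with | _ x y
  rw [mem_edgeSet] at hf
  obtain ⟨hne, r, hr, t, ht, h⟩ := hc
  have key : ∀ x y, G.Adj x y → s(u,v) ≠ s(x, y) → (u = x ∨ v = x ∨ G.Adj u x ∨ G.Adj v x) → ∃ x' w, G.Adj x' w ∧ s(x, y) = s(x', w) ∧ 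
      (x' = a ∨ x' = c ∨ x' = b ∨ x' = d) := by
    intro x y hxy hne h
    rw [hu.2.2.2, hv.2.2.2] at h
    rcases h with rfl | rfl | (rfl | rfl | rfl) | (rfl | rfl | rfl)
    · rcases (hu.2.2.2 y).1 hxy with rfl | rfl | rfl
      · exact absurd rfl hne
      · exact ⟨y, u, hxy.symm, Sym2.eq_swap, by tauto⟩
      · exact ⟨y, u, hxy.symm, Sym2.eq_swap, by tauto⟩
    · rcases (hv.2.2.2 y).1 hxy with rfl | rfl | rfl
      · exact absurd Sym2.eq_swap hne
      · exact ⟨y, v, hxy.symm, Sym2.eq_swap, by tauto⟩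
      · exact ⟨y, v, hxy.symm, Sym2.eq_swap, by tauto⟩
    · rcases (hv.2.2.2 y).1 hxy with rfl | rfl | rfl
      · exact absurd Sym2.eq_swap hne
      · exact ⟨y, x, hxy.symm, Sym2.eq_swap, by tauto⟩
      · exact ⟨y, x, hxy.symm, Sym2.eq_swap, by tauto⟩
    · exact ⟨x, y, hxy, rfl, by tauto⟩
    · exact ⟨x, y, hxy, rfl, by tauto⟩
    · rcases (hu.2.2.2 y).1 hxy with rfl | rfl | rfl
      · exact absurd rfl hne
      · exact ⟨y, x, hxy.symm, Sym2.eq_swap, by tauto⟩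
      · exact ⟨y, x, hxy.symm, Sym2.eq_swap, by tauto⟩
    · exact ⟨x, y, hxy, rfl, by tauto⟩
    · exact ⟨x, y, hxy, rfl, by tauto⟩
  simp only [Sym2.mem_iff] at hr ht
  rcases ht with rfl | rfl
  · exact key _ _ hf hne (by rcases hr with rfl | rfl <;> tauto)
  · rw [Sym2.eq_swap]
    exact key _ _ hf.symm (by rwa [Sym2.eq_swap (a := t)]) (by rcases hr with rfl | rfl <;> tauto)

/-- bound on the number of conflicts -/
def CB (G : SimpleGraph V) (e : Sym2 V) (T : ℕ) : Prop :=
  ∃ Z : Finset (Sym2 V), Z.card ≤ T ∧ ∀ f ∈ G.edgeSet, Conf G e f → f ∈ Z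

open Classical in
theorem card_share (A I : Finset (Sym2 V)) (a : ℕ) (hA : A.card ≤ a + 1) (hI : I.card ≤ 3)
    (h : ∃ e, e ∈ A ∧ e ∈ I) : (A ∪ I).card ≤ a + 3 := by
  have h1 := Finset.card_union_add_card_inter A I
  obtain ⟨e, he⟩ := h
  have h2 : 0 < (A ∩ I).card := Finset.card_pos.2 ⟨e, by simpa using he⟩
  omega

open Classical in
theorem card_noshare (A I : Finset (Sym2 V)) (a : ℕ) (hA : A.card ≤ a) (hI : I.card ≤ 3) :
    (A ∪ I).card ≤ a + 3 := by
  have := Finset.card_union_le A I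
  omega

theorem Cex.cb (H : Cex G L F) {u v a b c d : V} (hu : Nb G u v a b) (hv : Nb G v u c d) :
    CB G s(u, v) 12 ∧ (G.Adj a c → CB G s(u, v) 11) ∧ (G.Adj a c → G.Adj b d → CB G s(u, v) 10) ∧
    (G.Adj a c → G.Adj b c → CB G s(u, v) 10) ∧ (a = c → CB G s(u, v) 9) ∧
    (G.Adj a c → G.Adj b c → G.Adj a d → CB G s(u, v) 9) := by
  classical
  obtain ⟨A, hA⟩ := H.inc a
  obtain ⟨B, hB⟩ := H.inc b
  obtain ⟨C, hC⟩ := H.inc c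
  obtain ⟨D, hD⟩ := H.inc d
  have cov := conf_cover hu hv
  have hcov : ∀ f ∈ G.edgeSet, Conf G s(u, v) f → f ∈ A ∪ C ∪ B ∪ D := by
    intro f hf hc
    obtain ⟨x, w, hxw, rfl, h⟩ := cov f hf hc
    simp only [Finset.mem_union]
    rcases h with rfl | rfl | rfl | rfl
    · exact Or.inl (Or.inl (Or.inl (hA.2 _ hxw)))
    · exact Or.inl (Or.inl (Or.inr (hC.2 _ hxw)))
    · exact Or.inl (Or.inr (hB.2 _ hxw))
    · exact Or.inr (hD.2 _ hxw)
  have shAC : G.Adj a c → ∃ e, e ∈ A ∧ e ∈ C := fun h =>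
    ⟨s(a, c), hA.2 _ h, by rw [Sym2.eq_swap]; exact hC.2 _ h.symm⟩
  have shB : G.Adj b c → ∃ e, e ∈ A ∪ C ∧ e ∈ B := fun h =>
    ⟨s(b, c), by rw [Sym2.eq_swap]; exact Finset.mem_union_right _ (hC.2 _ h.symm), hB.2 _ h⟩
  refine ⟨⟨_, ?_, hcov⟩, fun h1 => ⟨_, ?_, hcov⟩, fun h1 h2 => ⟨_, ?_, hcov⟩, fun h1 h2 => ⟨_, ?_, hcov⟩, ?_,
    fun h1 h2 h3 => ⟨_, ?_, hcov⟩⟩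
  · exact card_noshare _ _ 9 (card_noshare _ _ 6 (card_noshare _ _ 3 hA.1 hC.1) hB.1) hD.1
  · exact card_noshare _ _ 8 (card_noshare _ _ 5 (card_share _ _ 2 hA.1 hC.1 (shAC h1)) hB.1) hD.1
  · exact card_share _ _ 7 (card_noshare _ _ 5 (card_share _ _ 2 hA.1 hC.1 (shAC h1)) hB.1) hD.1
      ⟨s(b, d), Finset.mem_union_right _ (hB.2 _ h2), by rw [Sym2.eq_swap]; exact hD.2 _ h2.symm⟩
  · exact card_noshare _ _ 7 (card_share _ _ 4 (card_share _ _ 2 hA.1 hC.1 (shAC h1)) hB.1 (shB h2)) hD.1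
  · rintro rfl
    refine ⟨A ∪ B ∪ D, card_noshare _ _ 6 (card_noshare _ _ 3 hA.1 hB.1) hD.1, ?_⟩
    intro f hf hc
    obtain ⟨x, w, hxw, rfl, h⟩ := cov f hf hc
    simp only [Finset.mem_union]
    rcases h with rfl | rfl | rfl | rfl
    · exact Or.inl (Or.inl (hA.2 _ hxw))
    · exact Or.inl (Or.inl (hA.2 _ hxw))
    · exact Or.inl (Or.inr (hB.2 _ hxw))
    · exact Or.inr (hD.2 _ hxw)
  · exact card_share _ _ 6 (card_share _ _ 4 (card_share _ _ 2 hA.1 hC.1 (shAC h1)) hB.1 (shB h2)) hD.1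
      ⟨s(a, d), Finset.mem_union_left _ (Finset.mem_union_left _ (hA.2 _ h3)), by rw [Sym2.eq_swap]; exact hD.2 _ h3.symm⟩

theorem Cex.cb12 (H : Cex G L F) {u v : V} (h : G.Adj u v) : CB G s(u, v) 12 := by
  obtain ⟨a, b, hu⟩ := H.nb2 h
  obtain ⟨c, d, hv⟩ := H.nb2 h.symm
  exact (H.cb hu hv).1

theorem Cex.red' (H : Cex G L F)
    (n : ℕ) (q : ℕ → Sym2 V) (hq : ∀ i < n, q i ∈ G.edgeSet)
    (hinj : ∀ i < n, ∀ j < n, q i = q j → i = j) (hex : ∃ i < n, q i ∈ F)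
    (es : List (ℕ × ℕ)) (hes : ∀ x ∈ es, x.1 < x.2 ∧ x.2 < n) (hnd : es.Nodup)
    (hC : ∀ x ∈ es, Conf G (q x.1) (q x.2))
    (hall : ∀ i j, i < j → j < n → Conf G (q i) (q j) → (i, j) ∈ es)
    (T : ℕ → ℕ) (hT : ∀ i < n, CB G (q i) (T i))
    (t : ℕ → ℕ) (ht : ∀ v, n ≤ v → t v = 0) (hlt : ∀ i < n, t i + T i < 10 + cnt i es)
    (hc : coefR es t ≠ 0) : False :=
  H.red n q hq hinj hex es hes hnd hC hall T (fun i hi => by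
    obtain ⟨Z, h1, h2⟩ := hT i hi
    exact ⟨Z, h1, fun f hf hc _ => h2 f hf hc⟩) t ht hlt hc

/-- touched vertices -/
def Touch (F : Finset (Sym2 V)) (v : V) : Prop := ∃ e ∈ F, v ∈ e

theorem Cex.closed (H : Cex G L F) {v w : V} (hv : Touch F v) (hvw : G.Adj v w) : Touch F w := by
  classical
  by_contra hw
  obtain ⟨e, heF, hve⟩ := hv
  obtain ⟨x, rfl⟩ := Sym2.mem_iff_exists.1 hve
  have hvx : G.Adj v x := H.edge _ heF
  have hxw : x ≠ w := by rintro rfl; exact hw ⟨_, heF, by simp⟩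
  obtain ⟨b, hu⟩ := H.nb3 hvx hvw hxw
  obtain ⟨c, d, hx⟩ := H.nb2 hvx.symm
  obtain ⟨B, hB⟩ := H.inc b
  obtain ⟨C, hC⟩ := H.inc c
  obtain ⟨D, hD⟩ := H.inc d
  refine H.red 1 (fun _ => s(v, x)) (fun _ _ => H.edge _ heF) (by intro i hi j hj _; omega)
    ⟨0, by omega, heF⟩ [] (by simp) (by simp) (by simp)
    (by intro i j h1 h2 h3; exact absurd rfl h3.1) (fun _ => 9) ?_ (fun _ => 0) (fun _ _ => rfl)
    (by intro i hi; omega) (by show (if (0 : ℕ → ℕ) = 0 then (1 : ℤ) else 0) ≠ 0; simp)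
  intro i _
  refine ⟨B ∪ C ∪ D, card_noshare _ _ 6 (card_noshare _ _ 3 hB.1 hC.1) hD.1, ?_⟩
  intro f hf hcf hfF
  have hfF' : f ∈ F := by
    rcases hfF with h | ⟨_, _, rfl⟩
    · exact h
    · exact heF
  obtain ⟨y, z, hyz, rfl, h⟩ := conf_cover hu hx f hf hcf
  simp only [Finset.mem_union]
  rcases h with rfl | rfl | rfl | rfl
  · exact absurd ⟨_, hfF', by simp⟩ hw
  · exact Or.inl (Or.inr (hC.2 _ hyz))
  · exact Or.inl (Or.inl (hB.2 _ hyz))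
  · exact Or.inr (hD.2 _ hyz)

end cubic
end graphpart


section fincase
open SimpleGraph AT
variable {V : Type*} {G : SimpleGraph V} {L : Sym2 V → Finset ℕ} {F : Finset (Sym2 V)}

namespace AT

def beq2 (x y : ℕ × ℕ) : Bool := Nat.beq x.1 y.1 && Nat.beq x.2 y.2

theorem beq2_iff (x y : ℕ × ℕ) : beq2 x y = true ↔ x = y := by
  obtain ⟨a, b⟩ := x
  obtain ⟨c, d⟩ := y
  simp [beq2, Prod.ext_iff]

def inB (l : List (ℕ × ℕ)) (a b : ℕ) : Bool := l.any fun x => beq2 x (a, b) || beq2 x (b, a)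

theorem inB_iff (l : List (ℕ × ℕ)) (a b : ℕ) : inB l a b = true ↔ (a, b) ∈ l ∨ (b, a) ∈ l := by
  simp only [inB, List.any_eq_true, Bool.or_eq_true, beq2_iff]
  constructor
  · rintro ⟨x, hx, rfl | rfl⟩
    · exact Or.inl hx
    · exact Or.inr hx
  · rintro (h | h)
    · exact ⟨_, h, Or.inl rfl⟩
    · exact ⟨_, h, Or.inr rfl⟩

def nearB (adj : List (ℕ × ℕ)) (a b : ℕ) : Bool := Nat.beq a b || inB adj a b

def confB (adj : List (ℕ × ℕ)) (e f : ℕ × ℕ) : Bool :=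
  nearB adj e.1 f.1 || nearB adj e.1 f.2 || nearB adj e.2 f.1 || nearB adj e.2 f.2

def neB (adj dst : List (ℕ × ℕ)) (a b : ℕ) : Bool := inB adj a b || inB dst a b

def eneB (adj dst : List (ℕ × ℕ)) (e f : ℕ × ℕ) : Bool :=
  (neB adj dst e.1 f.1 || neB adj dst e.2 f.2) && (neB adj dst e.1 f.2 || neB adj dst e.2 f.1)

def optB : List (ℕ × ℕ) → ℕ → ℕ × ℕ → Bool
  | [], _, _ => false
  | y :: l, m, x => (beq2 y x && Nat.beq (m % 2) 1) || optB l (m / 2) x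

theorem exists_mask (C : ℕ × ℕ → Prop) (opt : List (ℕ × ℕ)) :
    ∃ m < 2 ^ opt.length, ∀ x, optB opt m x = true ↔ (x ∈ opt ∧ C x) := by
  induction opt with
  | nil => exact ⟨0, by simp, by simp [optB]⟩
  | cons y l ih =>
    obtain ⟨m, hm, h⟩ := ih
    by_cases hy : C y
    · refine ⟨2 * m + 1, by rw [List.length_cons, pow_succ]; omega, fun x => ?_⟩
      have h1 : (2 * m + 1) / 2 = m := by omega
      have h2 : (2 * m + 1) % 2 = 1 := by omega
      simp only [optB, h1, h2, Bool.or_eq_true, Bool.and_eq_true, beq2_iff, h, List.mem_cons]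
      constructor
      · rintro (⟨rfl, _⟩ | h)
        · exact ⟨Or.inl rfl, hy⟩
        · exact ⟨Or.inr h.1, h.2⟩
      · rintro ⟨rfl | h1, h2⟩
        · exact Or.inl ⟨rfl, rfl⟩
        · exact Or.inr ⟨h1, h2⟩
    · refine ⟨2 * m, by rw [List.length_cons, pow_succ]; omega, fun x => ?_⟩
      have h1 : (2 * m) / 2 = m := by omega
      have h2 : (2 * m) % 2 = 0 := by omega
      have h3 : Nat.beq 0 1 = false := rfl
      simp only [optB, h1, h2, h3, Bool.or_eq_true, Bool.and_eq_true, h, List.mem_cons]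
      constructor
      · rintro (⟨_, h⟩ | h)
        · exact absurd h (by simp)
        · exact ⟨Or.inr h.1, h.2⟩
      · rintro ⟨rfl | h1, h2⟩
        · exact absurd h2 hy
        · exact Or.inr ⟨h1, h2⟩

def prs (n : ℕ) : List (ℕ × ℕ) :=
  ((List.range n ×ˢ List.range n).filter fun x => Nat.blt x.1 x.2).reverse

theorem mem_prs (n : ℕ) (x : ℕ × ℕ) : x ∈ prs n ↔ x.1 < x.2 ∧ x.2 < n := by
  obtain ⟨a, b⟩ := x
  simp [prs, Nat.blt_eq]
  omega

theorem nodup_prs (n : ℕ) : (prs n).Nodup := by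
  unfold prs
  rw [List.nodup_reverse]
  exact (List.Nodup.product List.nodup_range List.nodup_range).filter _

def sel (p : ℕ × ℕ → Bool) (l : List (ℕ × ℕ)) : List (ℕ × ℕ) → List (ℕ × ℕ) :=
  List.rec (motive := fun _ => List (ℕ × ℕ) → List (ℕ × ℕ)) (fun acc => acc)
    (fun x _ ih acc => bif p x then ih (x :: acc) else ih acc) l

theorem sel_eq (p) (l) : ∀ acc, sel p l acc = (l.filter p).reverse ++ acc := by
  induction l with
  | nil => intro acc; rfl
  | cons x l ih =>
    intro acc
    show (bif p x then sel p l (x :: acc) else sel p l acc) = _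
    cases h : p x
    · simp [h, ih]
    · simp [h, ih]

def mkE (n : ℕ) (ed adj opt : List (ℕ × ℕ)) (m : ℕ) : List (ℕ × ℕ) :=
  sel (fun x => confB adj (ed.getD x.1 (0, 0)) (ed.getD x.2 (0, 0)) || optB opt m x) (prs n) []

def bndB (n : ℕ) (T : List ℕ) (tg : ℕ) (es : List (ℕ × ℕ)) : Bool :=
  (List.range n).all fun i => Nat.blt (tg / 16 ^ i % 16 + T.getD i 12) (10 + cnt i es)

/-- all pairs covered, edges are edges, edges are distinct -/
def chk1 (n : ℕ) (ed adj dst opt non : List (ℕ × ℕ)) : Bool :=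
  ((prs n).all fun x => confB adj (ed.getD x.1 (0, 0)) (ed.getD x.2 (0, 0)) ||
    inB opt x.1 x.2 || inB non x.1 x.2) &&
  ((List.range n).all fun i => inB adj (ed.getD i (0, 0)).1 (ed.getD i (0, 0)).2) &&
  ((prs n).all fun x => eneB adj dst (ed.getD x.1 (0, 0)) (ed.getD x.2 (0, 0))) &&
  (opt.all fun x => Nat.blt x.1 x.2 && Nat.blt x.2 n)

def chk2 (n : ℕ) (ed adj opt : List (ℕ × ℕ)) (T tgs : List ℕ) : Bool :=
  (List.range (2 ^ opt.length)).all fun m =>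
    bndB n T (tgs.getD m 0) (mkE n ed adj opt m) &&
    fin (dp (fun _ => 0) (mkE n ed adj opt m) [(tgs.getD m 0, 1)])

end AT

theorem Cex.fincase (H : Cex G L F) (n : ℕ) (ed adj dst opt non : List (ℕ × ℕ)) (T tgs : List ℕ)
    (x : ℕ → V)
    (h1 : chk1 n ed adj dst opt non = true) (h2 : chk2 n ed adj opt T tgs = true)
    (hadj : ∀ e ∈ adj, G.Adj (x e.1) (x e.2)) (hdst : ∀ e ∈ dst, x e.1 ≠ x e.2)
    (hnon : ∀ e ∈ non, ¬ Conf G s(x (ed.getD e.1 (0, 0)).1, x (ed.getD e.1 (0, 0)).2)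
      s(x (ed.getD e.2 (0, 0)).1, x (ed.getD e.2 (0, 0)).2))
    (hT : ∀ i < n, CB G s(x (ed.getD i (0, 0)).1, x (ed.getD i (0, 0)).2) (T.getD i 12))
    (hex : ∃ i < n, s(x (ed.getD i (0, 0)).1, x (ed.getD i (0, 0)).2) ∈ F) : False := by
  set q : ℕ → Sym2 V := fun i => s(x (ed.getD i (0, 0)).1, x (ed.getD i (0, 0)).2) with hqd
  simp only [chk1, Bool.and_eq_true, List.all_eq_true, List.mem_range] at h1
  obtain ⟨⟨⟨h11, h12⟩, h13⟩, h14⟩ := h1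
  simp only [chk2, Bool.and_eq_true, List.all_eq_true, List.mem_range] at h2
  have hA : ∀ a b, inB adj a b = true → G.Adj (x a) (x b) := by
    intro a b h
    rw [inB_iff] at h
    rcases h with h | h
    · exact hadj _ h
    · exact (hadj _ h).symm
  have hN : ∀ a b, neB adj dst a b = true → x a ≠ x b := by
    intro a b h
    rw [neB, Bool.or_eq_true] at h
    rcases h with h | h
    · exact (hA _ _ h).ne
    · rw [inB_iff] at h
      rcases h with h | h
      · exact hdst _ h
      · exact (hdst _ h).symm
  have hqe : ∀ i < n, q i ∈ G.edgeSet := fun i hi => hA _ _ (h12 i hi)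
  have hne : ∀ i j, i < j → j < n → q i ≠ q j := by
    intro i j hij hj heq
    have h := h13 (i, j) ((mem_prs _ _).2 ⟨hij, hj⟩)
    simp only [eneB, Bool.and_eq_true, Bool.or_eq_true] at h
    simp only [hqd, Sym2.eq_iff] at heq
    rcases heq with ⟨e1, e2⟩ | ⟨e1, e2⟩
    · rcases h.1 with h | h
      · exact hN _ _ h e1
      · exact hN _ _ h e2
    · rcases h.2 with h | h
      · exact hN _ _ h e1
      · exact hN _ _ h e2
  have hinj : ∀ i < n, ∀ j < n, q i = q j → i = j := by
    intro i hi j hj h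
    rcases lt_trichotomy i j with h' | h' | h'
    · exact absurd h (hne i j h' hj)
    · exact h'
    · exact absurd h.symm (hne j i h' hi)
  have hnear : ∀ a b, nearB adj a b = true → x a = x b ∨ G.Adj (x a) (x b) := by
    intro a b h
    rw [nearB, Bool.or_eq_true] at h
    rcases h with h | h
    · exact Or.inl (by rw [Nat.eq_of_beq_eq_true h])
    · exact Or.inr (hA _ _ h)
  have hconf : ∀ i j, i < j → j < n → confB adj (ed.getD i (0, 0)) (ed.getD j (0, 0)) = true →
      Conf G (q i) (q j) := by
    intro i j hij hj h
    refine ⟨hne i j hij hj, ?_⟩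
    simp only [confB, Bool.or_eq_true] at h
    rcases h with ((h | h) | h) | h
    · exact ⟨_, Sym2.mem_mk_left _ _, _, Sym2.mem_mk_left _ _, hnear _ _ h⟩
    · exact ⟨_, Sym2.mem_mk_left _ _, _, Sym2.mem_mk_right _ _, hnear _ _ h⟩
    · exact ⟨_, Sym2.mem_mk_right _ _, _, Sym2.mem_mk_left _ _, hnear _ _ h⟩
    · exact ⟨_, Sym2.mem_mk_right _ _, _, Sym2.mem_mk_right _ _, hnear _ _ h⟩
  obtain ⟨m, hm, hmask⟩ := exists_mask (fun y => Conf G (q y.1) (q y.2)) opt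
  obtain ⟨hb, hf⟩ := h2 m hm
  have hmem : ∀ y, y ∈ mkE n ed adj opt m ↔ (y.1 < y.2 ∧ y.2 < n) ∧
      (confB adj (ed.getD y.1 (0, 0)) (ed.getD y.2 (0, 0)) = true ∨ (y ∈ opt ∧ Conf G (q y.1) (q y.2))) := by
    intro y
    rw [mkE, sel_eq]
    simp only [List.append_nil, List.mem_reverse, List.mem_filter, mem_prs, Bool.or_eq_true, hmask]
  have hes : ∀ y ∈ mkE n ed adj opt m, y.1 < y.2 ∧ y.2 < n := fun y hy => ((hmem y).1 hy).1
  simp only [bndB, List.all_eq_true, List.mem_range, Nat.blt_eq] at hb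
  refine H.red' n q hqe hinj hex (mkE n ed adj opt m) hes ?_ ?_ ?_ (fun i => T.getD i 12) hT
    (dcd n (tgs.getD m 0)) ?_ ?_ ?_
  · rw [mkE, sel_eq, List.append_nil, List.nodup_reverse]
    exact (nodup_prs n).filter _
  · intro y hy
    obtain ⟨⟨h1, h2⟩, h3⟩ := (hmem y).1 hy
    rcases h3 with h3 | h3
    · exact hconf _ _ h1 h2 h3
    · exact h3.2
  · intro i j hij hj hc
    rw [hmem]
    refine ⟨⟨hij, hj⟩, ?_⟩
    have h := h11 (i, j) ((mem_prs _ _).2 ⟨hij, hj⟩)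
    simp only [Bool.or_eq_true] at h
    rcases h with (h | h) | h
    · exact Or.inl h
    · right
      refine ⟨?_, hc⟩
      rw [inB_iff] at h
      rcases h with h | h
      · exact h
      · have := h14 _ h
        simp only [Nat.blt_eq] at this
        omega
    · rw [inB_iff] at h
      rcases h with h | h
      · exact absurd hc (hnon _ h)
      · exact absurd hc.symm (hnon _ h)
  · intro v hv
    simp only [dcd]
    rw [if_neg (by omega)]
  · intro i hi
    simp only [dcd, if_pos hi]
    exact hb i hi
  · exact coefR_ne_zero n _ _ (fun y hy => by have := hes y hy; omega) hf

end fincase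


section small
open SimpleGraph AT
variable {V : Type*} {G : SimpleGraph V} {L : Sym2 V → Finset ℕ} {F : Finset (Sym2 V)}

theorem Cex.hexN (H : Cex G L F) {v a b c : V} (hv : Touch F v) (h : Nb G v a b c) :
    s(v, a) ∈ F ∨ s(v, b) ∈ F ∨ s(v, c) ∈ F := by
  obtain ⟨e, heF, hve⟩ := hv
  obtain ⟨x, rfl⟩ := Sym2.mem_iff_exists.1 hve
  have hvx : G.Adj v x := H.edge _ heF
  rcases (h.2.2.2 x).1 hvx with rfl | rfl | rfl <;> tauto

theorem nconf {a b c d : V} (h1 : a ≠ c) (h2 : a ≠ d) (h3 : b ≠ c) (h4 : b ≠ d)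
    (h5 : ¬ G.Adj a c) (h6 : ¬ G.Adj a d) (h7 : ¬ G.Adj b c) (h8 : ¬ G.Adj b d) :
    ¬ Conf G s(a, b) s(c, d) := by
  rintro ⟨_, x, hx, y, hy, h⟩
  simp only [Sym2.mem_iff] at hx hy
  rcases hx with rfl | rfl <;> rcases hy with rfl | rfl <;> tauto

/-- list to vertex assignment -/
def vt (l : List V) (d : V) (i : ℕ) : V := l.getD i d

theorem forall_lt_succ' {P : ℕ → Prop} {n : ℕ} (h0 : P n) (h : ∀ i < n, P i) : ∀ i < n + 1, P i := by
  intro i hi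
  rcases Nat.lt_succ_iff_lt_or_eq.1 hi with h1 | rfl
  · exact h i h1
  · exact h0

theorem Cex.tri (H : Cex G L F) {v0 v1 v2 : V} (ht : Touch F v0) (h01 : G.Adj v0 v1)
    (h12 : G.Adj v1 v2) (h02 : G.Adj v0 v2) : False := by
  obtain ⟨u0, n0⟩ := H.nb3 h01 h02 h12.ne
  obtain ⟨u1, n1⟩ := H.nb3 h01.symm h12 h02.ne
  obtain ⟨u2, n2⟩ := H.nb3 h12.symm h02.symm h01.ne.symm
  have c01 := (H.cb n0 n1).2.2.2.2.1 rfl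
  have c12 := (H.cb n1.rot.swap n2).2.2.2.2.1 rfl
  have c20 := (H.cb n2.rot.swap n0.rot.swap).2.2.2.2.1 rfl
  refine H.fincase 6 [(0,3),(1,4),(2,5),(0,1),(1,2),(2,0)] [(0,1),(1,2),(2,0),(0,3),(1,4),(2,5)]
    [(3,1),(3,2),(4,0),(4,2),(5,0),(5,1)] [] [] [12,12,12,9,9,9] [0x543210]
    (vt [v0,v1,v2,u0,u1,u2] v0) (by decide +kernel) (by decide +kernel) ?_ ?_ ?_ ?_ ?_
  · simp only [List.forall_mem_cons]
    exact ⟨h01, h12, h02.symm, n0.a3, n1.a3, n2.a3, by simp⟩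
  · simp only [List.forall_mem_cons]
    exact ⟨n0.2.1.symm, n0.2.2.1.symm, n1.2.1.symm, n1.2.2.1.symm, n2.2.2.1.symm, n2.2.1.symm, by simp⟩
  · simp
  · intro i hi
    match i, hi with
    | 0, _ => exact H.cb12 n0.a3
    | 1, _ => exact H.cb12 n1.a3
    | 2, _ => exact H.cb12 n2.a3
    | 3, _ => exact c01
    | 4, _ => exact c12
    | 5, _ => exact c20
  · rcases H.hexN ht n0 with h | h | h
    · exact ⟨3, by omega, h⟩
    · exact ⟨5, by omega, by rw [Sym2.eq_swap]; exact h⟩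
    · exact ⟨0, by omega, h⟩

end small


section sq
open SimpleGraph AT
variable {V : Type*} {G : SimpleGraph V} {L : Sym2 V → Finset ℕ} {F : Finset (Sym2 V)}

theorem Nb.tw {v x y z : V} (h : Nb G v x y z) : Nb G v y x z := h.rot.swap

theorem Cex.kB1 (H : Cex G L F) {x y z0 z1 z2 w0 w : V} (ht : Touch F x) (hxy : x ≠ y)
    (nx : Nb G x z0 z1 z2) (ny : Nb G y z0 z1 z2) (n0 : Nb G z0 x y w0) (n1 : Nb G z1 x y w)
    (n2 : Nb G z2 x y w) : False := by
  have a0 := (H.cb nx n0).2.2.2.1 n1.a2 n2.a2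
  have b0 := (H.cb ny n0.tw).2.2.2.1 n1.a1 n2.a1
  have a1 := (H.cb nx.rot n1).2.2.2.2.2 n2.a2 n0.a2 n2.a3
  have b1 := (H.cb ny.rot n1.tw).2.2.2.2.2 n2.a1 n0.a1 n2.a3
  have a2 := (H.cb nx.rot.rot.swap n2).2.2.2.2.2 n1.a2 n0.a2 n1.a3
  have b2 := (H.cb ny.rot.rot.swap n2.tw).2.2.2.2.2 n1.a1 n0.a1 n1.a3
  refine H.fincase 6 [(0,2),(1,2),(0,3),(1,3),(0,4),(1,4)]
    [(0,2),(1,2),(0,3),(1,3),(0,4),(1,4)]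
    [(0,1),(2,3),(2,4),(3,4)] [] [] [10,10,9,9,9,9] [0x543210]
    (vt [x,y,z0,z1,z2] x) (by decide +kernel) (by decide +kernel) ?_ ?_ ?_ ?_ ?_
  · simp only [List.forall_mem_cons]
    exact ⟨nx.a1, ny.a1, nx.a2, ny.a2, nx.a3, ny.a3, by simp⟩
  · simp only [List.forall_mem_cons]
    exact ⟨hxy, nx.1, nx.2.1, nx.2.2.1, by simp⟩
  · simp
  · intro i hi
    match i, hi with
    | 0, _ => exact a0
    | 1, _ => exact b0
    | 2, _ => exact a1
    | 3, _ => exact b1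
    | 4, _ => exact a2
    | 5, _ => exact b2
  · rcases H.hexN ht nx with h | h | h
    · exact ⟨0, by omega, h⟩
    · exact ⟨2, by omega, h⟩
    · exact ⟨4, by omega, h⟩

theorem Cex.kB2 (H : Cex G L F) {x y z0 z1 z2 w0 w1 w2 : V} (ht : Touch F x) (hxy : x ≠ y)
    (nx : Nb G x z0 z1 z2) (ny : Nb G y z0 z1 z2) (n0 : Nb G z0 x y w0) (n1 : Nb G z1 x y w1)
    (n2 : Nb G z2 x y w2) (h01 : w0 ≠ w1)
    (hn : ¬ G.Adj w0 w1) : False := by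
  have a0 := (H.cb nx n0).2.2.2.1 n1.a2 n2.a2
  have b0 := (H.cb ny n0.tw).2.2.2.1 n1.a1 n2.a1
  have a1 := (H.cb nx.rot n1).2.2.2.1 n2.a2 n0.a2
  have b1 := (H.cb ny.rot n1.tw).2.2.2.1 n2.a1 n0.a1
  have a2 := (H.cb nx.rot.rot.swap n2).2.2.2.1 n1.a2 n0.a2
  have b2 := (H.cb ny.rot.rot.swap n2.tw).2.2.2.1 n1.a1 n0.a1
  have e01 : ¬ G.Adj z0 z1 := fun h => H.tri ht nx.a1 h nx.a2
  have e02 : ¬ G.Adj z0 z2 := fun h => H.tri ht nx.a1 h nx.a3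
  have e12 : ¬ G.Adj z1 z2 := fun h => H.tri ht nx.a2 h nx.a3
  have f1 : z0 ≠ w1 := fun h => e01 (by rw [h]; exact n1.a3.symm)
  have f2 : z0 ≠ w2 := fun h => e02 (by rw [h]; exact n2.a3.symm)
  have f3 : z1 ≠ w2 := fun h => e12 (by rw [h]; exact n2.a3.symm)
  have f4 : w0 ≠ z1 := fun h => e01 (by rw [← h]; exact n0.a3)
  refine H.fincase 9 [(2,5),(3,6),(4,7),(0,2),(0,3),(0,4),(1,2),(1,3),(1,4)]
    [(0,2),(1,2),(0,3),(1,3),(0,4),(1,4),(2,5),(3,6),(4,7)]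
    [(0,1),(2,3),(2,4),(3,4),(2,6),(2,7),(3,7),(5,0),(5,1),(6,0),(6,1),(7,0),(7,1)] [(0,2),(1,2)] [(0,1)] [12,12,12,10,10,10,10,10,10]
    [0x452367330,0x473652430,0x564732403,0x732465044]
    (vt [x,y,z0,z1,z2,w0,w1,w2] x) (by decide +kernel) (by decide +kernel) ?_ ?_ ?_ ?_ ?_
  · simp only [List.forall_mem_cons]
    exact ⟨nx.a1, ny.a1, nx.a2, ny.a2, nx.a3, ny.a3, n0.a3, n1.a3, n2.a3, by simp⟩
  · simp only [List.forall_mem_cons]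
    exact ⟨hxy, nx.1, nx.2.1, nx.2.2.1, f1, f2, f3, n0.2.1.symm, n0.2.2.1.symm, n1.2.1.symm, n1.2.2.1.symm,
      n2.2.1.symm, n2.2.2.1.symm, by simp⟩
  · simp only [List.forall_mem_cons]
    refine ⟨nconf nx.1 f1 f4 h01 e01 ?_ ?_ hn, by simp⟩
    · intro h
      rcases (n0.2.2.2 _).1 h with h | h | h
      · exact n1.2.1 h.symm
      · exact n1.2.2.1 h.symm
      · exact h01 h.symm
    · intro h
      rcases (n1.2.2.2 _).1 h.symm with h | h | h
      · exact n0.2.1 h.symm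
      · exact n0.2.2.1 h.symm
      · exact h01 h
  · intro i hi
    match i, hi with
    | 0, _ => exact H.cb12 n0.a3
    | 1, _ => exact H.cb12 n1.a3
    | 2, _ => exact H.cb12 n2.a3
    | 3, _ => exact a0
    | 4, _ => exact a1
    | 5, _ => exact a2
    | 6, _ => exact b0
    | 7, _ => exact b1
    | 8, _ => exact b2
  · rcases H.hexN ht nx with h | h | h
    · exact ⟨3, by omega, h⟩
    · exact ⟨4, by omega, h⟩
    · exact ⟨5, by omega, h⟩

theorem Cex.k23 (H : Cex G L F) {x y z0 z1 z2 : V} (ht : Touch F x) (hxy : x ≠ y)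
    (nx : Nb G x z0 z1 z2) (ny : Nb G y z0 z1 z2) : False := by
  obtain ⟨w0, n0⟩ := H.nb3 nx.a1.symm ny.a1.symm hxy
  obtain ⟨w1, n1⟩ := H.nb3 nx.a2.symm ny.a2.symm hxy
  obtain ⟨w2, n2⟩ := H.nb3 nx.a3.symm ny.a3.symm hxy
  by_cases h12 : w1 = w2
  · subst h12; exact H.kB1 ht hxy nx ny n0 n1 n2
  by_cases h02 : w0 = w2
  · subst h02; exact H.kB1 ht hxy nx.tw ny.tw n1 n0 n2
  by_cases h01 : w0 = w1
  · subst h01; exact H.kB1 ht hxy nx.rot.rot ny.rot.rot n2 n0 n1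
  by_cases a01 : G.Adj w0 w1
  · by_cases a02 : G.Adj w0 w2
    · by_cases a12 : G.Adj w1 w2
      · exact H.tri (H.closed (H.closed ht nx.a1) n0.a3) a01 a12 a02
      · exact H.kB2 ht hxy nx.rot ny.rot n1 n2 n0 h12 a12
    · exact H.kB2 ht hxy nx.swap ny.swap n0 n2 n1 h02 a02
  · exact H.kB2 ht hxy nx ny n0 n1 n2 h01 a01

/-- a 4-cycle with its neighbours -/
structure Sq (G : SimpleGraph V) (v0 v1 v2 v3 u0 u1 u2 u3 : V) : Prop where
  n0 : Nb G v0 v1 v3 u0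
  n1 : Nb G v1 v2 v0 u1
  n2 : Nb G v2 v3 v1 u2
  n3 : Nb G v3 v0 v2 u3

theorem Sq.rot {v0 v1 v2 v3 u0 u1 u2 u3 : V} (S : Sq G v0 v1 v2 v3 u0 u1 u2 u3) :
    Sq G v1 v2 v3 v0 u1 u2 u3 u0 := ⟨S.n1, S.n2, S.n3, S.n0⟩

theorem Sq.ne1 {v0 v1 v2 v3 u0 u1 u2 u3 : V}
    (S : Sq G v0 v1 v2 v3 u0 u1 u2 u3) (H : Cex G L F) (ht : Touch F v0) : u0 ≠ u1 ∧ u0 ≠ v2 ∧ u0 ≠ u2 ∧ u0 ≠ u3 := by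
  refine ⟨?_, ?_, ?_, ?_⟩
  · rintro rfl
    exact H.tri ht S.n0.a1 S.n1.a3 S.n0.a3
  · rintro rfl
    exact H.tri ht S.n0.a1 S.n1.a1 S.n0.a3
  · rintro rfl
    exact H.k23 ht S.n1.1.symm S.n0 S.n2.tw
  · rintro rfl
    exact H.tri ht S.n0.a2 S.n3.a3 S.n0.a3

theorem Sq.na {v0 v1 v2 v3 u0 u1 u2 u3 : V} (S : Sq G v0 v1 v2 v3 u0 u1 u2 u3) (H : Cex G L F)
    (ht : Touch F v0) :
    ¬ G.Adj u0 v1 ∧ ¬ G.Adj u0 v2 ∧ ¬ G.Adj u0 v3 ∧ ¬ G.Adj v0 v2 := by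
  have k0 := S.ne1 H ht
  refine ⟨fun h => ?_, fun h => ?_, fun h => ?_, fun h => ?_⟩
  · exact H.tri ht S.n0.a3 h S.n0.a1
  · rcases (S.n2.2.2.2 _).1 h.symm with h | h | h
    · exact S.n0.2.2.1 h.symm
    · exact S.n0.2.1 h.symm
    · exact k0.2.2.1 h
  · exact H.tri ht S.n0.a3 h S.n0.a2
  · exact H.tri ht S.n0.a1 S.n1.a1 h

theorem Sq.cD {v0 v1 v2 v3 u0 u1 u2 u3 : V}
    (S : Sq G v0 v1 v2 v3 u0 u1 u2 u3) (H : Cex G L F) (ht : Touch F v0) (h : G.Adj u0 u1) : False := by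
  have k0 := S.ne1 H ht
  have k1 := S.rot.ne1 H (H.closed ht S.n0.a1)
  have k2 := S.rot.rot.ne1 H (H.closed (H.closed ht S.n0.a1) S.n1.a1)
  have k3 := S.rot.rot.rot.ne1 H (H.closed ht S.n0.a2)
  have c1 := (H.cb S.n0 S.n1.tw).2.1 S.n2.a1.symm
  have c2 := (H.cb S.n1 S.n2.tw).2.1 S.n3.a1.symm
  have c3 := (H.cb S.n2 S.n3.tw).2.1 S.n0.a1.symm
  have c4 := (H.cb S.n3 S.n0.tw).2.1 S.n1.a1.symm
  have q0 := S.na H ht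
  have q1 := S.rot.na H (H.closed ht S.n0.a1)
  have q2 := S.rot.rot.na H (H.closed (H.closed ht S.n0.a1) S.n1.a1)
  have q3 := S.rot.rot.rot.na H (H.closed ht S.n0.a2)
  obtain ⟨w0, m0⟩ := H.nb3 S.n0.a3.symm h S.n1.2.2.1
  obtain ⟨w1, m1⟩ := H.nb3 S.n1.a3.symm h.symm S.n0.2.1
  have d1 := (H.cb S.n0.rot.rot m0).2.1 S.n1.a3
  have d2 := (H.cb S.n1.rot.rot.swap m1).2.1 S.n0.a3
  have d3 := (H.cb m0.tw m1.tw).2.1 S.n0.a1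
  have d4 := (H.cb S.n0.swap.swap S.n1.tw).2.2.1 S.n2.a1.symm h
  refine H.fincase 9 [(2,6),(3,7),(0,4),(1,5),(4,5),(1,2),(2,3),(3,0),(0,1)]
    [(0,1),(1,2),(2,3),(3,0),(0,4),(1,5),(2,6),(3,7),(4,5)]
    [(0,2),(1,3),(4,1),(4,2),(4,3),(5,0),(5,2),(5,3),(6,0),(6,1),(6,3),(7,0),(7,1),(7,2),
     (4,5),(4,6),(4,7),(5,6),(5,7),(6,7)]
    [(0,2),(1,3),(0,4),(1,4)] [(4,6)]
    [12,12,11,11,11,11,11,11,10]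
    [0x765533020, 0x765530402, 0x765435020, 0x765335220, 0x765444020, 0x745535022, 0x765544020,
     0x765532420, 0x755445020, 0x765540402, 0x755634210, 0x765145402, 0x765454020, 0x765553120,
     0x765055312, 0x765344501]
    (vt [v0,v1,v2,v3,u0,u1,u2,u3] v0) (by decide +kernel) (by decide +kernel) ?_ ?_ ?_ ?_ ?_
  · simp only [List.forall_mem_cons]
    exact ⟨S.n0.a1, S.n1.a1, S.n2.a1, S.n3.a1, S.n0.a3, S.n1.a3, S.n2.a3, S.n3.a3, h, by simp⟩
  · simp only [List.forall_mem_cons]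
    exact ⟨S.n1.1.symm, S.n2.1.symm, S.n0.2.1.symm, k0.2.1, S.n0.2.2.1.symm,
      S.n1.2.2.1.symm, S.n1.2.1.symm, k1.2.1, k2.2.1, S.n2.2.2.1.symm, S.n2.2.1.symm,
      S.n3.2.1.symm, k3.2.1, S.n3.2.2.1.symm,
      k0.1, k0.2.2.1, k0.2.2.2, k1.1, k1.2.2.1, k2.1, by simp⟩
  · simp only [List.forall_mem_cons]
    exact ⟨nconf k0.2.1 S.n0.2.2.1.symm S.n1.2.1.symm k1.2.1 q0.2.1 q0.2.2.1 q1.1 q1.2.1, by simp⟩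
  · intro i hi
    match i, hi with
    | 0, _ => exact H.cb12 S.n2.a3
    | 1, _ => exact H.cb12 S.n3.a3
    | 2, _ => exact d1
    | 3, _ => exact d2
    | 4, _ => exact d3
    | 5, _ => exact c2
    | 6, _ => exact c3
    | 7, _ => exact c4
    | 8, _ => exact d4
  · rcases H.hexN ht S.n0 with h | h | h
    · exact ⟨8, by omega, h⟩
    · exact ⟨7, by omega, by rw [Sym2.eq_swap]; exact h⟩
    · exact ⟨2, by omega, h⟩

theorem Sq.cC {v0 v1 v2 v3 u0 u1 u2 u3 : V}
    (S : Sq G v0 v1 v2 v3 u0 u1 u2 u3) (H : Cex G L F) (ht : Touch F v0) (h : G.Adj u0 u2)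
    (e01 : ¬ G.Adj u0 u1) (e12 : ¬ G.Adj u1 u2) (e23 : ¬ G.Adj u2 u3) (e30 : ¬ G.Adj u3 u0) : False := by
  have k0 := S.ne1 H ht
  have k1 := S.rot.ne1 H (H.closed ht S.n0.a1)
  have k2 := S.rot.rot.ne1 H (H.closed (H.closed ht S.n0.a1) S.n1.a1)
  have k3 := S.rot.rot.rot.ne1 H (H.closed ht S.n0.a2)
  have c1 := (H.cb S.n0 S.n1.tw).2.1 S.n2.a1.symm
  have c2 := (H.cb S.n1 S.n2.tw).2.1 S.n3.a1.symm
  have c3 := (H.cb S.n2 S.n3.tw).2.1 S.n0.a1.symm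
  have c4 := (H.cb S.n3 S.n0.tw).2.1 S.n1.a1.symm
  have q0 := S.na H ht
  have q1 := S.rot.na H (H.closed ht S.n0.a1)
  have q2 := S.rot.rot.na H (H.closed (H.closed ht S.n0.a1) S.n1.a1)
  have q3 := S.rot.rot.rot.na H (H.closed ht S.n0.a2)
  obtain ⟨w0, m0⟩ := H.nb3 S.n0.a3.symm h k2.2.1.symm
  obtain ⟨w2, m2⟩ := H.nb3 S.n2.a3.symm h.symm k0.2.1.symm
  have x1 : w0 ≠ v1 := fun hh => q0.1 (by rw [← hh]; exact m0.a3)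
  have x2 : w0 ≠ v2 := fun hh => q0.2.1 (by rw [← hh]; exact m0.a3)
  have x3 : w0 ≠ v3 := fun hh => q0.2.2.1 (by rw [← hh]; exact m0.a3)
  have y1 : w2 ≠ v1 := fun hh => q2.2.2.1 (by rw [← hh]; exact m2.a3)
  have y0 : w2 ≠ v0 := fun hh => q2.2.1 (by rw [← hh]; exact m2.a3)
  have y3 : w2 ≠ v3 := fun hh => q2.1 (by rw [← hh]; exact m2.a3)
  have x4 : w0 ≠ u1 := fun hh => e01 (by rw [← hh]; exact m0.a3)
  have x5 : w0 ≠ u3 := fun hh => e30 (by rw [← hh]; exact m0.a3.symm)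
  have y4 : w2 ≠ u1 := fun hh => e12 (by rw [← hh]; exact m2.a3.symm)
  have y5 : w2 ≠ u3 := fun hh => e23 (by rw [← hh]; exact m2.a3)
  have x6 : ¬ G.Adj w0 v1 := fun hh => by
    rcases (S.n1.2.2.2 _).1 hh.symm with hh | hh | hh
    exacts [x2 hh, m0.2.1 hh.symm, x4 hh]
  have x7 : ¬ G.Adj w0 v2 := fun hh => by
    rcases (S.n2.2.2.2 _).1 hh.symm with hh | hh | hh
    exacts [x3 hh, x1 hh, m0.2.2.1 hh.symm]
  have x8 : ¬ G.Adj w0 v3 := fun hh => by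
    rcases (S.n3.2.2.2 _).1 hh.symm with hh | hh | hh
    exacts [m0.2.1 hh.symm, x2 hh, x5 hh]
  have y6 : ¬ G.Adj w2 v1 := fun hh => by
    rcases (S.n1.2.2.2 _).1 hh.symm with hh | hh | hh
    exacts [m2.2.1 hh.symm, y0 hh, y4 hh]
  have y7 : ¬ G.Adj w2 v0 := fun hh => by
    rcases (S.n0.2.2.2 _).1 hh.symm with hh | hh | hh
    exacts [y1 hh, y3 hh, m2.2.2.1 hh.symm]
  have y8 : ¬ G.Adj w2 v3 := fun hh => by
    rcases (S.n3.2.2.2 _).1 hh.symm with hh | hh | hh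
    exacts [y0 hh, m2.2.1 hh.symm, y5 hh]
  refine H.fincase 11 [(4,8),(6,9),(1,5),(3,7),(4,6),(0,4),(2,6),(0,1),(1,2),(2,3),(3,0)]
    [(0,1),(1,2),(2,3),(3,0),(0,4),(1,5),(2,6),(3,7),(4,6),(4,8),(6,9)]
    [(0,2),(1,3),(4,1),(4,2),(4,3),(5,0),(5,2),(5,3),(6,0),(6,1),(6,3),(7,0),(7,1),(7,2),
     (4,5),(4,6),(4,7),(5,6),(5,7),(6,7),(8,6),(9,4),(8,0),(9,2),(8,1),(8,3),(9,1),(9,3)]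
    [(2,3),(0,2),(1,2),(0,3),(1,3)] [(2,4),(3,4),(0,8),(0,9),(1,7),(1,10)]
    [12,12,12,12,12,12,12,11,11,11,11]
    [0x77530753133, 0x52777550403, 0x77207653404, 0x57377540404, 0x77525740440, 0x65774540530,
     0x77565250540, 0x70751754443, 0x75705754203, 0x77206753234, 0x40776754330, 0x72707554505,
     0x77255750404, 0x30776555540, 0x7577254505, 0x45767454222, 0x75707454303, 0x77366554021,
     0x77407654204, 0x67517055344, 0x50777254450, 0x50777353550, 0x77605652504, 0x70727555550,
     0x47077654330, 0x57077556140, 0x57077555240, 0x77563554213, 0x57072755450, 0x64770455442,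
     0x77055755250, 0x7574756404]
    (vt [v0,v1,v2,v3,u0,u1,u2,u3,w0,w2] v0) (by decide +kernel) (by decide +kernel) ?_ ?_ ?_ ?_ ?_
  · simp only [List.forall_mem_cons]
    exact ⟨S.n0.a1, S.n1.a1, S.n2.a1, S.n3.a1, S.n0.a3, S.n1.a3, S.n2.a3, S.n3.a3, h, m0.a3, m2.a3, by simp⟩
  · simp only [List.forall_mem_cons]
    exact ⟨S.n1.1.symm, S.n2.1.symm, S.n0.2.1.symm, k0.2.1, S.n0.2.2.1.symm,
      S.n1.2.2.1.symm, S.n1.2.1.symm, k1.2.1, k2.2.1, S.n2.2.2.1.symm, S.n2.2.1.symm,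
      S.n3.2.1.symm, k3.2.1, S.n3.2.2.1.symm,
      k0.1, k0.2.2.1, k0.2.2.2, k1.1, k1.2.2.1, k2.1, m0.2.2.1.symm, m2.2.2.1.symm, m0.2.1.symm, m2.2.1.symm,
      x1, x3, y1, y3, by simp⟩
  · simp only [List.forall_mem_cons]
    exact ⟨nconf S.n0.2.1 S.n2.2.2.1 k0.1.symm k1.1 (fun hh => q0.1 hh.symm)
        (fun hh => q2.2.2.1 hh.symm) (fun hh => e01 hh.symm) e12,
      nconf S.n0.2.2.1 S.n2.2.1 k0.2.2.2.symm k2.1.symm (fun hh => q0.2.2.1 hh.symm)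
        (fun hh => q2.1 hh.symm) e30 (fun hh => e23 hh.symm),
      nconf S.n0.2.1.symm k0.2.1 x1 x2 q0.1 q0.2.1 x6 x7,
      nconf k0.2.1 S.n0.2.2.1.symm x2 x3 q0.2.1 q0.2.2.1 x7 x8,
      nconf k2.2.1 S.n2.2.2.1.symm y0 y1 q2.2.1 q2.2.2.1 y7 y6,
      nconf S.n2.2.1.symm k2.2.1 y3 y0 q2.1 q2.2.1 y8 y7, by simp⟩
  · intro i hi
    match i, hi with
    | 0, _ => exact H.cb12 m0.a3
    | 1, _ => exact H.cb12 m2.a3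
    | 2, _ => exact H.cb12 S.n1.a3
    | 3, _ => exact H.cb12 S.n3.a3
    | 4, _ => exact H.cb12 h
    | 5, _ => exact H.cb12 S.n0.a3
    | 6, _ => exact H.cb12 S.n2.a3
    | 7, _ => exact c1
    | 8, _ => exact c2
    | 9, _ => exact c3
    | 10, _ => exact c4
  · rcases H.hexN ht S.n0 with h | h | h
    · exact ⟨7, by omega, h⟩
    · exact ⟨10, by omega, by rw [Sym2.eq_swap]; exact h⟩
    · exact ⟨5, by omega, h⟩

theorem Sq.cA {v0 v1 v2 v3 u0 u1 u2 u3 : V}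
    (S : Sq G v0 v1 v2 v3 u0 u1 u2 u3) (H : Cex G L F) (ht : Touch F v0) (e02 : ¬ G.Adj u0 u2) (e13 : ¬ G.Adj u1 u3) : False := by
  have k0 := S.ne1 H ht
  have k1 := S.rot.ne1 H (H.closed ht S.n0.a1)
  have k2 := S.rot.rot.ne1 H (H.closed (H.closed ht S.n0.a1) S.n1.a1)
  have k3 := S.rot.rot.rot.ne1 H (H.closed ht S.n0.a2)
  have c1 := (H.cb S.n0 S.n1.tw).2.1 S.n2.a1.symm
  have c2 := (H.cb S.n1 S.n2.tw).2.1 S.n3.a1.symm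
  have c3 := (H.cb S.n2 S.n3.tw).2.1 S.n0.a1.symm
  have c4 := (H.cb S.n3 S.n0.tw).2.1 S.n1.a1.symm
  have q0 := S.na H ht
  have q1 := S.rot.na H (H.closed ht S.n0.a1)
  have q2 := S.rot.rot.na H (H.closed (H.closed ht S.n0.a1) S.n1.a1)
  have q3 := S.rot.rot.rot.na H (H.closed ht S.n0.a2)
  refine H.fincase 8 [(0,1),(1,2),(2,3),(3,0),(0,4),(1,5),(2,6),(3,7)]
    [(0,1),(1,2),(2,3),(3,0),(0,4),(1,5),(2,6),(3,7)]
    [(0,2),(1,3),(4,1),(4,2),(4,3),(5,0),(5,2),(5,3),(6,0),(6,1),(6,3),(7,0),(7,1),(7,2),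
     (4,5),(4,6),(4,7),(5,6),(5,7),(6,7)]
    [] [(4,6),(5,7)]
    [11,11,11,11,12,12,12,12]
    [0x33332345]
    (vt [v0,v1,v2,v3,u0,u1,u2,u3] v0) (by decide +kernel) (by decide +kernel) ?_ ?_ ?_ ?_ ?_
  · simp only [List.forall_mem_cons]
    exact ⟨S.n0.a1, S.n1.a1, S.n2.a1, S.n3.a1, S.n0.a3, S.n1.a3, S.n2.a3, S.n3.a3, by simp⟩
  · simp only [List.forall_mem_cons]
    exact ⟨S.n1.1.symm, S.n2.1.symm, S.n0.2.1.symm, k0.2.1, S.n0.2.2.1.symm,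
      S.n1.2.2.1.symm, S.n1.2.1.symm, k1.2.1, k2.2.1, S.n2.2.2.1.symm, S.n2.2.1.symm,
      S.n3.2.1.symm, k3.2.1, S.n3.2.2.1.symm,
      k0.1, k0.2.2.1, k0.2.2.2, k1.1, k1.2.2.1, k2.1, by simp⟩
  · simp only [List.forall_mem_cons]
    exact ⟨nconf S.n1.1.symm k2.2.1.symm k0.2.1 k0.2.2.1 q0.2.2.2 (fun hh => q2.2.1 hh.symm) q0.2.1 e02,
      nconf S.n2.1.symm k3.2.1.symm k1.2.1 k1.2.2.1 q1.2.2.2 (fun hh => q3.2.1 hh.symm) q1.2.1 e13, by simp⟩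
  · intro i hi
    match i, hi with
    | 0, _ => exact c1
    | 1, _ => exact c2
    | 2, _ => exact c3
    | 3, _ => exact c4
    | 4, _ => exact H.cb12 S.n0.a3
    | 5, _ => exact H.cb12 S.n1.a3
    | 6, _ => exact H.cb12 S.n2.a3
    | 7, _ => exact H.cb12 S.n3.a3
  · rcases H.hexN ht S.n0 with h | h | h
    · exact ⟨0, by omega, h⟩
    · exact ⟨3, by omega, by rw [Sym2.eq_swap]; exact h⟩
    · exact ⟨4, by omega, h⟩

theorem Cex.sq (H : Cex G L F) {v0 v1 v2 v3 : V} (ht : Touch F v0) (h01 : G.Adj v0 v1)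
    (h12 : G.Adj v1 v2) (h23 : G.Adj v2 v3) (h30 : G.Adj v3 v0) (h02 : v0 ≠ v2) (h13 : v1 ≠ v3) :
    False := by
  obtain ⟨u0, n0⟩ := H.nb3 h01 h30.symm h13
  obtain ⟨u1, n1⟩ := H.nb3 h12 h01.symm h02.symm
  obtain ⟨u2, n2⟩ := H.nb3 h23 h12.symm h13.symm
  obtain ⟨u3, n3⟩ := H.nb3 h30 h23.symm h02
  have S : Sq G v0 v1 v2 v3 u0 u1 u2 u3 := ⟨n0, n1, n2, n3⟩
  have t1 := H.closed ht h01
  have t2 := H.closed t1 h12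
  have t3 := H.closed t2 h23
  have e01 : ¬ G.Adj u0 u1 := fun h => S.cD H ht h
  have e12 : ¬ G.Adj u1 u2 := fun h => S.rot.cD H t1 h
  have e23 : ¬ G.Adj u2 u3 := fun h => S.rot.rot.cD H t2 h
  have e30 : ¬ G.Adj u3 u0 := fun h => S.rot.rot.rot.cD H t3 h
  exact S.cA H ht (fun h => S.cC H ht h e01 e12 e23 e30) (fun h => S.rot.cC H t1 h e12 e23 e30 e01)

end sq


section cyc
open SimpleGraph AT
variable {V : Type*} {G : SimpleGraph V} {L : Sym2 V → Finset ℕ} {F : Finset (Sym2 V)}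

/-- nonbacktracking walk: start, length, last but one, last -/
inductive NW (G : SimpleGraph V) : V → ℕ → V → V → Prop
  | one {x y : V} : G.Adj x y → NW G x 1 x y
  | snoc {x z w t : V} {m : ℕ} : NW G x m z w → G.Adj w t → t ≠ z → NW G x (m + 1) w t

theorem NW.ext {g : ℕ → V} (h1 : ∀ i, G.Adj (g i) (g (i + 1))) (h2 : ∀ i, g i ≠ g (i + 2))
    {x : V} {m i : ℕ} (h : NW G x m (g i) (g (i + 1))) (d : ℕ) :
    NW G x (m + d) (g (i + d)) (g (i + d + 1)) := by
  induction d with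
  | zero => exact h
  | succ d ih => exact ih.snoc (h1 _) (h2 (i + d)).symm

theorem NW.sub {g : ℕ → V} {n : ℕ} (h1 : ∀ i < n, G.Adj (g i) (g (i + 1)))
    (h2 : ∀ i, i + 1 < n → g i ≠ g (i + 2)) (a d : ℕ) (h : a + d + 1 ≤ n) :
    NW G (g a) (d + 1) (g (a + d)) (g (a + d + 1)) := by
  induction d with
  | zero => exact NW.one (h1 _ (by omega))
  | succ d ih => exact (ih (by omega)).snoc (h1 _ (by omega)) (h2 (a + d) (by omega)).symm

theorem NW.pos {x z w : V} {m : ℕ} (h : NW G x m z w) : 1 ≤ m := by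
  cases h <;> omega

theorem NW.fn {x z w : V} {m : ℕ} (h : NW G x m z w) : ∃ f : ℕ → V, f 0 = x ∧ f (m - 1) = z ∧
    f m = w ∧ (∀ i < m, G.Adj (f i) (f (i + 1))) ∧ ∀ i, i + 1 < m → f i ≠ f (i + 2) := by
  induction h with
  | @one y h =>
    refine ⟨fun i => if i = 0 then x else y, by simp, by simp, by simp, ?_, ?_⟩
    · intro i hi
      obtain rfl : i = 0 := by omega
      simpa using h
    · intro i hi; omega
  | @snoc z w t m hN ha hne ih =>
    obtain ⟨f, h0, h1, h2, h3, h4⟩ := ih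
    have hm := hN.pos
    refine ⟨fun i => if i ≤ m then f i else t, by simpa using h0, by simpa using h2, by simp, ?_, ?_⟩
    · intro i hi
      rcases Nat.lt_or_ge i m with h | h
      · simp only [if_pos h.le, if_pos (Nat.succ_le_of_lt h)]
        exact h3 i h
      · obtain rfl : i = m := by omega
        simpa [h2] using ha
    · intro i hi
      rcases Nat.lt_or_ge (i + 1) m with h | h
      · simp only [if_pos (show i ≤ m by omega), if_pos (show i + 2 ≤ m by omega)]
        exact h4 i h
      · obtain rfl : m = i + 1 := by omega
        have : f i = z := h1
        simp [this, hne.symm]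

/-- an induced shortest cycle in the touched part -/
structure Cyc (G : SimpleGraph V) (F : Finset (Sym2 V)) (k : ℕ) (f u : ℕ → V) : Prop where
  three : 3 ≤ k
  touch : ∀ i, Touch F (f i)
  per : ∀ i, f (i + k) = f i
  peru : ∀ i, u (i + k) = u i
  adj : ∀ i, G.Adj (f i) (f (i + 1))
  nbt : ∀ i, f i ≠ f (i + 2)
  nb : ∀ i, Nb G (f (i + 1)) (f i) (f (i + 2)) (u (i + 1))
  min : ∀ m < k, ∀ x z, Touch F x → ¬ NW G x m z x

theorem Cex.exCyc (H : Cex G L F) : ∃ k f u, Cyc G F k f u := by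
  classical
  have hne : F.Nonempty := by
    rw [Finset.nonempty_iff_ne_empty]
    rintro rfl
    exact H.bad ⟨fun _ => 0, by simp, by simp⟩
  obtain ⟨e, he⟩ := hne
  obtain ⟨v0, v1, hadj, ht0⟩ : ∃ v0 v1, G.Adj v0 v1 ∧ Touch F v0 := by
    induction e using Sym2.ind with
    | _ a b => exact ⟨a, b, H.edge _ he, _, he, Sym2.mem_mk_left _ _⟩
  have hstep : ∀ p : V × V, ∃ t, G.Adj p.1 p.2 → G.Adj p.2 t ∧ t ≠ p.1 := by
    rintro ⟨a, b⟩
    by_cases h : G.Adj a b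
    · obtain ⟨y, z, hb⟩ := H.nb2 h.symm
      exact ⟨y, fun _ => ⟨hb.a2, hb.1.symm⟩⟩
    · exact ⟨a, fun h' => absurd h' h⟩
  choose nx hnx using hstep
  let P : ℕ → V × V := fun n => Nat.rec (v0, v1) (fun _ p => (p.2, nx p)) n
  have hP : ∀ n, P (n + 1) = ((P n).2, nx (P n)) := fun n => rfl
  have hPa : ∀ n, G.Adj (P n).1 (P n).2 := by
    intro n
    induction n with
    | zero => exact hadj
    | succ n ih => rw [hP]; exact (hnx _ ih).1
  let g : ℕ → V := fun n => (P n).1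
  have g1 : ∀ i, G.Adj (g i) (g (i + 1)) := hPa
  have g2 : ∀ i, g i ≠ g (i + 2) := fun i => (hnx _ (hPa i)).2.symm
  have gt : ∀ i, Touch F (g i) := by
    intro i
    induction i with
    | zero => exact ht0
    | succ i ih => exact H.closed ih (g1 i)
  have hfin : {v | Touch F v}.Finite := by
    have : {v | Touch F v} = ⋃ e ∈ F, {v | v ∈ e} := by
      ext v; simp [Touch]
    rw [this]
    refine Set.Finite.biUnion F.finite_toSet fun e _ => ?_
    induction e using Sym2.ind with
    | _ a b =>
      refine (Set.toFinite {a, b}).subset ?_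
      intro v hv
      simpa using hv
  have hex : ∃ m, ∃ x z, Touch F x ∧ NW G x m z x := by
    have := hfin.to_subtype
    obtain ⟨i, j, hij, h⟩ := Finite.exists_ne_map_eq_of_infinite
      (fun n : ℕ => (⟨g n, gt n⟩ : {v | Touch F v}))
    replace h : g i = g j := congrArg Subtype.val h
    wlog hlt : i < j generalizing i j
    · exact this j i hij.symm h.symm (lt_of_le_of_ne (not_lt.1 hlt) hij.symm)
    obtain ⟨d, rfl⟩ := Nat.exists_eq_add_of_lt hlt
    have := NW.ext g1 g2 (NW.one (g1 i)) d
    rw [← h] at this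
    exact ⟨_, _, _, gt i, this⟩
  obtain ⟨x, z, hx, hN⟩ := Nat.find_spec hex
  have hmin : ∀ m < Nat.find hex, ∀ x z, Touch F x → ¬ NW G x m z x :=
    fun m hm x z h1 h2 => Nat.find_min hex hm ⟨x, z, h1, h2⟩
  generalize Nat.find hex = k at hN hmin
  obtain ⟨f, h0, -, hk, h3, h4⟩ := hN.fn
  have hk1 := hN.pos
  have k3 : 3 ≤ k := by
    by_contra hlt
    obtain rfl | rfl : k = 1 ∨ k = 2 := by omega
    · have := h3 0 (by omega)
      rw [h0, hk] at this
      exact G.loopless.irrefl _ this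
    · exact h4 0 (by omega) (by rw [h0, hk])
  have ft : ∀ i ≤ k, Touch F (f i) := by
    intro i hi
    induction i with
    | zero => rw [h0]; exact hx
    | succ i ih => exact H.closed (ih (by omega)) (h3 i (by omega))
  have hw : f 1 ≠ f (k - 1) := by
    intro h
    have h5 := NW.sub h3 h4 1 (k - 3) (by omega)
    rw [show 1 + (k - 3) + 1 = k - 1 by omega, ← h] at h5
    exact hmin _ (by omega) _ _ (ft 1 (by omega)) h5
  have p : ∀ i, f ((i + k) % k) = f (i % k) := fun i => by rw [Nat.add_mod_right]
  have A : ∀ i, G.Adj (f (i % k)) (f ((i + 1) % k)) := by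
    intro i
    have hlt := Nat.mod_lt i (by omega : 0 < k)
    rw [Nat.add_mod, Nat.mod_eq_of_lt (show 1 < k by omega)]
    rcases Nat.lt_or_ge (i % k + 1) k with h | h
    · rw [Nat.mod_eq_of_lt h]; exact h3 _ hlt
    · have e : i % k + 1 = k := by omega
      have := h3 _ hlt
      rw [e] at this ⊢
      rw [Nat.mod_self, h0, ← hk]; exact this
  have B : ∀ i, f (i % k) ≠ f ((i + 2) % k) := by
    intro i
    have hlt := Nat.mod_lt i (by omega : 0 < k)
    rw [Nat.add_mod, Nat.mod_eq_of_lt (show 2 < k by omega)]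
    rcases Nat.lt_or_ge (i % k + 2) k with h | h
    · rw [Nat.mod_eq_of_lt h]; exact h4 _ (by omega)
    · rcases Nat.lt_or_ge k (i % k + 2) with h' | h'
      · have e : i % k + 2 = k + 1 := by omega
        have e' : i % k = k - 1 := by omega
        rw [e, e', Nat.add_mod_left, Nat.mod_eq_of_lt (by omega : 1 < k)]
        exact hw.symm
      · have e : i % k + 2 = k := by omega
        have := h4 _ (by omega : i % k + 1 < k)
        rw [e] at this ⊢
        rw [Nat.mod_self, h0, ← hk]; exact this
  have U : ∀ i, ∃ t, Nb G (f ((i + 1) % k)) (f (i % k)) (f ((i + 2) % k)) t :=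
    fun i => H.nb3 (A i).symm (A (i + 1)) (B i)
  choose u hu using U
  refine ⟨k, fun i => f (i % k), fun i => u ((i + (k - 1)) % k), k3, ?_, p, ?_, A, B, ?_, hmin⟩
  · intro i
    exact ft _ (Nat.mod_lt i (by omega)).le
  · intro i
    show u ((i + k + (k - 1)) % k) = u ((i + (k - 1)) % k)
    rw [show i + k + (k - 1) = i + (k - 1) + k by omega, Nat.add_mod_right]
  · intro i
    have := hu (i % k)
    simp only [Nat.mod_add_mod, Nat.mod_mod] at this
    rw [show i + 1 + (k - 1) = i + k by omega, Nat.add_mod_right]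
    exact this

namespace Cyc
variable {k : ℕ} {f u : ℕ → V}

theorem nb' (C : Cyc G F k f u) (i : ℕ) : Nb G (f i) (f (i + k - 1)) (f (i + 1)) (u i) := by
  have h3 := C.three
  have := C.nb (i + k - 1)
  rw [show i + k - 1 + 1 = i + k by omega, show i + k - 1 + 2 = i + 1 + k by omega, C.per, C.per, C.peru] at this
  exact this

theorem au (C : Cyc G F k f u) (i : ℕ) : G.Adj (f i) (u i) := (C.nb' i).a3

theorem tu (C : Cyc G F k f u) (H : Cex G L F) (i : ℕ) : Touch F (u i) := H.closed (C.touch i) (C.au i)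

theorem u1 (C : Cyc G F k f u) (i : ℕ) : u i ≠ f (i + 1) := (C.nb' i).2.2.1.symm
theorem u2 (C : Cyc G F k f u) (i : ℕ) : u (i + 1) ≠ f i := (C.nb i).2.1.symm

theorem ff (C : Cyc G F k f u) (a d : ℕ) (h1 : 1 ≤ d) (h2 : d + 1 ≤ k) : f a ≠ f (a + d) := by
  intro h
  obtain ⟨d, rfl⟩ := Nat.exists_eq_add_of_le' h1
  have := NW.ext C.adj C.nbt (NW.one (C.adj a)) d
  rw [← add_assoc] at h
  rw [← h] at this
  exact C.min _ (by omega) _ _ (C.touch a) this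

theorem naff (C : Cyc G F k f u) (a d : ℕ) (h1 : 2 ≤ d) (h2 : d + 2 ≤ k) : ¬ G.Adj (f a) (f (a + d)) := by
  intro h
  obtain ⟨d, rfl⟩ := Nat.exists_eq_add_of_le' h1
  have := NW.ext C.adj C.nbt (NW.one (C.adj a)) (d + 1)
  exact C.min _ (by omega) _ _ (C.touch a) (this.snoc h.symm (C.ff a (d + 1) (by omega) (by omega)))

theorem uf (C : Cyc G F k f u) (a d : ℕ) (h2 : d + 2 ≤ k) : u a ≠ f (a + d) ∧ u (a + d) ≠ f a := by
  rcases Nat.lt_or_ge 1 d with h | h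
  · refine ⟨fun hh => C.naff a d h h2 ?_, fun hh => C.naff a d h h2 ?_⟩
    · rw [← hh]; exact C.au a
    · rw [← hh]; exact (C.au (a + d)).symm
  · obtain rfl | rfl : d = 0 ∨ d = 1 := by omega
    · exact ⟨(C.au a).ne.symm, (C.au a).ne.symm⟩
    · exact ⟨C.u1 a, C.u2 a⟩

/-- the walk from `u a` along the cycle -/
theorem wu (C : Cyc G F k f u) (a d : ℕ) : NW G (u a) (d + 2) (f (a + d)) (f (a + d + 1)) := by
  have := NW.ext C.adj C.nbt ((NW.one (C.au a).symm).snoc (C.adj a) (C.u1 a).symm) d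
  rwa [show 1 + 1 + d = d + 2 by omega] at this

theorem nauf (C : Cyc G F k f u) (H : Cex G L F) (a d : ℕ) (h1 : 1 ≤ d) (h2 : d + 3 ≤ k) :
    ¬ G.Adj (u a) (f (a + d)) ∧ ¬ G.Adj (f a) (u (a + d)) := by
  obtain ⟨d, rfl⟩ := Nat.exists_eq_add_of_le' h1
  constructor
  · intro h
    exact C.min _ (by omega) _ _ (C.tu H a) ((C.wu a d).snoc h.symm (C.uf a d (by omega)).1)
  · intro h
    have := NW.ext C.adj C.nbt (NW.one (C.adj a)) d
    refine C.min _ (by omega) _ _ (C.touch a)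
      ((this.snoc (C.au (a + d + 1)) (C.u2 (a + d))).snoc h.symm ?_)
    exact C.ff a (d + 1) (by omega) (by omega)

theorem uu (C : Cyc G F k f u) (H : Cex G L F) (a d : ℕ) (h1 : 1 ≤ d) (h2 : d + 3 ≤ k) :
    u a ≠ u (a + d) := by
  obtain ⟨d, rfl⟩ := Nat.exists_eq_add_of_le' h1
  intro h
  have := (C.wu a d).snoc (C.au (a + d + 1)) (C.u2 (a + d))
  rw [← add_assoc] at h
  rw [← h] at this
  exact C.min _ (by omega) _ _ (C.tu H a) this

theorem nauu (C : Cyc G F k f u) (H : Cex G L F) (a d : ℕ) (h1 : 1 ≤ d) (h2 : d + 4 ≤ k) :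
    ¬ G.Adj (u a) (u (a + d)) := by
  obtain ⟨d, rfl⟩ := Nat.exists_eq_add_of_le' h1
  intro h
  have := (C.wu a d).snoc (C.au (a + d + 1)) (C.u2 (a + d))
  exact C.min _ (by omega) _ _ (C.tu H a) (this.snoc h.symm (C.uf a (d + 1) (by omega)).1)

end Cyc
end cyc


section cyc2
open SimpleGraph AT
variable {V : Type*} {G : SimpleGraph V} {L : Sym2 V → Finset ℕ} {F : Finset (Sym2 V)}
namespace Cyc
variable {k : ℕ} {f u : ℕ → V}

theorem uf' (C : Cyc G F k f u) (h5 : 5 ≤ k) (a d : ℕ) (h2 : d + 1 ≤ k) :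
    u a ≠ f (a + d) ∧ u (a + d) ≠ f a := by
  rcases Nat.lt_or_ge (d + 1) k with h | h
  · exact C.uf a d h
  · have := C.uf (a + d) (k - d) (by omega)
    rw [show a + d + (k - d) = a + k by omega, C.per, C.peru] at this
    exact this.symm

theorem nauf' (C : Cyc G F k f u) (H : Cex G L F) (h5 : 5 ≤ k) (a d : ℕ) (h1 : 1 ≤ d) (h2 : d + 1 ≤ k) :
    ¬ G.Adj (u a) (f (a + d)) ∧ ¬ G.Adj (f a) (u (a + d)) := by
  rcases Nat.lt_or_ge (d + 2) k with h | h
  · exact C.nauf H a d h1 h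
  · have := C.nauf H (a + d) (k - d) (by omega) (by omega)
    rw [show a + d + (k - d) = a + k by omega, C.per, C.peru] at this
    exact ⟨fun h => this.2 h.symm, fun h => this.1 h.symm⟩

theorem uu' (C : Cyc G F k f u) (H : Cex G L F) (h5 : 5 ≤ k) (a d : ℕ) (h1 : 1 ≤ d) (h2 : d + 1 ≤ k) :
    u a ≠ u (a + d) := by
  rcases Nat.lt_or_ge (d + 2) k with h | h
  · exact C.uu H a d h1 h
  · have := C.uu H (a + d) (k - d) (by omega) (by omega)
    rw [show a + d + (k - d) = a + k by omega, C.peru] at this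
    exact this.symm

theorem nauu' (C : Cyc G F k f u) (H : Cex G L F) (a d : ℕ) (h1 : 1 ≤ d) (h2 : d + 1 ≤ k)
    (h3 : d + 4 ≤ k ∨ 4 ≤ d) : ¬ G.Adj (u a) (u (a + d)) := by
  rcases h3 with h | h
  · exact C.nauu H a d h1 h
  · have := C.nauu H (a + d) (k - d) (by omega) (by omega)
    rw [show a + d + (k - d) = a + k by omega, C.peru] at this
    exact fun h => this h.symm

theorem npp (C : Cyc G F k f u) (H : Cex G L F) (h5 : 5 ≤ k) (a d : ℕ) (h1 : 2 ≤ d) (h2 : d + 2 ≤ k)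
    (h3 : d + 4 ≤ k ∨ 4 ≤ d) : ¬ Conf G s(f a, u a) s(f (a + d), u (a + d)) :=
  nconf (C.ff a d (by omega) (by omega)) (C.uf' h5 a d (by omega)).2.symm (C.uf' h5 a d (by omega)).1
    (C.uu' H h5 a d (by omega) (by omega)) (C.naff a d h1 h2)
    (C.nauf' H h5 a d (by omega) (by omega)).2 (C.nauf' H h5 a d (by omega) (by omega)).1
    (C.nauu' H a d (by omega) (by omega) h3)

theorem ncc (C : Cyc G F k f u) (a d : ℕ) (h1 : 3 ≤ d) (h2 : d + 3 ≤ k) :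
    ¬ Conf G s(f a, f (a + 1)) s(f (a + d), f (a + d + 1)) := by
  have e1 := C.ff (a + 1) (d - 1) (by omega) (by omega)
  have e2 := C.ff (a + 1) d (by omega) (by omega)
  have e3 := C.naff (a + 1) (d - 1) (by omega) (by omega)
  have e4 := C.naff (a + 1) d (by omega) (by omega)
  rw [show a + 1 + (d - 1) = a + d by omega] at e1 e3
  rw [show a + 1 + d = a + d + 1 by omega] at e2 e4
  exact nconf (C.ff a d (by omega) (by omega)) (C.ff a (d + 1) (by omega) (by omega)) e1 e2
    (C.naff a d (by omega) (by omega)) (C.naff a (d + 1) (by omega) (by omega)) e3 e4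

theorem npc (C : Cyc G F k f u) (H : Cex G L F) (h5 : 5 ≤ k) (a d : ℕ) (h1 : 2 ≤ d) (h2 : d + 3 ≤ k) :
    ¬ Conf G s(f a, u a) s(f (a + d), f (a + d + 1)) :=
  nconf (C.ff a d (by omega) (by omega)) (C.ff a (d + 1) (by omega) (by omega))
    (C.uf' h5 a d (by omega)).1 (C.uf' h5 a (d + 1) (by omega)).1
    (C.naff a d (by omega) (by omega)) (C.naff a (d + 1) (by omega) (by omega))
    (C.nauf' H h5 a d (by omega) (by omega)).1 (C.nauf' H h5 a (d + 1) (by omega) (by omega)).1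

theorem ncp (C : Cyc G F k f u) (H : Cex G L F) (h5 : 5 ≤ k) (a d : ℕ) (h1 : 3 ≤ d) (h2 : d + 2 ≤ k) :
    ¬ Conf G s(f a, f (a + 1)) s(f (a + d), u (a + d)) := by
  have e1 := C.ff (a + 1) (d - 1) (by omega) (by omega)
  have e2 := (C.uf' h5 (a + 1) (d - 1) (by omega)).2
  have e3 := C.naff (a + 1) (d - 1) (by omega) (by omega)
  have e4 := (C.nauf' H h5 (a + 1) (d - 1) (by omega) (by omega)).2
  rw [show a + 1 + (d - 1) = a + d by omega] at e1 e2 e3 e4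
  exact nconf (C.ff a d (by omega) (by omega)) (C.uf' h5 a d (by omega)).2.symm e1 e2.symm
    (C.naff a d (by omega) (by omega)) (C.nauf' H h5 a d (by omega) (by omega)).2 e3 e4

theorem not3 (C : Cyc G F 3 f u) (H : Cex G L F) : False := by
  have h := C.adj 2
  rw [show f (2 + 1) = f 0 from C.per 0] at h
  exact H.tri (C.touch 0) (C.adj 0) (C.adj 1) h.symm

theorem not4 (C : Cyc G F 4 f u) (H : Cex G L F) : False := by
  have h := C.adj 3
  rw [show f (3 + 1) = f 0 from C.per 0] at h
  exact H.sq (C.touch 0) (C.adj 0) (C.adj 1) (C.adj 2) h (C.nbt 0) (C.nbt 1)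

theorem not5 (C : Cyc G F 5 f u) (H : Cex G L F) : False := by
  have e0 : f 5 = f 0 := C.per 0
  have e1 : f 6 = f 1 := C.per 1
  have e2 : f 7 = f 2 := C.per 2
  have e3 : f 8 = f 3 := C.per 3
  have e4 : f 9 = f 4 := C.per 4
  have d0 : u 5 = u 0 := C.peru 0
  have d1 : u 6 = u 1 := C.peru 1
  have ea := C.adj 4
  have g1 := C.npc H (by omega) 2 2 (by omega) (by omega)
  have g2 := C.npc H (by omega) 3 2 (by omega) (by omega)
  have g3 := C.npc H (by omega) 4 2 (by omega) (by omega)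
  have g4 := C.npc H (by omega) 0 2 (by omega) (by omega)
  have g5 := C.npc H (by omega) 1 2 (by omega) (by omega)
  simp only [Nat.reduceAdd, e0, e1, e2, e3, e4, d0, d1] at ea g1 g2 g3 g4 g5
  refine H.fincase 10 [(0,5), (4,0), (1,6), (0,1), (2,7), (1,2), (3,8), (2,3), (4,9), (3,4)]
    [(0,1), (1,2), (2,3), (3,4), (4,0), (0,5), (1,6), (2,7), (3,8), (4,9)]
    [(0,1), (5,1), (6,0), (0,2), (5,2), (7,0), (0,3), (5,3), (8,0), (0,4), (5,4), (9,0), (1,2),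
     (6,2), (7,1), (1,3), (6,3), (8,1), (1,4), (6,4), (9,1), (2,3), (7,3), (8,2), (2,4), (7,4),
     (9,2), (3,4), (8,4), (9,3)]
    [(0,4), (2,6), (4,8), (0,6), (2,8)]
    [(4,1), (6,3), (8,5), (0,7), (2,9)] []
    [0x5250435353, 0x5353445304, 0x5044535451, 0x5344535404, 0x5453535303, 0x5453544304,
     0x5044345453, 0x5054455451, 0x354435354, 0x5344535305, 0x5155435450, 0x5155445405,
     0x454435354, 0x5450554055, 0x5035345454, 0x4055555055, 0x5453525403, 0x5453534404,
     0x5454505540, 0x5434535504, 0x5543545402, 0x5543555402, 0x1554545450, 0x5504555550,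
     0x5454034444, 0x5453345405, 0x5455505504, 0x5455505505, 0x5541545450, 0x5550554055,
     0x5555505540, 0x5555505505]
    (vt [f 0, f 1, f 2, f 3, f 4, u 0, u 1, u 2, u 3, u 4] (f 0)) (by decide +kernel) (by decide +kernel) ?_ ?_ ?_ ?_ ?_
  · simp only [List.forall_mem_cons]
    exact ⟨C.adj 0, C.adj 1, C.adj 2, C.adj 3, ea, C.au 0, C.au 1, C.au 2, C.au 3, C.au 4, by simp⟩
  · simp only [List.forall_mem_cons]
    exact ⟨C.ff 0 1 (by omega) (by omega), (C.uf' (by omega) 0 1 (by omega)).1, (C.uf' (by omega) 0 1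
     (by omega)).2, C.ff 0 2 (by omega) (by omega), (C.uf' (by omega) 0 2 (by omega)).1, (C.uf'
     (by omega) 0 2 (by omega)).2, C.ff 0 3 (by omega) (by omega), (C.uf' (by omega) 0 3 (by
     omega)).1, (C.uf' (by omega) 0 3 (by omega)).2, C.ff 0 4 (by omega) (by omega), (C.uf' (by
     omega) 0 4 (by omega)).1, (C.uf' (by omega) 0 4 (by omega)).2, C.ff 1 1 (by omega) (by
     omega), (C.uf' (by omega) 1 1 (by omega)).1, (C.uf' (by omega) 1 1 (by omega)).2, C.ff 1 2
     (by omega) (by omega), (C.uf' (by omega) 1 2 (by omega)).1, (C.uf' (by omega) 1 2 (by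
     omega)).2, C.ff 1 3 (by omega) (by omega), (C.uf' (by omega) 1 3 (by omega)).1, (C.uf' (by
     omega) 1 3 (by omega)).2, C.ff 2 1 (by omega) (by omega), (C.uf' (by omega) 2 1 (by
     omega)).1, (C.uf' (by omega) 2 1 (by omega)).2, C.ff 2 2 (by omega) (by omega), (C.uf' (by
     omega) 2 2 (by omega)).1, (C.uf' (by omega) 2 2 (by omega)).2, C.ff 3 1 (by omega) (by
     omega), (C.uf' (by omega) 3 1 (by omega)).1, (C.uf' (by omega) 3 1 (by omega)).2, by simp⟩
  · simp only [List.forall_mem_cons]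
    exact ⟨g1, g2, g3, g4, g5, by simp⟩
  · intro i hi
    match i, hi with
    | 0, _ => exact H.cb12 (C.au 0)
    | 1, _ => exact H.cb12 ea
    | 2, _ => exact H.cb12 (C.au 1)
    | 3, _ => exact H.cb12 (C.adj 0)
    | 4, _ => exact H.cb12 (C.au 2)
    | 5, _ => exact H.cb12 (C.adj 1)
    | 6, _ => exact H.cb12 (C.au 3)
    | 7, _ => exact H.cb12 (C.adj 2)
    | 8, _ => exact H.cb12 (C.au 4)
    | 9, _ => exact H.cb12 (C.adj 3)
  · rcases H.hexN (C.touch 1) (C.nb 0) with h | h | h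
    · exact ⟨3, by omega, by rw [Sym2.eq_swap]; exact h⟩
    · exact ⟨5, by omega, h⟩
    · exact ⟨2, by omega, h⟩

theorem not6 (C : Cyc G F 6 f u) (H : Cex G L F) : False := by
  have e0 : f 6 = f 0 := C.per 0
  have e1 : f 7 = f 1 := C.per 1
  have e2 : f 8 = f 2 := C.per 2
  have e3 : f 9 = f 3 := C.per 3
  have e4 : f 10 = f 4 := C.per 4
  have d0 : u 6 = u 0 := C.peru 0
  have d1 : u 7 = u 1 := C.peru 1
  have ea := C.adj 5
  have g1 := C.npc H (by omega) 2 3 (by omega) (by omega)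
  have g2 := C.npc H (by omega) 3 2 (by omega) (by omega)
  have g3 := C.ncc 2 3 (by omega) (by omega)
  have g4 := C.npp H (by omega) 0 2 (by omega) (by omega) (by omega)
  have g5 := C.npc H (by omega) 3 3 (by omega) (by omega)
  have g6 := C.npc H (by omega) 4 2 (by omega) (by omega)
  have g7 := C.ncc 3 3 (by omega) (by omega)
  have g8 := C.npp H (by omega) 1 2 (by omega) (by omega) (by omega)
  have g9 := C.npc H (by omega) 4 3 (by omega) (by omega)
  have g10 := C.npc H (by omega) 5 2 (by omega) (by omega)
  have g11 := C.ncc 4 3 (by omega) (by omega)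
  have g12 := C.npp H (by omega) 2 2 (by omega) (by omega) (by omega)
  have g13 := C.npc H (by omega) 5 3 (by omega) (by omega)
  have g14 := C.npc H (by omega) 0 2 (by omega) (by omega)
  have g15 := C.npp H (by omega) 3 2 (by omega) (by omega) (by omega)
  have g16 := C.npc H (by omega) 0 3 (by omega) (by omega)
  have g17 := C.npc H (by omega) 1 2 (by omega) (by omega)
  have g18 := C.npp H (by omega) 4 2 (by omega) (by omega) (by omega)
  have g19 := C.npc H (by omega) 1 3 (by omega) (by omega)
  have g20 := C.npc H (by omega) 2 2 (by omega) (by omega)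
  have g21 := C.npp H (by omega) 5 2 (by omega) (by omega) (by omega)
  simp only [Nat.reduceAdd, e0, e1, e2, e3, e4, d0, d1] at ea g1 g2 g3 g4 g5 g6 g7 g8 g9 g10 g11 g12 g13 g14 g15 g16 g17 g18 g19 g20 g21
  refine H.fincase 12 [(0,6), (5,0), (1,7), (0,1), (2,8), (1,2), (3,9), (2,3), (4,10), (3,4), (5,11), (4,5)]
    [(0,1), (1,2), (2,3), (3,4), (4,5), (5,0), (0,6), (1,7), (2,8), (3,9), (4,10), (5,11)]
    [(0,1), (6,1), (7,0), (0,2), (6,2), (8,0), (0,3), (6,3), (9,0), (0,4), (6,4), (10,0), (0,5),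
     (6,5), (11,0), (1,2), (7,2), (8,1), (1,3), (7,3), (9,1), (1,4), (7,4), (10,1), (1,5), (7,5),
     (11,1), (2,3), (8,3), (9,2), (2,4), (8,4), (10,2), (2,5), (8,5), (11,2), (3,4), (9,4),
     (10,3), (3,5), (9,5), (11,3), (4,5), (10,5), (11,4)]
    [(0,6), (2,8), (4,10)]
    [(4,1), (6,1), (7,1), (0,4), (6,3), (8,3), (9,3), (2,6), (8,5), (10,5), (11,5), (4,8),
     (10,7), (0,7), (6,10), (0,9), (2,9), (8,0), (2,11), (4,11), (10,2)] []
    [0x505352535243, 0x535353534304, 0x505451525443, 0x504454535054, 0x544353544303,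
     0x545353543304, 0x45453525443, 0x505450544454]
    (vt [f 0, f 1, f 2, f 3, f 4, f 5, u 0, u 1, u 2, u 3, u 4, u 5] (f 0)) (by decide +kernel) (by decide +kernel) ?_ ?_ ?_ ?_ ?_
  · simp only [List.forall_mem_cons]
    exact ⟨C.adj 0, C.adj 1, C.adj 2, C.adj 3, C.adj 4, ea, C.au 0, C.au 1, C.au 2, C.au 3, C.au 4,
     C.au 5, by simp⟩
  · simp only [List.forall_mem_cons]
    exact ⟨C.ff 0 1 (by omega) (by omega), (C.uf' (by omega) 0 1 (by omega)).1, (C.uf' (by omega) 0 1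
     (by omega)).2, C.ff 0 2 (by omega) (by omega), (C.uf' (by omega) 0 2 (by omega)).1, (C.uf'
     (by omega) 0 2 (by omega)).2, C.ff 0 3 (by omega) (by omega), (C.uf' (by omega) 0 3 (by
     omega)).1, (C.uf' (by omega) 0 3 (by omega)).2, C.ff 0 4 (by omega) (by omega), (C.uf' (by
     omega) 0 4 (by omega)).1, (C.uf' (by omega) 0 4 (by omega)).2, C.ff 0 5 (by omega) (by
     omega), (C.uf' (by omega) 0 5 (by omega)).1, (C.uf' (by omega) 0 5 (by omega)).2, C.ff 1 1
     (by omega) (by omega), (C.uf' (by omega) 1 1 (by omega)).1, (C.uf' (by omega) 1 1 (by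
     omega)).2, C.ff 1 2 (by omega) (by omega), (C.uf' (by omega) 1 2 (by omega)).1, (C.uf' (by
     omega) 1 2 (by omega)).2, C.ff 1 3 (by omega) (by omega), (C.uf' (by omega) 1 3 (by
     omega)).1, (C.uf' (by omega) 1 3 (by omega)).2, C.ff 1 4 (by omega) (by omega), (C.uf' (by
     omega) 1 4 (by omega)).1, (C.uf' (by omega) 1 4 (by omega)).2, C.ff 2 1 (by omega) (by
     omega), (C.uf' (by omega) 2 1 (by omega)).1, (C.uf' (by omega) 2 1 (by omega)).2, C.ff 2 2
     (by omega) (by omega), (C.uf' (by omega) 2 2 (by omega)).1, (C.uf' (by omega) 2 2 (by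
     omega)).2, C.ff 2 3 (by omega) (by omega), (C.uf' (by omega) 2 3 (by omega)).1, (C.uf' (by
     omega) 2 3 (by omega)).2, C.ff 3 1 (by omega) (by omega), (C.uf' (by omega) 3 1 (by
     omega)).1, (C.uf' (by omega) 3 1 (by omega)).2, C.ff 3 2 (by omega) (by omega), (C.uf' (by
     omega) 3 2 (by omega)).1, (C.uf' (by omega) 3 2 (by omega)).2, C.ff 4 1 (by omega) (by
     omega), (C.uf' (by omega) 4 1 (by omega)).1, (C.uf' (by omega) 4 1 (by omega)).2, by simp⟩
  · simp only [List.forall_mem_cons]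
    exact ⟨g1, g2, g3, g4, g5, g6, g7, g8, g9, g10, g11, g12, g13, g14, g15, g16, g17, g18, g19, g20,
     g21, by simp⟩
  · intro i hi
    match i, hi with
    | 0, _ => exact H.cb12 (C.au 0)
    | 1, _ => exact H.cb12 ea
    | 2, _ => exact H.cb12 (C.au 1)
    | 3, _ => exact H.cb12 (C.adj 0)
    | 4, _ => exact H.cb12 (C.au 2)
    | 5, _ => exact H.cb12 (C.adj 1)
    | 6, _ => exact H.cb12 (C.au 3)
    | 7, _ => exact H.cb12 (C.adj 2)
    | 8, _ => exact H.cb12 (C.au 4)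
    | 9, _ => exact H.cb12 (C.adj 3)
    | 10, _ => exact H.cb12 (C.au 5)
    | 11, _ => exact H.cb12 (C.adj 4)
  · rcases H.hexN (C.touch 1) (C.nb 0) with h | h | h
    · exact ⟨3, by omega, by rw [Sym2.eq_swap]; exact h⟩
    · exact ⟨5, by omega, h⟩
    · exact ⟨2, by omega, h⟩

end Cyc
end cyc2

namespace AT

def blk : ℕ → List (ℕ × ℕ)
  | 0 => [(0, 1)]
  | 1 => [(2, 3), (0, 2), (0, 3), (1, 2), (1, 3)]
  | j + 2 => [(2 * j + 4, 2 * j + 5), (2 * j + 2, 2 * j + 4), (2 * j + 2, 2 * j + 5),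
      (2 * j + 3, 2 * j + 4), (2 * j + 3, 2 * j + 5), (2 * j, 2 * j + 5), (2 * j + 1, 2 * j + 5)]

def low : ℕ → List (ℕ × ℕ)
  | 0 => []
  | j + 1 => blk j ++ low j

/-- wrap-around pairs for cycle length `j + 2` -/
def wrp (j : ℕ) : List (ℕ × ℕ) :=
  [(0, 2 * j + 2), (0, 2 * j + 3), (1, 2 * j + 2), (1, 2 * j + 3), (1, 2 * j), (1, 2 * j + 1),
    (3, 2 * j + 2), (3, 2 * j + 3)]

def esC (j : ℕ) : List (ℕ × ℕ) := wrp j ++ low (j + 2)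

def std (v : ℕ) : ℕ := if v < 4 then (if v = 0 then 3 else if v = 2 then 1 else 5)
  else if v % 2 = 0 then 3 else 4

/-- target for cycle length `j + 2` -/
def tgC (j v : ℕ) : ℕ := if v < 2 * j + 4 then std v else 0

def up : ℕ → List (ℕ × ℕ)
  | 0 => []
  | r + 1 => blk (4 + r) ++ up r

def rho (e i : ℕ) : ℕ := if i < 4 then i else i + 2 * e

theorem blk_rho (e j : ℕ) : (blk (4 + j)).map (Prod.map (rho e) (rho e)) = blk (4 + e + j) := by
  rw [show 4 + j = (j + 2) + 2 by omega, show 4 + e + j = (e + j + 2) + 2 by omega]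
  simp only [blk, List.map_cons, List.map_nil, Prod.map, rho]
  simp only [if_neg (show ¬ (2 * (j + 2) + 4 < 4) by omega), if_neg (show ¬ (2 * (j + 2) + 5 < 4) by omega),
    if_neg (show ¬ (2 * (j + 2) + 2 < 4) by omega), if_neg (show ¬ (2 * (j + 2) + 3 < 4) by omega),
    if_neg (show ¬ (2 * (j + 2) < 4) by omega), if_neg (show ¬ (2 * (j + 2) + 1 < 4) by omega)]
  refine List.ext_get (by simp) ?_
  intro n h1 h2
  simp only [List.length_cons, List.length_nil] at h1
  simp only [List.get_eq_getElem]
  interval_cases n <;> simp <;> omega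

theorem low_up (e r : ℕ) : low (4 + e + r) = (up r).map (Prod.map (rho e) (rho e)) ++ low (4 + e) := by
  induction r with
  | zero => simp [up]
  | succ r ih =>
    rw [show 4 + e + (r + 1) = (4 + e + r) + 1 by omega, low, ih, up, List.map_append, blk_rho,
      List.append_assoc]

theorem wrp_rho (e j : ℕ) (hj : 2 ≤ j) : (wrp j).map (Prod.map (rho e) (rho e)) = wrp (j + e) := by
  simp only [wrp, List.map_cons, List.map_nil, Prod.map, rho]
  simp only [if_neg (show ¬ (2 * j + 2 < 4) by omega), if_neg (show ¬ (2 * j + 3 < 4) by omega),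
    if_neg (show ¬ (2 * j < 4) by omega), if_neg (show ¬ (2 * j + 1 < 4) by omega)]
  refine List.ext_get (by simp) ?_
  intro n h1 h2
  simp only [List.length_cons, List.length_nil] at h1
  simp only [List.get_eq_getElem]
  interval_cases n <;> simp <;> omega

theorem esC_rho (e r : ℕ) (hr : 2 ≤ r) : esC (2 + e + r) =
    (wrp (2 + r) ++ up r).map (Prod.map (rho e) (rho e)) ++ low (4 + e) := by
  rw [esC, List.map_append, wrp_rho _ _ (by omega), show 2 + e + r + 2 = 4 + e + r by omega, low_up,
    List.append_assoc, show 2 + r + e = 2 + e + r by omega]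

def cl (m v : ℕ) : ℕ := if 2 * m ≤ v then 0 else if v < 2 then 4 else if v < 4 then 6 else
  if v + 2 < 2 * m then (if v + 4 < 2 * m then (if v % 2 = 0 then 6 else 8) else
    (if v % 2 = 0 then 5 else 7)) else (if v % 2 = 0 then 3 else 5)

theorem cnt_nil (v : ℕ) : cnt v [] = 0 := rfl

theorem cnt_zero (v : ℕ) (es : List (ℕ × ℕ)) (h : ∀ x ∈ es, x.1 ≠ v ∧ x.2 ≠ v) : cnt v es = 0 := by
  induction es with
  | nil => rfl
  | cons x es ih =>
    rw [cnt_cons, ih fun y hy => h y (List.mem_cons_of_mem _ hy), if_neg (h x (by simp)).1,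
      if_neg (h x (by simp)).2]

theorem cnt_blk (v j : ℕ) : cnt v (blk (j + 2)) = if v = 2 * j + 4 then 3 else if v = 2 * j + 5 then 5
    else if v = 2 * j + 2 ∨ v = 2 * j + 3 then 2 else if v = 2 * j ∨ v = 2 * j + 1 then 1 else 0 := by
  simp only [blk, cnt_cons, cnt_nil]
  split_ifs <;> omega

theorem cnt_low (e v : ℕ) : cnt v (low (4 + e)) = cl (4 + e) v := by
  induction e with
  | zero =>
    rcases Nat.lt_or_ge v 8 with h | h
    · interval_cases v <;> decide
    · rw [cl, if_pos (by omega)]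
      refine cnt_zero v _ ?_
      have : ∀ x ∈ low (4 + 0), x.1 < 8 ∧ x.2 < 8 := by decide
      intro x hx
      have := this x hx
      omega
  | succ e ih =>
    rw [show 4 + (e + 1) = (4 + e) + 1 by omega, low, cnt_append, ih,
      show 4 + e = (e + 2) + 2 by omega, cnt_blk]
    have hc : v < 2 * (e + 2) ∨ v = 2 * (e + 2) ∨ v = 2 * (e + 2) + 1 ∨ v = 2 * (e + 2) + 2 ∨
      v = 2 * (e + 2) + 3 ∨ v = 2 * (e + 2) + 4 ∨ v = 2 * (e + 2) + 5 ∨ 2 * (e + 2) + 6 ≤ v := by omega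
    clear ih
    simp only [cl]
    rcases hc with h | rfl | rfl | rfl | rfl | rfl | rfl | h
    all_goals grind

def dcC (e m v : ℕ) : ℕ := if v < 4 then m / 16 ^ v % 16 else if v < 2 * e + 4 then std v else
  m / 16 ^ (v - 2 * e) % 16

theorem dec_dcC (e N : ℕ) : Dec N (rho e) (dcC e) where
  inj := fun a _ b _ h => by
    simp only [rho] at h
    split_ifs at h <;> omega
  dig := fun a ha m => by
    simp only [rho, dcC]
    split_ifs with h1 h2 h3
    · rfl
    · omega
    · omega
    · rw [Nat.add_sub_cancel]
  sub := fun a ha m h => by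
    have key : dcC e m (rho e a) = m / 16 ^ a % 16 := by
      simp only [rho, dcC]
      split_ifs with h1 h2 h3
      · rfl
      · omega
      · omega
      · rw [Nat.add_sub_cancel]
    funext v
    by_cases hv : v = rho e a
    · subst hv
      rw [Function.update_self, key]
      simp only [rho, dcC]
      split_ifs with h1 h2 h3
      · rw [digit_sub _ _ _ h]; simp
      · omega
      · omega
      · rw [Nat.add_sub_cancel, digit_sub _ _ _ h]; simp
    · rw [Function.update_of_ne hv]
      simp only [rho] at hv
      simp only [dcC, digit_sub _ _ _ h]
      split_ifs at hv ⊢ <;> first | rfl | omega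


def tlC (a : ℕ) : ℕ := [4, 4, 6, 6, 5, 7, 3, 5].getD a 0

theorem cnt_tlC (e a : ℕ) : cnt (rho e a) (low (4 + e)) ≤ tlC a := by
  rw [cnt_low]
  rcases Nat.lt_or_ge a 8 with h | h
  · simp only [cl, rho]
    interval_cases a <;> simp [tlC] <;> split_ifs <;> omega
  · simp only [cl, rho, if_neg (show ¬ a < 4 by omega)]
    rw [if_pos (by omega)]
    exact Nat.zero_le _

theorem dp_per : dp tlC (wrp 12 ++ up 10) [(0x4343434343434343434343435153, 1)] =
    dp tlC (wrp 6 ++ up 4) [(0x4343434343435153, 1)] := by decide +kernel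

theorem dcC_tg (e r T : ℕ) (h : ∀ v < 2 * r + 8, T / 16 ^ v % 16 = std v) (hlt : T < 16 ^ (2 * r + 8)) :
    dcC e T = tgC (2 + e + r) := by
  funext v
  simp only [dcC, tgC]
  rcases Nat.lt_or_ge v 4 with h1 | h1
  · rw [if_pos h1, if_pos (by omega), h v (by omega)]
  rw [if_neg (by omega)]
  rcases Nat.lt_or_ge v (2 * e + 4) with h2 | h2
  · rw [if_pos h2, if_pos (by omega)]
  rw [if_neg (by omega)]
  rcases Nat.lt_or_ge v (2 * e + (2 * r + 8)) with h3 | h3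
  · rw [if_pos (by omega), h _ (by omega)]
    simp only [std]
    have : (v - 2 * e) % 2 = v % 2 := by omega
    rw [if_neg (show ¬ v - 2 * e < 4 by omega), if_neg (show ¬ v < 4 by omega), this]
  · rw [if_neg (by omega), Nat.div_eq_of_lt]
    exact lt_of_lt_of_le hlt (Nat.pow_le_pow_right (by norm_num) (by omega))

theorem Val_esC (e r T : ℕ) (hr : 2 ≤ r) (h : ∀ v < 2 * r + 8, T / 16 ^ v % 16 = std v)
    (hlt : T < 16 ^ (2 * r + 8))
    (hf : ∀ x ∈ wrp (2 + r) ++ up r, x.1 ≠ x.2 ∧ x.1 < 2 * r + 8 ∧ x.2 < 2 * r + 8) :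
    (coefR (esC (2 + e + r)) (tgC (2 + e + r)) : ZMod 1009) =
      Val (dcC e) (low (4 + e)) (dp tlC (wrp (2 + r) ++ up r) [(T, 1)]) := by
  rw [Val_dp (dec_dcC e (2 * r + 8)) tlC (fun a _ => cnt_tlC e a) _ hf, ← esC_rho _ _ hr]
  simp only [Val_cons, Val_nil, dcC_tg e r T h hlt]
  simp

theorem coef_per (e : ℕ) : (coefR (esC (2 + e + 10)) (tgC (2 + e + 10)) : ZMod 1009) =
    (coefR (esC (2 + e + 4)) (tgC (2 + e + 4)) : ZMod 1009) := by
  rw [Val_esC e 10 0x4343434343434343434343435153 (by omega) (by decide +kernel) (by decide +kernel) (by decide +kernel),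
    Val_esC e 4 0x4343434343435153 (by omega) (by decide +kernel) (by decide +kernel) (by decide +kernel)]
  exact congrArg _ dp_per

theorem coef_base (j T : ℕ) (h : ∀ v < 2 * j + 4, T / 16 ^ v % 16 = std v)
    (hf : ∀ x ∈ esC j, x.1 ≠ x.2 ∧ x.1 < 2 * j + 4 ∧ x.2 < 2 * j + 4)
    (hd : fin (dp (fun _ => 0) (esC j) [(T, 1)]) = true) :
    (coefR (esC j) (tgC j) : ZMod 1009) ≠ 0 := by
  have h1 := Val_fin (dcd (2 * j + 4)) (dcd_zero _) _ hd
  rw [Val_dp (dec_dcd (2 * j + 4)) _ (by intro a _; exact le_refl 0) _ hf] at h1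
  have e1 : (esC j).map (Prod.map id id) ++ [] = esC j := by simp
  have e2 : dcd (2 * j + 4) T = tgC j := by
    funext v
    simp only [dcd, tgC]
    split_ifs with hv
    · exact h v hv
    · rfl
  simpa only [Val_cons, Val_nil, e1, e2, Nat.cast_one, one_mul, add_zero] using h1

theorem coef_C (j : ℕ) (hj : 5 ≤ j) : (coefR (esC j) (tgC j) : ZMod 1009) ≠ 0 := by
  induction j using Nat.strong_induction_on with
  | _ j ih =>
  rcases Nat.lt_or_ge j 12 with h | h
  · have cb := coef_base
    match j, hj, h with
    | 5, _, _ => exact cb 5 0x43434343435153 (by decide +kernel) (by decide +kernel) (by decide +kernel)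
    | 6, _, _ => exact cb 6 0x4343434343435153 (by decide +kernel) (by decide +kernel) (by decide +kernel)
    | 7, _, _ => exact cb 7 0x434343434343435153 (by decide +kernel) (by decide +kernel) (by decide +kernel)
    | 8, _, _ => exact cb 8 0x43434343434343435153 (by decide +kernel) (by decide +kernel) (by decide +kernel)
    | 9, _, _ => exact cb 9 0x4343434343434343435153 (by decide +kernel) (by decide +kernel) (by decide +kernel)
    | 10, _, _ => exact cb 10 0x434343434343434343435153 (by decide +kernel) (by decide +kernel) (by decide +kernel)
    | 11, _, _ => exact cb 11 0x43434343434343434343435153 (by decide +kernel) (by decide +kernel) (by decide +kernel)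
  · obtain ⟨e, rfl⟩ : ∃ e, j = 2 + e + 10 := ⟨j - 12, by omega⟩
    rw [coef_per]
    exact ih _ (by omega) (by omega)

end AT

section long
open SimpleGraph AT
variable {V : Type*} {G : SimpleGraph V} {L : Sym2 V → Finset ℕ} {F : Finset (Sym2 V)}

namespace AT
def W (a b : ℕ) : Prop := a < b ∧ (b % 2 = 1 ∧ b ≤ a + 5 ∨ b % 2 = 0 ∧ b ≤ a + 2)

theorem mem_blk (s a b : ℕ) : (a, b) ∈ blk s ↔ b / 2 = s ∧ W a b := by
  unfold W
  match s with
  | 0 =>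
    simp only [blk, List.mem_cons, List.not_mem_nil, Prod.mk.injEq, or_false]
    omega
  | 1 =>
    simp only [blk, List.mem_cons, List.not_mem_nil, Prod.mk.injEq, or_false]
    omega
  | s + 2 =>
    simp only [blk, List.mem_cons, List.not_mem_nil, Prod.mk.injEq, or_false]
    omega

theorem mem_low (m a b : ℕ) : (a, b) ∈ low m ↔ b < 2 * m ∧ W a b := by
  induction m with
  | zero => simp [low]
  | succ m ih =>
    rw [low, List.mem_append, ih, mem_blk, ← or_and_right]
    refine and_congr_left fun _ => ?_
    omega

theorem mem_esC (j : ℕ) (hj : 5 ≤ j) (a b : ℕ) : (a, b) ∈ esC j ↔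
    a < b ∧ b < 2 * j + 4 ∧ (W a b ∨ W b (a + (2 * j + 4))) := by
  rw [esC, List.mem_append, mem_low]
  unfold W
  simp only [wrp, List.mem_cons, List.not_mem_nil, Prod.mk.injEq, or_false]
  omega

theorem nodup_blk (s : ℕ) : (blk s).Nodup := by
  match s with
  | 0 => decide
  | 1 => decide
  | s + 2 => simp [blk]

theorem nodup_low (m : ℕ) : (low m).Nodup := by
  induction m with
  | zero => simp [low]
  | succ m ih =>
    rw [low, List.nodup_append']
    refine ⟨nodup_blk m, ih, ?_⟩
    rintro ⟨a, b⟩ h1 h2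
    rw [mem_blk] at h1
    rw [mem_low] at h2
    omega

theorem nodup_esC (j : ℕ) (hj : 5 ≤ j) : (esC j).Nodup := by
  rw [esC, List.nodup_append']
  refine ⟨by simp [wrp], nodup_low _, ?_⟩
  rintro ⟨a, b⟩ h1 h2
  rw [mem_low] at h2
  unfold W at h2
  simp only [wrp, List.mem_cons, List.not_mem_nil, Prod.mk.injEq, or_false] at h1
  omega

theorem deg_esC (j : ℕ) (hj : 5 ≤ j) (i : ℕ) (hi : i < 2 * j + 4) : tgC j i + 2 < cnt i (esC j) := by
  obtain ⟨e, rfl⟩ : ∃ e, j = e + 2 := ⟨j - 2, by omega⟩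
  rw [esC, cnt_append, show e + 2 + 2 = 4 + e by omega, cnt_low]
  rw [tgC, if_pos hi]
  simp only [wrp, cnt_cons, cnt_nil, cl, std]
  have hc : i = 0 ∨ i = 1 ∨ i = 2 ∨ i = 3 ∨ (4 ≤ i ∧ i < 2 * e + 4) ∨ i = 2 * e + 4 ∨ i = 2 * e + 5 ∨
    i = 2 * e + 6 ∨ i = 2 * e + 7 := by omega
  rcases hc with rfl | rfl | rfl | rfl | h | rfl | rfl | rfl | rfl
  all_goals grind

end AT

namespace Cyc
variable {k : ℕ} {f u : ℕ → V}

theorem ufall (C : Cyc G F k f u) (h5 : 5 ≤ k) (a b : ℕ) (h1 : b < a + k) (h2 : a < b + k) : u a ≠ f b := by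
  rcases Nat.le_total a b with h | h
  · obtain ⟨d, rfl⟩ := Nat.exists_eq_add_of_le h
    exact (C.uf' h5 a d (by omega)).1
  · obtain ⟨d, rfl⟩ := Nat.exists_eq_add_of_le h
    exact (C.uf' h5 b d (by omega)).2

def qe (f u : ℕ → V) (i : ℕ) : Sym2 V :=
  if i % 2 = 0 then s(f (i / 2 + 1), u (i / 2 + 1)) else s(f (i / 2), f (i / 2 + 1))

theorem qe0 (f u : ℕ → V) (t : ℕ) : qe f u (2 * t) = s(f (t + 1), u (t + 1)) := by
  rw [qe, if_pos (by omega), Nat.mul_div_cancel_left _ (by omega)]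

theorem qe1 (f u : ℕ → V) (t : ℕ) : qe f u (2 * t + 1) = s(f t, f (t + 1)) := by
  rw [qe, if_neg (by omega), show (2 * t + 1) / 2 = t by omega]

theorem qper (C : Cyc G F k f u) (i : ℕ) : qe f u (i + 2 * k) = qe f u i := by
  obtain ⟨t, rfl | rfl⟩ : ∃ t, i = 2 * t ∨ i = 2 * t + 1 := ⟨i / 2, by omega⟩
  · rw [show 2 * t + 2 * k = 2 * (t + k) by ring, qe0, qe0, show t + k + 1 = t + 1 + k by ring, C.per, C.peru]
  · rw [show 2 * t + 1 + 2 * k = 2 * (t + k) + 1 by ring, qe1, qe1, show t + k + 1 = t + 1 + k by ring, C.per,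
      C.per]

theorem qedge (C : Cyc G F k f u) (i : ℕ) : ∃ a b, qe f u i = s(a, b) ∧ G.Adj a b := by
  obtain ⟨t, rfl | rfl⟩ : ∃ t, i = 2 * t ∨ i = 2 * t + 1 := ⟨i / 2, by omega⟩
  · exact ⟨_, _, qe0 _ _ _, C.au _⟩
  · exact ⟨_, _, qe1 _ _ _, C.adj _⟩

theorem qnear (C : Cyc G F k f u) (a b : ℕ) (h : W a b) :
    ∃ x ∈ qe f u a, ∃ y ∈ qe f u b, x = y ∨ G.Adj x y := by
  unfold W at h
  obtain ⟨t, rfl | rfl⟩ : ∃ t, a = 2 * t ∨ a = 2 * t + 1 := ⟨a / 2, by omega⟩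
  · obtain rfl | rfl | rfl | rfl : b = 2 * t + 1 ∨ b = 2 * (t + 1) ∨ b = 2 * (t + 1) + 1 ∨
      b = 2 * (t + 2) + 1 := by omega
    · rw [qe0, qe1]; exact ⟨f (t + 1), by simp, f (t + 1), by simp, Or.inl rfl⟩
    · rw [qe0, qe0]; exact ⟨f (t + 1), by simp, f (t + 1 + 1), by simp, Or.inr (C.adj _)⟩
    · rw [qe0, qe1]; exact ⟨f (t + 1), by simp, f (t + 1), by simp, Or.inl rfl⟩
    · rw [qe0, qe1]; exact ⟨f (t + 1), by simp, f (t + 2), by simp, Or.inr (C.adj _)⟩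
  · obtain rfl | rfl | rfl : b = 2 * (t + 1) ∨ b = 2 * (t + 1) + 1 ∨ b = 2 * (t + 2) + 1 := by omega
    · rw [qe1, qe0]; exact ⟨f (t + 1), by simp, f (t + 1 + 1), by simp, Or.inr (C.adj _)⟩
    · rw [qe1, qe1]; exact ⟨f (t + 1), by simp, f (t + 1), by simp, Or.inl rfl⟩
    · rw [qe1, qe1]; exact ⟨f (t + 1), by simp, f (t + 2), by simp, Or.inr (C.adj _)⟩

theorem qne (C : Cyc G F k f u) (h5 : 5 ≤ k) (a b : ℕ) (hab : a < b) (hb : b < 2 * k) :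
    qe f u a ≠ qe f u b := by
  obtain ⟨t, rfl | rfl⟩ : ∃ t, a = 2 * t ∨ a = 2 * t + 1 := ⟨a / 2, by omega⟩
  · obtain ⟨d, rfl | rfl⟩ : ∃ d, b = 2 * (t + d) ∨ b = 2 * (t + d) + 1 := ⟨b / 2 - t, by omega⟩
    · rw [qe0, qe0, Ne, Sym2.eq_iff]
      rintro (⟨h, _⟩ | ⟨h, _⟩)
      · rw [show t + d + 1 = t + 1 + d by ring] at h
        exact C.ff (t + 1) d (by omega) (by omega) h
      · exact C.ufall h5 _ _ (by omega) (by omega) h.symm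
    · rw [qe0, qe1, Ne, Sym2.eq_iff]
      rintro (⟨_, h⟩ | ⟨_, h⟩)
      · exact C.ufall h5 _ _ (by omega) (by omega) h
      · exact C.ufall h5 _ _ (by omega) (by omega) h
  · obtain ⟨d, rfl | rfl⟩ : ∃ d, b = 2 * (t + d) ∨ b = 2 * (t + d) + 1 := ⟨b / 2 - t, by omega⟩
    · rw [qe1, qe0, Ne, Sym2.eq_iff]
      rintro (⟨_, h⟩ | ⟨_, h⟩)
      · exact C.ufall h5 _ _ (by omega) (by omega) h.symm
      · rw [show t + d + 1 = t + 1 + d by ring] at h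
        exact C.ff (t + 1) d (by omega) (by omega) h
    · rw [qe1, qe1, Ne, Sym2.eq_iff]
      rintro (⟨h, _⟩ | ⟨h, h'⟩)
      · exact C.ff t d (by omega) (by omega) h
      · rcases Nat.lt_or_ge 1 d with hd | hd
        · rw [show t + d = t + 1 + (d - 1) by omega] at h'
          exact C.ff (t + 1) (d - 1) (by omega) (by omega) h'
        · obtain rfl : d = 1 := by omega
          exact C.nbt t h

theorem qnon (C : Cyc G F k f u) (H : Cex G L F) (h7 : 7 ≤ k) (a b : ℕ) (hab : a < b) (hb : b < 2 * k)
    (h1 : ¬ W a b) (h2 : ¬ W b (a + 2 * k)) : ¬ Conf G (qe f u a) (qe f u b) := by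
  unfold W at h1 h2
  obtain ⟨t, rfl | rfl⟩ : ∃ t, a = 2 * t ∨ a = 2 * t + 1 := ⟨a / 2, by omega⟩
  · obtain ⟨d, rfl | rfl⟩ : ∃ d, b = 2 * (t + d) ∨ b = 2 * (t + d) + 1 := ⟨b / 2 - t, by omega⟩
    · rw [qe0, qe0, show t + d + 1 = t + 1 + d by ring]
      exact C.npp H (by omega) _ _ (by omega) (by omega) (by omega)
    · rw [qe0, qe1, show t + d = t + 1 + (d - 1) by omega]
      exact C.npc H (by omega) _ _ (by omega) (by omega)
  · obtain ⟨d, rfl | rfl⟩ : ∃ d, b = 2 * (t + d) ∨ b = 2 * (t + d) + 1 := ⟨b / 2 - t, by omega⟩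
    · rw [qe1, qe0, add_assoc t d 1]
      exact C.ncp H (by omega) _ _ (by omega) (by omega)
    · rw [qe1, qe1]
      exact C.ncc _ _ (by omega) (by omega)

theorem not7 (C : Cyc G F k f u) (H : Cex G L F) (h7 : 7 ≤ k) : False := by
  obtain ⟨j, rfl⟩ : ∃ j, k = j + 2 := ⟨k - 2, by omega⟩
  have hj : 5 ≤ j := by omega
  have e2 : 2 * (j + 2) = 2 * j + 4 := by ring
  refine H.red' (2 * j + 4) (qe f u) ?_ ?_ ?_ (esC j) ?_ (nodup_esC j hj) ?_ ?_ (fun _ => 12) ?_ (tgC j)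
    ?_ ?_ ?_
  · intro i _
    obtain ⟨a, b, h1, h2⟩ := C.qedge i
    rw [h1]; exact h2
  · intro a ha b hb h
    rcases lt_trichotomy a b with h' | h' | h'
    · exact absurd h (C.qne (by omega) a b h' (by omega))
    · exact h'
    · exact absurd h.symm (C.qne (by omega) b a h' (by omega))
  · rcases H.hexN (C.touch 1) (C.nb 0) with h | h | h
    · exact ⟨2 * 0 + 1, by omega, by rw [qe1, Sym2.eq_swap]; exact h⟩
    · exact ⟨2 * 1 + 1, by omega, by rw [qe1]; exact h⟩
    · exact ⟨2 * 0, by omega, by rw [qe0]; exact h⟩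
  · rintro ⟨a, b⟩ hx
    rw [mem_esC j hj] at hx
    exact ⟨hx.1, hx.2.1⟩
  · rintro ⟨a, b⟩ hx
    rw [mem_esC j hj] at hx
    obtain ⟨h1, h2, h3⟩ := hx
    refine ⟨C.qne (by omega) a b h1 (by omega), ?_⟩
    rcases h3 with h3 | h3
    · exact C.qnear a b h3
    · obtain ⟨x, hx, y, hy, h⟩ := C.qnear _ _ h3
      rw [← e2, C.qper] at hy
      exact ⟨y, hy, x, hx, h.imp Eq.symm fun h => h.symm⟩
  · intro a b hab hb hc
    rw [mem_esC j hj]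
    refine ⟨hab, hb, ?_⟩
    by_contra hn
    rw [not_or] at hn
    exact C.qnon H h7 a b hab (by omega) hn.1 (by rw [e2]; exact hn.2) hc
  · intro i _
    obtain ⟨a, b, h1, h2⟩ := C.qedge i
    rw [h1]; exact H.cb12 h2
  · intro v hv
    rw [tgC, if_neg (by omega)]
  · intro i hi
    have := deg_esC j hj i hi
    show tgC j i + 12 < _
    omega
  · intro h
    exact coef_C j hj (by rw [h]; simp)

end Cyc

theorem Cex.absurd (H : Cex G L F) : False := by
  obtain ⟨k, f, u, C⟩ := H.exCyc
  have h3 := C.three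
  rcases Nat.lt_or_ge k 7 with h | h
  · obtain rfl | rfl | rfl | rfl : k = 3 ∨ k = 4 ∨ k = 5 ∨ k = 6 := by omega
    · exact C.not3 H
    · exact C.not4 H
    · exact C.not5 H
    · exact C.not6 H
  · exact C.not7 H h

end long

section final
open SimpleGraph
variable {V : Type*} {G : SimpleGraph V} {L : Sym2 V → Finset ℕ}

theorem all_good (hc : ∀ v, ∃ x y z, Nb G v x y z) (hL : ∀ e ∈ G.edgeSet, 10 ≤ (L e).card)
    (F : Finset (Sym2 V)) : (∀ e ∈ F, e ∈ G.edgeSet) → Good G L F := by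
  induction F using Finset.strongInduction with
  | H F ih =>
    intro hF
    by_contra hb
    exact Cex.absurd (G := G) (L := L) (F := F)
      ⟨hc, hF, hL, hb, fun F' h => ih F' h fun e he => hF e (h.1 he)⟩

theorem global_good (hc : ∀ v, ∃ x y z, Nb G v x y z) (hL : ∀ e ∈ G.edgeSet, 10 ≤ (L e).card) :
    ∃ φ : Sym2 V → ℕ, (∀ e ∈ G.edgeSet, φ e ∈ L e) ∧
      ∀ e ∈ G.edgeSet, ∀ f ∈ G.edgeSet, Conf G e f → φ e ≠ φ f := by
  classical
  have h0 : ∀ F : Finset (Sym2 V), Good G L (F.filter (· ∈ G.edgeSet)) := fun F =>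
    all_good hc hL _ fun e he => (Finset.mem_filter.1 he).2
  choose ψ h1 h2 using h0
  let g : Finset (Sym2 V) → (e : Sym2 V) → {c // c ∈ insert 0 (L e)} := fun F e =>
    if h : ψ F e ∈ insert 0 (L e) then ⟨ψ F e, h⟩ else ⟨0, Finset.mem_insert_self _ _⟩
  have hg : ∀ F, ∀ e ∈ F, e ∈ G.edgeSet → (g F e : ℕ) = ψ F e := by
    intro F e he hE
    have := Finset.mem_insert_of_mem (b := 0) (h1 F e (Finset.mem_filter.2 ⟨he, hE⟩))
    simp only [g, dif_pos this]
  obtain ⟨χ, hχ⟩ := Finset.rado_selection g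
  refine ⟨fun e => χ e, ?_, ?_⟩
  · intro e he
    obtain ⟨t, ht, h⟩ := hχ {e}
    have het := ht (Finset.mem_singleton_self e)
    show (χ e : ℕ) ∈ L e
    rw [h e (Finset.mem_singleton_self e), hg t e het he]
    exact h1 t e (Finset.mem_filter.2 ⟨het, he⟩)
  · intro e he f hf hcf
    obtain ⟨t, ht, h⟩ := hχ {e, f}
    have het := ht (show e ∈ ({e, f} : Finset _) by simp)
    have hft := ht (show f ∈ ({e, f} : Finset _) by simp)
    show (χ e : ℕ) ≠ χ f
    rw [h e (by simp), h f (by simp), hg t e het he, hg t f hft hf]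
    exact h2 t e (Finset.mem_filter.2 ⟨het, he⟩) f (Finset.mem_filter.2 ⟨hft, hf⟩) hcf

theorem nb_of (hc : ∀ v, ∃ x y z, Nb G v x y z) {v x : V} (hx : G.Adj v x) : ∃ y z, Nb G v x y z := by
  obtain ⟨p, q, r, h⟩ := hc v
  rcases (h.2.2.2 x).1 hx with rfl | rfl | rfl
  · exact ⟨_, _, h⟩
  · exact ⟨_, _, h.rot⟩
  · exact ⟨_, _, h.rot.rot⟩

theorem rich_of (φ : Sym2 V → ℕ)
    (hφ : ∀ e ∈ G.edgeSet, ∀ f ∈ G.edgeSet, Conf G e f → φ e ≠ φ f) {u v a b c d : V}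
    (hu : Nb G u v a b) (hv : Nb G v u c d) : IsRich G φ s(u, v) := by
  have huv : u ≠ v := hu.a1.ne
  have hset : {f | f ∈ G.edgeSet ∧ EdgeAdj s(u, v) f} = {s(u, a), s(u, b), s(v, c), s(v, d)} := by
    ext f
    simp only [Set.mem_setOf_eq, Set.mem_insert_iff, Set.mem_singleton_iff]
    constructor
    · rintro ⟨hf, hne, w, hw, hwf⟩
      obtain ⟨y, rfl⟩ := Sym2.mem_iff_exists.1 hwf
      rw [SimpleGraph.mem_edgeSet] at hf
      rcases Sym2.mem_iff.1 hw with rfl | rfl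
      · rcases (hu.2.2.2 y).1 hf with rfl | rfl | rfl
        · exact absurd rfl hne
        · simp
        · simp
      · rcases (hv.2.2.2 y).1 hf with rfl | rfl | rfl
        · exact absurd Sym2.eq_swap hne
        · simp
        · simp
    · rintro (rfl | rfl | rfl | rfl)
      · exact ⟨hu.a2, fun h => hu.1 (Sym2.congr_right.1 h), u, by simp, by simp⟩
      · exact ⟨hu.a3, fun h => hu.2.1 (Sym2.congr_right.1 h), u, by simp, by simp⟩
      · exact ⟨hv.a2, fun h => hv.1 (Sym2.congr_right.1 (Sym2.eq_swap.trans h)), v, by simp, by simp⟩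
      · exact ⟨hv.a3, fun h => hv.2.1 (Sym2.congr_right.1 (Sym2.eq_swap.trans h)), v, by simp, by simp⟩
  have cross : ∀ x y, u ≠ y → s(u, x) ≠ s(v, y) := by
    intro x y hy h
    rcases Sym2.eq_iff.1 h with ⟨h, _⟩ | ⟨h, _⟩
    · exact huv h
    · exact hy h
  have kc : ∀ x y, u ≠ y → Conf G s(u, x) s(v, y) := fun x y hy =>
    ⟨cross x y hy, u, by simp, v, by simp, Or.inr hu.a1⟩
  have n1 : φ s(u, a) ≠ φ s(u, b) := hφ _ hu.a2 _ hu.a3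
    ⟨fun h => hu.2.2.1 (Sym2.congr_right.1 h), u, by simp, u, by simp, Or.inl rfl⟩
  have n2 : φ s(v, c) ≠ φ s(v, d) := hφ _ hv.a2 _ hv.a3
    ⟨fun h => hv.2.2.1 (Sym2.congr_right.1 h), v, by simp, v, by simp, Or.inl rfl⟩
  have n3 : φ s(u, a) ≠ φ s(v, c) := hφ _ hu.a2 _ hv.a2 (kc _ _ hv.1)
  have n4 : φ s(u, a) ≠ φ s(v, d) := hφ _ hu.a2 _ hv.a3 (kc _ _ hv.2.1)
  have n5 : φ s(u, b) ≠ φ s(v, c) := hφ _ hu.a3 _ hv.a2 (kc _ _ hv.1)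
  have n6 : φ s(u, b) ≠ φ s(v, d) := hφ _ hu.a3 _ hv.a3 (kc _ _ hv.2.1)
  rw [IsRich, hset]
  simp only [Set.image_insert_eq, Set.image_singleton]
  rw [Set.ncard_eq_toFinset_card']
  simp [n1, n2, n3, n4, n5, n6]

end final

/-- Every cubic graph has list normal chromatic index at most 10. -/
theorem cubic_list_normal_chromatic_index_le_ten {V : Type*} (G : SimpleGraph V)
    (hcubic : ∀ v, (G.neighborSet v).ncard = 3)
    (L : Sym2 V → Finset ℕ) (hL : ∀ e ∈ G.edgeSet, 10 ≤ (L e).card) :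
    ∃ φ : Sym2 V → ℕ, IsNormalEdgeColoring G φ ∧ ∀ e ∈ G.edgeSet, φ e ∈ L e := by
  have hc : ∀ v, ∃ x y z, Nb G v x y z := by
    intro v
    obtain ⟨x, y, z, h1, h2, h3, h⟩ := Set.ncard_eq_three.1 (hcubic v)
    refine ⟨x, y, z, h1, h2, h3, fun w => ?_⟩
    rw [← SimpleGraph.mem_neighborSet, h]
    simp
  obtain ⟨φ, h1, h2⟩ := global_good hc hL
  refine ⟨φ, ⟨?_, ?_⟩, h1⟩
  · rintro e he f hf ⟨hne, v, hv, hv'⟩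
    exact h2 e he f hf ⟨hne, v, hv, v, hv', Or.inl rfl⟩
  · intro e
    induction e with | _ u v
    intro he
    obtain ⟨a, b, hu⟩ := nb_of hc (show G.Adj u v from he)
    obtain ⟨c, d, hv⟩ := nb_of hc (show G.Adj v u from he.symm)
    exact Or.inl (rich_of φ h2 hu hv)
end

section
/- There exists a bridgeless cubic graph on 12 vertices whose list normal chromatic index is at least 8: there is a list assignment with lists of size 7 from which no normal edge-coloring can be chosen. -/
open SimpleGraph

namespace Necklace

def nbr (i : Fin 12) : List (Fin 12) :=
  match i with
  | 0 => [4, 8, 3] | 1 => [4, 8, 10] | 2 => [5, 9, 7] | 3 => [0, 5, 9]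
  | 4 => [0, 1, 6] | 5 => [3, 11, 2] | 6 => [4, 8, 10] | 7 => [10, 11, 2]
  | 8 => [0, 6, 1] | 9 => [3, 11, 2] | 10 => [1, 6, 7] | 11 => [5, 9, 7]

def gr : SimpleGraph (Fin 12) where
  Adj i j := j ∈ nbr i
  symm := ⟨by decide⟩
  loopless := ⟨by decide⟩

instance : DecidableRel gr.Adj := fun i j => inferInstanceAs (Decidable (j ∈ nbr i))

/-- successor on a Hamiltonian cycle -/
def nx (i : Fin 12) : Fin 12 :=
  match i with
  | 0 => 3 | 3 => 5 | 5 => 2 | 2 => 9 | 9 => 11 | 11 => 7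
  | 7 => 10 | 10 => 6 | 6 => 8 | 8 => 1 | 1 => 4 | 4 => 0

lemma reach (H : SimpleGraph (Fin 12)) (x : Fin 12) (k : ℕ)
    (h : ∀ m < k, H.Adj (nx^[m] x) (nx (nx^[m] x))) : H.Reachable x (nx^[k] x) := by
  induction k with
  | zero => exact Reachable.refl _
  | succ k ih =>
    rw [Function.iterate_succ_apply']
    exact (ih fun m hm => h m (by omega)).trans (h k (by omega)).reachable

lemma nx_adj : ∀ x, gr.Adj x (nx x) := by decide

lemma route : ∀ u v : Fin 12, gr.Adj u v →
    (∃ k < 12, nx^[k] v = u ∧ ∀ m < k, s(nx^[m] v, nx (nx^[m] v)) ≠ s(u, v)) ∨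
    (∃ k < 12, nx^[k] u = v ∧ ∀ m < k, s(nx^[m] u, nx (nx^[m] u)) ≠ s(u, v)) := by
  decide +kernel

lemma not_bridge : ∀ e ∈ gr.edgeSet, ¬ gr.IsBridge e := by
  intro e
  induction e using Sym2.ind with
  | _ u v =>
  intro he hb
  rw [isBridge_iff] at hb
  rcases route u v he with ⟨k, -, hk, h⟩ | ⟨k, -, hk, h⟩
  · refine hb (Reachable.symm ?_)
    have := reach (gr.deleteEdges {s(u, v)}) v k (fun m hm => by
      rw [deleteEdges_adj]; exact ⟨nx_adj _, h m hm⟩)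
    rwa [hk] at this
  · refine hb ?_
    have := reach (gr.deleteEdges {s(u, v)}) u k (fun m hm => by
      rw [deleteEdges_adj]; exact ⟨nx_adj _, h m hm⟩)
    rwa [hk] at this

lemma card_cond (a b c d : ℕ) (h1 : a ≠ b) (h2 : c ≠ d)
    (h : ({a, b, c, d} : Set ℕ).ncard = 4 ∨ ({a, b, c, d} : Set ℕ).ncard = 2) :
    (a ≠ c ∧ a ≠ d ∧ b ≠ c ∧ b ≠ d) ∨ (a = c ∧ b = d) ∨ (a = d ∧ b = c) := by
  have e : ({a, b, c, d} : Set ℕ) = (({a, b, c, d} : Finset ℕ) : Set ℕ) := by simp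
  rw [e, Set.ncard_coe_finset] at h
  by_cases h3 : a = c <;> by_cases h4 : a = d <;> by_cases h5 : b = c <;> by_cases h6 : b = d <;>
    simp_all

lemma adj_set (u v : Fin 12) (e₁ e₂ e₃ e₄ : Sym2 (Fin 12))
    (h : ∀ x y : Fin 12, (gr.Adj x y ∧ s(u, v) ≠ s(x, y) ∧ (u = x ∨ u = y ∨ v = x ∨ v = y)) ↔
      (s(x, y) = e₁ ∨ s(x, y) = e₂ ∨ s(x, y) = e₃ ∨ s(x, y) = e₄)) :
    {f | f ∈ gr.edgeSet ∧ EdgeAdj s(u, v) f} = {e₁, e₂, e₃, e₄} := by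
  ext f
  induction f using Sym2.ind with
  | _ x y =>
  have := h x y
  simp only [Set.mem_ofPred_eq, mem_edgeSet, EdgeAdj, Set.mem_insert_iff, Set.mem_singleton_iff]
  rw [← this]
  simp only [Sym2.mem_iff]
  constructor
  · rintro ⟨p, q, w, rfl | rfl, r⟩ <;> exact ⟨p, q, by tauto⟩
  · rintro ⟨p, q, r⟩
    refine ⟨p, q, ?_⟩
    rcases r with r | r | r | r
    · exact ⟨u, by tauto⟩
    · exact ⟨u, by tauto⟩
    · exact ⟨v, by tauto⟩
    · exact ⟨v, by tauto⟩

lemma cond (φ : Sym2 (Fin 12) → ℕ) (hφ : IsNormalEdgeColoring gr φ) (u v : Fin 12)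
    (e₁ e₂ e₃ e₄ : Sym2 (Fin 12))
    (hd : (gr.Adj u v ∧ (e₁ ∈ gr.edgeSet ∧ e₂ ∈ gr.edgeSet ∧ e₃ ∈ gr.edgeSet ∧ e₄ ∈ gr.edgeSet) ∧
      (u ∈ e₁ ∧ u ∈ e₂ ∧ v ∈ e₃ ∧ v ∈ e₄) ∧ e₁ ≠ e₂ ∧ e₃ ≠ e₄) ∧
     ∀ x y : Fin 12, (gr.Adj x y ∧ s(u, v) ≠ s(x, y) ∧ (u = x ∨ u = y ∨ v = x ∨ v = y)) ↔
      (s(x, y) = e₁ ∨ s(x, y) = e₂ ∨ s(x, y) = e₃ ∨ s(x, y) = e₄)) :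
    φ e₁ ≠ φ e₂ ∧ φ e₃ ≠ φ e₄ ∧
    ((φ e₁ ≠ φ e₃ ∧ φ e₁ ≠ φ e₄ ∧ φ e₂ ≠ φ e₃ ∧ φ e₂ ≠ φ e₄) ∨
      (φ e₁ = φ e₃ ∧ φ e₂ = φ e₄) ∨ (φ e₁ = φ e₄ ∧ φ e₂ = φ e₃)) := by
  obtain ⟨⟨h0, ⟨h1, h2, h3, h4⟩, ⟨m1, m2, m3, m4⟩, h5, h6⟩, h⟩ := hd
  have p1 : φ e₁ ≠ φ e₂ := hφ.1 _ h1 _ h2 ⟨h5, u, m1, m2⟩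
  have p2 : φ e₃ ≠ φ e₄ := hφ.1 _ h3 _ h4 ⟨h6, v, m3, m4⟩
  refine ⟨p1, p2, card_cond _ _ _ _ p1 p2 ?_⟩
  have := hφ.2 s(u, v) h0
  unfold IsRich IsPoor at this
  rw [adj_set u v e₁ e₂ e₃ e₄ h] at this
  simpa only [Set.image_insert_eq, Set.image_singleton] using this

/-- eight numbers below seven are not distinct -/
lemma pigeon (l : List ℕ) (hl : l.length = 8) (h : ∀ x ∈ l, x < 7) : ¬ l.Nodup := by
  intro hn
  have h1 : l.toFinset ⊆ Finset.range 7 := by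
    intro x hx
    simpa using h x (by simpa using hx)
  have h2 := Finset.card_le_card h1
  rw [List.toFinset_card_of_nodup hn, hl] at h2
  simp at h2

def isB (e : Sym2 (Fin 12)) : Prop := e = s(0, 3) ∨ e = s(1, 10) ∨ e = s(3, 5)

instance : DecidablePred isB := fun e => by unfold isB; infer_instance

def lst (e : Sym2 (Fin 12)) : Finset ℕ :=
  if isB e then Finset.Ico 7 14 else Finset.range 7

/-- the rich-or-poor condition, together with properness at both ends -/
def RP (a b c d : ℕ) : Prop :=
  a ≠ b ∧ c ≠ d ∧ ((a ≠ c ∧ a ≠ d ∧ b ≠ c ∧ b ≠ d) ∨ (a = c ∧ b = d) ∨ (a = d ∧ b = c))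

lemma rp1 {a b c d : ℕ} (h : RP a b c d) (h1 : a ≠ c) (h2 : a ≠ d) :
    a ≠ b ∧ c ≠ d ∧ a ≠ c ∧ a ≠ d ∧ b ≠ c ∧ b ≠ d := by
  unfold RP at h
  omega

lemma rp2 {a b c d : ℕ} (h : RP a b c d) (h1 : b ≠ c) (h2 : b ≠ d) :
    a ≠ b ∧ c ≠ d ∧ a ≠ c ∧ a ≠ d ∧ b ≠ c ∧ b ≠ d := by
  unfold RP at h
  omega

lemma rp3 {a b c d : ℕ} (h : RP a b c d) (h1 : c ≠ a) (h2 : c ≠ b) :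
    a ≠ b ∧ c ≠ d ∧ a ≠ c ∧ a ≠ d ∧ b ≠ c ∧ b ≠ d := by
  unfold RP at h
  omega

/-- the half with the second special edge at the far end -/
lemma side_one (p q r s t u v w z y : ℕ) (hp : p < 7) (hq : q < 7) (hr : r < 7) (hs : s < 7)
    (ht : t < 7) (hu : u < 7) (hv : v < 7) (hw : 7 ≤ w) (hz : 7 ≤ z) (hy : y < 7)
    (h1 : RP q z r t) (h2 : RP p z s u) (h3 : RP s w p t) (h4 : RP r w q u)
    (h5 : RP p r u v) (h6 : RP q s t v) (h7 : RP t u w y) (h8 : RP r s v y)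
    (h9 : p ≠ q) (h10 : v ≠ y) : y = p ∨ y = q := by
  by_contra hn
  have a1 := rp2 h1 (by omega) (by omega)
  have a2 := rp2 h2 (by omega) (by omega)
  have a3 := rp2 h3 (by omega) (by omega)
  have a4 := rp2 h4 (by omega) (by omega)
  have a5 := rp3 h5 (by grind only) (by grind only)
  have a6 := rp3 h6 (by grind only) (by grind only)
  have a7 := rp3 h7 (by omega) (by omega)
  have a8 := rp3 h8 (by grind only) (by grind only)
  refine pigeon [p, q, r, s, t, u, v, y] rfl
    (by simp only [List.mem_cons, List.not_mem_nil, or_false]; rintro _ (rfl | rfl | rfl | rfl | rfl | rfl | rfl | rfl) <;> assumption) ?_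
  simp only [List.nodup_cons, List.mem_cons, List.not_mem_nil, not_or, or_false, not_false_eq_true,
    List.nodup_nil, and_true]
  clear h1 h2 h3 h4 h5 h6 h7 h8
  grind

lemma side_two (a b c d e f g x z y : ℕ) (ha : a < 7) (hb : b < 7) (hc : c < 7) (hd : d < 7)
    (he : e < 7) (hf : f < 7) (hg : g < 7) (hx : 7 ≤ x) (hz : 7 ≤ z) (hy : y < 7)
    (h1 : RP z a b d) (h2 : RP x z c e) (h3 : RP x d c f) (h4 : RP a e b f)
    (h5 : RP x b e g) (h6 : RP a c d g) (h7 : RP g y b c) (h8 : RP f y d e)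
    (h9 : f ≠ g) : y = a := by
  by_contra hn
  have a1 := rp1 h1 (by omega) (by omega)
  have a2 := h2.2.1
  have a3 := rp1 h3 (by omega) (by omega)
  have a5 := rp1 h5 (by omega) (by omega)
  have a6 := rp3 h6 (by grind only) (by grind only)
  have a4 := rp3 h4 (by grind only) (by grind only)
  have a7 := rp1 h7 (by grind only) (by grind only)
  have a8 := rp1 h8 (by grind only) (by grind only)
  refine pigeon [a, b, c, d, e, f, g, y] rfl
    (by simp only [List.mem_cons, List.not_mem_nil, or_false]; rintro _ (rfl | rfl | rfl | rfl | rfl | rfl | rfl | rfl) <;> assumption) ?_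
  simp only [List.nodup_cons, List.mem_cons, List.not_mem_nil, not_or, or_false, not_false_eq_true,
    List.nodup_nil, and_true]
  clear h1 h2 h3 h4 h5 h6 h7 h8
  grind

end Necklace

open Necklace in
theorem exists_bridgeless_cubic_list_normal_ge_eight :
    ∃ (V : Type) (G : SimpleGraph V), Finite V ∧ Nat.card V = 12 ∧
      (∀ v, (G.neighborSet v).ncard = 3) ∧
      (∀ e ∈ G.edgeSet, ¬ G.IsBridge e) ∧
      (∃ L : Sym2 V → Finset ℕ, (∀ e ∈ G.edgeSet, (L e).card = 7) ∧
        ¬ ∃ φ : Sym2 V → ℕ, IsNormalEdgeColoring G φ ∧ ∀ e ∈ G.edgeSet, φ e ∈ L e) := by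
  refine ⟨Fin 12, gr, inferInstance, by simp, ?_, not_bridge, lst, ?_, ?_⟩
  · intro v
    rw [Set.ncard_eq_toFinset_card']
    revert v
    decide +kernel
  · intro e _
    unfold lst
    split_ifs <;> simp
  rintro ⟨φ, hφ, hL⟩
  have hA : ∀ x y : Fin 12, gr.Adj x y → ¬ isB s(x, y) → φ s(x, y) < 7 := by
    intro x y h1 h2
    have := hL s(x, y) h1
    simpa [lst, h2] using this
  have hB : ∀ x y : Fin 12, gr.Adj x y → isB s(x, y) → 7 ≤ φ s(x, y) := by
    intro x y h1 h2
    have := hL s(x, y) h1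
    simp only [lst, h2, if_true, Finset.mem_Ico] at this
    exact this.1
  have K : ∀ (u v : Fin 12) (e₁ e₂ e₃ e₄ : Sym2 (Fin 12)), _ →
      RP (φ e₁) (φ e₂) (φ e₃) (φ e₄) := cond φ hφ
  have k1 := K 0 3 s(0, 4) s(0, 8) s(3, 5) s(3, 9) (by decide +kernel)
  have k2 := K 10 7 s(6, 10) s(1, 10) s(7, 11) s(2, 7) (by decide +kernel)
  have n1 : φ s(6, 10) ≠ φ s(7, 10) := hφ.1 _ (by decide) _ (by decide)
    ⟨by decide, 10, by decide, by decide⟩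
  have s1 := side_one _ _ _ _ _ _ _ _ _ _
      (hA 0 4 (by decide) (by decide)) (hA 0 8 (by decide) (by decide)) (hA 1 4 (by decide) (by decide)) (hA 1 8 (by decide) (by decide)) (hA 4 6 (by decide) (by decide)) (hA 6 8 (by decide) (by decide)) (hA 6 10 (by decide) (by decide)) (hB 1 10 (by decide) (by decide)) (hB 0 3 (by decide) (by decide)) (hA 7 10 (by decide) (by decide))
      (K 0 4 s(0, 8) s(0, 3) s(1, 4) s(4, 6) (by decide +kernel))
      (K 0 8 s(0, 4) s(0, 3) s(1, 8) s(6, 8) (by decide +kernel))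
      (K 1 4 s(1, 8) s(1, 10) s(0, 4) s(4, 6) (by decide +kernel))
      (K 1 8 s(1, 4) s(1, 10) s(0, 8) s(6, 8) (by decide +kernel))
      (K 4 6 s(0, 4) s(1, 4) s(6, 8) s(6, 10) (by decide +kernel))
      (K 8 6 s(0, 8) s(1, 8) s(4, 6) s(6, 10) (by decide +kernel))
      (K 6 10 s(4, 6) s(6, 8) s(1, 10) s(7, 10) (by decide +kernel))
      (K 1 10 s(1, 4) s(1, 8) s(6, 10) s(7, 10) (by decide +kernel))
      k1.1 n1
  have s2 := side_two _ _ _ _ _ _ _ _ _ _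
      (hA 3 9 (by decide) (by decide)) (hA 5 11 (by decide) (by decide)) (hA 9 11 (by decide) (by decide)) (hA 2 5 (by decide) (by decide)) (hA 2 9 (by decide) (by decide)) (hA 7 11 (by decide) (by decide)) (hA 2 7 (by decide) (by decide)) (hB 3 5 (by decide) (by decide)) (hB 0 3 (by decide) (by decide)) (hA 7 10 (by decide) (by decide))
      (K 3 5 s(0, 3) s(3, 9) s(5, 11) s(2, 5) (by decide +kernel))
      (K 3 9 s(3, 5) s(0, 3) s(9, 11) s(2, 9) (by decide +kernel))
      (K 5 11 s(3, 5) s(2, 5) s(9, 11) s(7, 11) (by decide +kernel))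
      (K 9 11 s(3, 9) s(2, 9) s(5, 11) s(7, 11) (by decide +kernel))
      (K 5 2 s(3, 5) s(5, 11) s(2, 9) s(2, 7) (by decide +kernel))
      (K 9 2 s(3, 9) s(9, 11) s(2, 5) s(2, 7) (by decide +kernel))
      (K 7 11 s(2, 7) s(7, 10) s(5, 11) s(9, 11) (by decide +kernel))
      (K 7 2 s(7, 11) s(7, 10) s(2, 5) s(2, 9) (by decide +kernel))
      k2.2.1
  have b1 := hA 0 4 (by decide) (by decide)
  have b2 := hA 0 8 (by decide) (by decide)
  have b3 := hB 3 5 (by decide) (by decide)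
  unfold RP at k1
  omega
end

section
/- The prism graph over a path of triangles used in the construction (any cubic graph containing the configuration H_I of Figure 4, which includes a bridge) has list normal chromatic index at least 9: there is a list assignment with lists of size 8 admitting no normal edge-coloring; in particular, there exist infinitely many cubic graphs with list normal chromatic index at least 9. -/
open SimpleGraph

namespace HIProof

/-- The local richness/poorness condition on the four colors around an edge. -/
def RP (a b c d : ℕ) : Prop :=
  (a ≠ c ∧ a ≠ d ∧ b ≠ c ∧ b ≠ d) ∨ (a = c ∧ b = d) ∨ (a = d ∧ b = c)

lemma pigeon (f : Fin 9 → ℕ) (h : ∀ i, f i < 8) (hf : Function.Injective f) : False := by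
  have := Fintype.card_le_of_injective (fun i => (⟨f i, h i⟩ : Fin 8))
    (fun i j hij => hf (by simpa using hij))
  simp at this

lemma core (c01 c03 c05 c12 c14 c23 c25 c34 c46 c56 c67 : ℕ)
    (h01 : c01 < 8) (h03 : c03 < 8) (h05 : 8 ≤ c05) (h05' : c05 < 16) (h12 : c12 < 8)
    (h14 : c14 < 8) (h23 : c23 < 8) (h25 : c25 < 8) (h34 : c34 < 8) (h46 : c46 < 8)
    (h56 : c56 < 8) (h67 : 16 ≤ c67)
    (p0 : c01 ≠ c03)
    (p1 : c01 ≠ c12 ∧ c01 ≠ c14 ∧ c12 ≠ c14)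
    (p2 : c12 ≠ c23 ∧ c12 ≠ c25 ∧ c23 ≠ c25)
    (p3 : c03 ≠ c23 ∧ c03 ≠ c34 ∧ c23 ≠ c34)
    (p4 : c14 ≠ c34 ∧ c14 ≠ c46 ∧ c34 ≠ c46)
    (p5 : c25 ≠ c56) (p6 : c46 ≠ c56)
    (r01 : RP c03 c05 c12 c14) (r03 : RP c01 c05 c23 c34) (r05 : RP c01 c03 c25 c56)
    (r12 : RP c01 c14 c23 c25) (r14 : RP c01 c12 c34 c46) (r23 : RP c12 c25 c03 c34)
    (r25 : RP c12 c23 c05 c56) (r34 : RP c03 c23 c14 c46) (r46 : RP c14 c34 c56 c67)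
    (r56 : RP c05 c25 c46 c67) : False := by
  have r01 : c03 ≠ c12 ∧ c03 ≠ c14 := by unfold RP at r01; omega
  have r03 : c01 ≠ c23 ∧ c01 ≠ c34 := by unfold RP at r03; omega
  have r25 : c12 ≠ c56 ∧ c23 ≠ c56 := by unfold RP at r25; omega
  have r46 : c14 ≠ c56 ∧ c34 ≠ c56 := by unfold RP at r46; omega
  have r56 : c25 ≠ c46 := by unfold RP at r56; omega
  have r12 : c01 ≠ c25 ∧ c14 ≠ c23 ∧ c14 ≠ c25 := by
    clear r14 r23; unfold RP at r12 r05 r34; grind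
  have r23 : c12 ≠ c34 ∧ c25 ≠ c03 ∧ c25 ≠ c34 := by
    clear r34; unfold RP at r23 r05 r14; grind
  have r14 : c01 ≠ c46 ∧ c12 ≠ c46 := by unfold RP at r14; grind
  have r34 : c03 ≠ c46 ∧ c23 ≠ c46 := by unfold RP at r34; grind
  have r05 : c01 ≠ c56 ∧ c03 ≠ c56 := by unfold RP at r05; grind
  refine pigeon ![c01, c03, c12, c14, c23, c25, c34, c46, c56] ?_ ?_
  · intro i; fin_cases i <;> simpa
  · have hn : [c01, c03, c12, c14, c23, c25, c34, c46, c56].Nodup := by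
      simp only [List.nodup_cons, List.mem_cons, List.not_mem_nil, or_false, not_false_eq_true,
        List.nodup_nil, and_true, not_or]
      clear h01 h03 h05 h05' h12 h14 h23 h25 h34 h46 h56 h67
      obtain ⟨p1a, p1b, p1c⟩ := p1
      obtain ⟨p2a, p2b, p2c⟩ := p2
      obtain ⟨p3a, p3b, p3c⟩ := p3
      obtain ⟨p4a, p4b, p4c⟩ := p4
      obtain ⟨r01, r01'⟩ := r01
      obtain ⟨r03, r03'⟩ := r03
      obtain ⟨r25, r25'⟩ := r25
      obtain ⟨r46, r46'⟩ := r46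
      obtain ⟨r12, r12', r12b⟩ := r12
      obtain ⟨r23, r23', r23b⟩ := r23
      obtain ⟨r14, r14'⟩ := r14
      obtain ⟨r34, r34'⟩ := r34
      obtain ⟨r05, r05'⟩ := r05
      and_intros <;> first | assumption | (apply Ne.symm; assumption)
    have := List.nodup_iff_injective_get.1 hn
    intro i j hij
    apply this
    fin_cases i <;> fin_cases j <;> first | rfl | simpa using hij

lemma nbr {V : Type} {G : SimpleGraph V} {w a b c : V} (h : (G.neighborSet w).ncard = 3)
    (ha : G.Adj w a) (hb : G.Adj w b) (hc : G.Adj w c) (hab : a ≠ b) (hac : a ≠ c)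
    (hbc : b ≠ c) : ∀ x, G.Adj w x ↔ x = a ∨ x = b ∨ x = c := by
  have hfin : (G.neighborSet w).Finite := Set.finite_of_ncard_ne_zero (by omega)
  have : ({a, b, c} : Set V) = G.neighborSet w := by
    apply Set.eq_of_subset_of_ncard_le _ _ hfin
    · rintro x (rfl | rfl | rfl) <;> assumption
    · rw [h, Set.ncard_eq_three.2 ⟨a, b, c, hab, hac, hbc, rfl⟩]
  intro x
  rw [← SimpleGraph.mem_neighborSet, ← this]
  simp

lemma pr {V : Type} {G : SimpleGraph V} {φ : Sym2 V → ℕ} (hφ : IsNormalEdgeColoring G φ)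
    {u a b : V} (ha : G.Adj u a) (hb : G.Adj u b) (hab : a ≠ b) : φ s(u, a) ≠ φ s(u, b) := by
  refine hφ.1 _ ha _ hb ⟨?_, u, by simp, by simp⟩
  intro h
  exact hab (Sym2.congr_right.1 h)

lemma edge {V : Type} {G : SimpleGraph V} {φ : Sym2 V → ℕ} (hφ : IsNormalEdgeColoring G φ)
    {u v a b c d : V} (hu : ∀ x, G.Adj u x ↔ x = v ∨ x = a ∨ x = b)
    (hv : ∀ x, G.Adj v x ↔ x = u ∨ x = c ∨ x = d)
    (hva : v ≠ a) (hvb : v ≠ b) (hab : a ≠ b) (huc : u ≠ c) (hud : u ≠ d) (hcd : c ≠ d) :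
    RP (φ s(u, a)) (φ s(u, b)) (φ s(v, c)) (φ s(v, d)) := by
  have hset : {f | f ∈ G.edgeSet ∧ EdgeAdj s(u, v) f}
      = {s(u, a), s(u, b), s(v, c), s(v, d)} := by
    ext f
    simp only [Set.mem_ofPred_eq, Set.mem_insert_iff, Set.mem_singleton_iff]
    constructor
    · rintro ⟨hf, hne, x, hx, hxf⟩
      obtain ⟨y, rfl⟩ := Sym2.mem_iff_exists.1 hxf
      rw [SimpleGraph.mem_edgeSet] at hf
      rcases Sym2.mem_iff.1 hx with rfl | rfl
      · rcases (hu y).1 hf with rfl | rfl | rfl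
        · exact absurd rfl hne
        · simp
        · simp
      · rcases (hv y).1 hf with rfl | rfl | rfl
        · exact absurd Sym2.eq_swap hne
        · simp
        · simp
    · rintro (rfl | rfl | rfl | rfl)
      · exact ⟨(hu a).2 (by simp), fun h => hva (Sym2.congr_right.1 h), u, by simp, by simp⟩
      · exact ⟨(hu b).2 (by simp), fun h => hvb (Sym2.congr_right.1 h), u, by simp, by simp⟩
      · exact ⟨(hv c).2 (by simp), fun h => huc (Sym2.congr_right.1 (Sym2.eq_swap.trans h)),
          v, by simp, by simp⟩
      · exact ⟨(hv d).2 (by simp), fun h => hud (Sym2.congr_right.1 (Sym2.eq_swap.trans h)),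
          v, by simp, by simp⟩
  have h1 : φ s(u, a) ≠ φ s(u, b) := pr hφ ((hu a).2 (by simp)) ((hu b).2 (by simp)) hab
  have h2 : φ s(v, c) ≠ φ s(v, d) := pr hφ ((hv c).2 (by simp)) ((hv d).2 (by simp)) hcd
  have h := hφ.2 s(u, v) ((hu v).2 (by simp))
  unfold IsRich IsPoor at h
  rw [hset] at h
  simp only [Set.image_insert_eq, Set.image_singleton] at h
  generalize φ s(u, a) = p at *
  generalize φ s(u, b) = q at *
  generalize φ s(v, c) = r at *
  generalize φ s(v, d) = t at *
  have hc : ({p, q, r, t} : Set ℕ) = (({p, q, r, t} : Finset ℕ) : Set ℕ) := by simp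
  rw [hc, Set.ncard_coe_finset] at h
  unfold RP
  by_cases e1 : p = r <;> by_cases e2 : p = t <;> by_cases e3 : q = r <;> by_cases e4 : q = t <;>
    first
    | omega
    | (subst_vars; exfalso; simp_all [Finset.card_insert_of_notMem])

lemma main (V : Type) (G : SimpleGraph V) (v : Fin 8 → V) (hv : Function.Injective v)
    (h3 : ∀ w, (G.neighborSet w).ncard = 3)
    (a01 : G.Adj (v 0) (v 1)) (a03 : G.Adj (v 0) (v 3)) (a05 : G.Adj (v 0) (v 5))
    (a12 : G.Adj (v 1) (v 2)) (a14 : G.Adj (v 1) (v 4))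
    (a23 : G.Adj (v 2) (v 3)) (a25 : G.Adj (v 2) (v 5))
    (a34 : G.Adj (v 3) (v 4))
    (a46 : G.Adj (v 4) (v 6)) (a56 : G.Adj (v 5) (v 6)) (a67 : G.Adj (v 6) (v 7)) :
    ∃ L : Sym2 V → Finset ℕ, (∀ e ∈ G.edgeSet, (L e).card = 8) ∧
        ¬ ∃ φ : Sym2 V → ℕ, IsNormalEdgeColoring G φ ∧ ∀ e ∈ G.edgeSet, φ e ∈ L e := by
  classical
  have ne : ∀ i j : Fin 8, i ≠ j → v i ≠ v j := fun i j h h' => h (hv h')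
  refine ⟨fun e => if e = s(v 0, v 5) then Finset.Ico 8 16
    else if e = s(v 6, v 7) then Finset.Ico 16 24 else Finset.Ico 0 8, ?_, ?_⟩
  · intro e _
    dsimp only
    split_ifs <;> simp
  rintro ⟨φ, hφ, hL⟩
  have b : ∀ i j : Fin 8, G.Adj (v i) (v j) → s(i, j) ≠ s(0, 5) → s(i, j) ≠ s(6, 7) →
      φ s(v i, v j) < 8 := by
    intro i j ha h1 h2
    have := hL s(v i, v j) ha
    have e1 : s(v i, v j) ≠ s(v 0, v 5) := fun h => h1 (Sym2.map.injective hv h)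
    have e2 : s(v i, v j) ≠ s(v 6, v 7) := fun h => h2 (Sym2.map.injective hv h)
    dsimp only at this
    rw [if_neg e1, if_neg e2, Finset.mem_Ico] at this
    exact this.2
  have b05 : φ s(v 0, v 5) ∈ Finset.Ico 8 16 := by simpa using hL s(v 0, v 5) a05
  have b67 : φ s(v 6, v 7) ∈ Finset.Ico 16 24 := by
    have := hL s(v 6, v 7) a67
    have e1 : s(v 6, v 7) ≠ s(v 0, v 5) := fun h =>
      (by decide : s((6 : Fin 8), 7) ≠ s(0, 5)) (Sym2.map.injective hv h)
    dsimp only at this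
    rwa [if_neg e1, if_pos rfl] at this
  rw [Finset.mem_Ico] at b05 b67
  have sw : ∀ i j : Fin 8, φ s(v i, v j) = φ s(v j, v i) := fun i j => by rw [Sym2.eq_swap]
  have n01 := nbr (h3 (v 0)) a01 a03 a05 (ne _ _ (by decide)) (ne _ _ (by decide)) (ne _ _ (by decide))
  have n10 := nbr (h3 (v 1)) a01.symm a12 a14 (ne _ _ (by decide)) (ne _ _ (by decide)) (ne _ _ (by decide))
  have n03 := nbr (h3 (v 0)) a03 a01 a05 (ne _ _ (by decide)) (ne _ _ (by decide)) (ne _ _ (by decide))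
  have n30 := nbr (h3 (v 3)) a03.symm a23.symm a34 (ne _ _ (by decide)) (ne _ _ (by decide)) (ne _ _ (by decide))
  have n05 := nbr (h3 (v 0)) a05 a01 a03 (ne _ _ (by decide)) (ne _ _ (by decide)) (ne _ _ (by decide))
  have n50 := nbr (h3 (v 5)) a05.symm a25.symm a56 (ne _ _ (by decide)) (ne _ _ (by decide)) (ne _ _ (by decide))
  have n12 := nbr (h3 (v 1)) a12 a01.symm a14 (ne _ _ (by decide)) (ne _ _ (by decide)) (ne _ _ (by decide))
  have n21 := nbr (h3 (v 2)) a12.symm a23 a25 (ne _ _ (by decide)) (ne _ _ (by decide)) (ne _ _ (by decide))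
  have n14 := nbr (h3 (v 1)) a14 a01.symm a12 (ne _ _ (by decide)) (ne _ _ (by decide)) (ne _ _ (by decide))
  have n41 := nbr (h3 (v 4)) a14.symm a34.symm a46 (ne _ _ (by decide)) (ne _ _ (by decide)) (ne _ _ (by decide))
  have n23 := nbr (h3 (v 2)) a23 a12.symm a25 (ne _ _ (by decide)) (ne _ _ (by decide)) (ne _ _ (by decide))
  have n32 := nbr (h3 (v 3)) a23.symm a03.symm a34 (ne _ _ (by decide)) (ne _ _ (by decide)) (ne _ _ (by decide))
  have n25 := nbr (h3 (v 2)) a25 a12.symm a23 (ne _ _ (by decide)) (ne _ _ (by decide)) (ne _ _ (by decide))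
  have n52 := nbr (h3 (v 5)) a25.symm a05.symm a56 (ne _ _ (by decide)) (ne _ _ (by decide)) (ne _ _ (by decide))
  have n34 := nbr (h3 (v 3)) a34 a03.symm a23.symm (ne _ _ (by decide)) (ne _ _ (by decide)) (ne _ _ (by decide))
  have n43 := nbr (h3 (v 4)) a34.symm a14.symm a46 (ne _ _ (by decide)) (ne _ _ (by decide)) (ne _ _ (by decide))
  have n46 := nbr (h3 (v 4)) a46 a14.symm a34.symm (ne _ _ (by decide)) (ne _ _ (by decide)) (ne _ _ (by decide))
  have n64 := nbr (h3 (v 6)) a46.symm a56.symm a67 (ne _ _ (by decide)) (ne _ _ (by decide)) (ne _ _ (by decide))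
  have n56 := nbr (h3 (v 5)) a56 a05.symm a25.symm (ne _ _ (by decide)) (ne _ _ (by decide)) (ne _ _ (by decide))
  have n65 := nbr (h3 (v 6)) a56.symm a46.symm a67 (ne _ _ (by decide)) (ne _ _ (by decide)) (ne _ _ (by decide))
  have r01 := edge hφ n01 n10 (ne _ _ (by decide)) (ne _ _ (by decide)) (ne _ _ (by decide)) (ne _ _ (by decide)) (ne _ _ (by decide)) (ne _ _ (by decide))
  have r03 := edge hφ n03 n30 (ne _ _ (by decide)) (ne _ _ (by decide)) (ne _ _ (by decide)) (ne _ _ (by decide)) (ne _ _ (by decide)) (ne _ _ (by decide))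
  have r05 := edge hφ n05 n50 (ne _ _ (by decide)) (ne _ _ (by decide)) (ne _ _ (by decide)) (ne _ _ (by decide)) (ne _ _ (by decide)) (ne _ _ (by decide))
  have r12 := edge hφ n12 n21 (ne _ _ (by decide)) (ne _ _ (by decide)) (ne _ _ (by decide)) (ne _ _ (by decide)) (ne _ _ (by decide)) (ne _ _ (by decide))
  have r14 := edge hφ n14 n41 (ne _ _ (by decide)) (ne _ _ (by decide)) (ne _ _ (by decide)) (ne _ _ (by decide)) (ne _ _ (by decide)) (ne _ _ (by decide))
  have r23 := edge hφ n23 n32 (ne _ _ (by decide)) (ne _ _ (by decide)) (ne _ _ (by decide)) (ne _ _ (by decide)) (ne _ _ (by decide)) (ne _ _ (by decide))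
  have r25 := edge hφ n25 n52 (ne _ _ (by decide)) (ne _ _ (by decide)) (ne _ _ (by decide)) (ne _ _ (by decide)) (ne _ _ (by decide)) (ne _ _ (by decide))
  have r34 := edge hφ n34 n43 (ne _ _ (by decide)) (ne _ _ (by decide)) (ne _ _ (by decide)) (ne _ _ (by decide)) (ne _ _ (by decide)) (ne _ _ (by decide))
  have r46 := edge hφ n46 n64 (ne _ _ (by decide)) (ne _ _ (by decide)) (ne _ _ (by decide)) (ne _ _ (by decide)) (ne _ _ (by decide)) (ne _ _ (by decide))
  have r56 := edge hφ n56 n65 (ne _ _ (by decide)) (ne _ _ (by decide)) (ne _ _ (by decide)) (ne _ _ (by decide)) (ne _ _ (by decide)) (ne _ _ (by decide))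
  have p0a := pr hφ a01 a03 (ne _ _ (by decide))
  have p0b := pr hφ a01 a05 (ne _ _ (by decide))
  have p0c := pr hφ a03 a05 (ne _ _ (by decide))
  have p1a := pr hφ a01.symm a12 (ne _ _ (by decide))
  have p1b := pr hφ a01.symm a14 (ne _ _ (by decide))
  have p1c := pr hφ a12 a14 (ne _ _ (by decide))
  have p2a := pr hφ a12.symm a23 (ne _ _ (by decide))
  have p2b := pr hφ a12.symm a25 (ne _ _ (by decide))
  have p2c := pr hφ a23 a25 (ne _ _ (by decide))
  have p3a := pr hφ a03.symm a23.symm (ne _ _ (by decide))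
  have p3b := pr hφ a03.symm a34 (ne _ _ (by decide))
  have p3c := pr hφ a23.symm a34 (ne _ _ (by decide))
  have p4a := pr hφ a14.symm a34.symm (ne _ _ (by decide))
  have p4b := pr hφ a14.symm a46 (ne _ _ (by decide))
  have p4c := pr hφ a34.symm a46 (ne _ _ (by decide))
  have p5a := pr hφ a05.symm a25.symm (ne _ _ (by decide))
  have p5b := pr hφ a05.symm a56 (ne _ _ (by decide))
  have p5c := pr hφ a25.symm a56 (ne _ _ (by decide))
  have p6a := pr hφ a46.symm a56.symm (ne _ _ (by decide))
  have p6b := pr hφ a46.symm a67 (ne _ _ (by decide))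
  have p6c := pr hφ a56.symm a67 (ne _ _ (by decide))
  simp only [sw 1 0, sw 3 0, sw 5 0, sw 2 1, sw 4 1, sw 3 2, sw 5 2, sw 4 3, sw 6 4, sw 6 5, sw 7 6] at r01 r03 r05 r12 r14 r23 r25 r34 r46 r56 p0a p0b p0c p1a p1b p1c p2a p2b p2c p3a p3b p3c p4a p4b p4c p5a p5b p5c p6a p6b p6c
  exact core (φ s(v 0, v 1)) (φ s(v 0, v 3)) (φ s(v 0, v 5)) (φ s(v 1, v 2)) (φ s(v 1, v 4)) (φ s(v 2, v 3)) (φ s(v 2, v 5)) (φ s(v 3, v 4)) (φ s(v 4, v 6)) (φ s(v 5, v 6)) (φ s(v 6, v 7))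
    (b 0 1 a01 (by decide) (by decide))
    (b 0 3 a03 (by decide) (by decide))
    b05.1 b05.2
    (b 1 2 a12 (by decide) (by decide))
    (b 1 4 a14 (by decide) (by decide))
    (b 2 3 a23 (by decide) (by decide))
    (b 2 5 a25 (by decide) (by decide))
    (b 3 4 a34 (by decide) (by decide))
    (b 4 6 a46 (by decide) (by decide))
    (b 5 6 a56 (by decide) (by decide))
    b67.1
    p0a ⟨p1a, p1b, p1c⟩ ⟨p2a, p2b, p2c⟩ ⟨p3a, p3b, p3c⟩ ⟨p4a, p4b, p4c⟩ p5c p6a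
    r01 r03 r05 r12 r14 r23 r25 r34 r46 r56

/-- Adjacency of a fixed cubic graph on 14 vertices: two copies of subdivided `K₃,₃`
joined by a bridge. -/
def badj (a b : Fin 14) : Bool :=
  (a.val, b.val) ∈ [(0, 1), (0, 3), (0, 5), (1, 2), (1, 4), (2, 3), (2, 5), (3, 4), (4, 6), (5, 6),
    (6, 7), (7, 12), (7, 13), (8, 9), (8, 11), (8, 13), (9, 10), (9, 12), (10, 11), (10, 13),
    (11, 12)]

/-- `n + 1` disjoint copies of the fixed graph. -/
def bigG (n : ℕ) : SimpleGraph (Fin (n + 1) × Fin 14) where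
  Adj x y := x.1 = y.1 ∧ (badj x.2 y.2 || badj y.2 x.2) = true
  symm := ⟨fun x y h => ⟨h.1.symm, by rw [Bool.or_comm]; exact h.2⟩⟩
  loopless := ⟨fun x h => by
    have : ∀ a : Fin 14, ¬ ((badj a a || badj a a) = true) := by decide
    exact this _ h.2⟩

lemma bigG_cubic (n : ℕ) (w : Fin (n + 1) × Fin 14) : ((bigG n).neighborSet w).ncard = 3 := by
  obtain ⟨i, a⟩ := w
  have h : (bigG n).neighborSet (i, a) = (Prod.mk i) ''
      ((Finset.univ.filter fun b => (badj a b || badj b a) = true : Finset (Fin 14)) :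
        Set (Fin 14)) := by
    ext ⟨j, b⟩
    simp only [bigG, SimpleGraph.mem_neighborSet, Set.mem_image, Finset.coe_filter,
      Finset.mem_univ, true_and, Set.mem_ofPred_eq, Prod.mk.injEq]
    constructor
    · rintro ⟨rfl, h⟩
      exact ⟨b, h, rfl, rfl⟩
    · rintro ⟨c, h, rfl, rfl⟩
      exact ⟨rfl, h⟩
  rw [h, Set.ncard_image_of_injective _ (Prod.mk_right_injective i), Set.ncard_coe_finset]
  clear h
  revert a
  decide

end HIProof

/-- Any cubic graph containing the configuration `H_I` (on vertices `v 0, …, v 7`, with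
the listed edges) has list normal chromatic index at least 9, and in particular there are
infinitely many cubic graphs with list normal chromatic index at least 9. -/
theorem cubic_with_HI_list_normal_ge_nine :
    (∀ (V : Type) (G : SimpleGraph V) (v : Fin 8 → V), Function.Injective v →
      (∀ w, (G.neighborSet w).ncard = 3) →
      G.Adj (v 0) (v 1) → G.Adj (v 0) (v 3) → G.Adj (v 0) (v 5) →
      G.Adj (v 1) (v 2) → G.Adj (v 1) (v 4) →
      G.Adj (v 2) (v 3) → G.Adj (v 2) (v 5) →
      G.Adj (v 3) (v 4) →
      G.Adj (v 4) (v 6) → G.Adj (v 5) (v 6) → G.Adj (v 6) (v 7) →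
      ∃ L : Sym2 V → Finset ℕ, (∀ e ∈ G.edgeSet, (L e).card = 8) ∧
        ¬ ∃ φ : Sym2 V → ℕ, IsNormalEdgeColoring G φ ∧ ∀ e ∈ G.edgeSet, φ e ∈ L e) ∧
    (∀ n : ℕ, ∃ (V : Type) (G : SimpleGraph V), Finite V ∧ n ≤ Nat.card V ∧
      (∀ w, (G.neighborSet w).ncard = 3) ∧
      ∃ L : Sym2 V → Finset ℕ, (∀ e ∈ G.edgeSet, (L e).card = 8) ∧
        ¬ ∃ φ : Sym2 V → ℕ, IsNormalEdgeColoring G φ ∧ ∀ e ∈ G.edgeSet, φ e ∈ L e) := by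
  refine ⟨HIProof.main, fun n => ⟨Fin (n + 1) × Fin 14, HIProof.bigG n, inferInstance, ?_,
    HIProof.bigG_cubic n, ?_⟩⟩
  · simp
    omega
  · refine HIProof.main _ (HIProof.bigG n) (fun i => (0, i.castLE (by norm_num))) ?_
      (HIProof.bigG_cubic n) ?_ ?_ ?_ ?_ ?_ ?_ ?_ ?_ ?_ ?_ ?_
    · intro i j h
      simpa using h
    all_goals exact ⟨rfl, rfl⟩
end
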